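/- Let q be the Kronig–Penney potential, let n ≥ 1 satisfy Condition 1, and let r, s be positive integers. Then the equation λ = n² + g_n(λ) has exactly one solution ρ_n in the interval I_n = [n² − M, n² + M]. -/

import Mathlib

open MeasureTheory Filter Asymptotics

/-- Cosine Fourier coefficients `C_k = (1/π) ∫₀^π q(x) cos(kx) dx` of a real potential. -/
noncomputable def cosCoefR (q : ℝ → ℝ) (k : ℤ) : ℝ :=
  (1 / Real.pi) * ∫ x in (0:ℝ)..Real.pi, q x * Real.cos ((k : ℝ) * x)

/-- `λ` is a Dirichlet eigenvalue of `L(q) = −d²/dx² + q` on `[0,π]` with eigenfunction `y`: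
`y` is nontrivial, `y, y′` are absolutely continuous, `−y″ + q y = λ y` a.e. and
`y(0) = y(π) = 0`.  Absolute continuity and the a.e. differential equation are expressed
in their equivalent integral form. -/
def IsDirichletEigenpair (q : ℝ → ℂ) (lam : ℂ) (y : ℝ → ℂ) : Prop :=
  ∃ g : ℝ → ℂ,
    (∃ x ∈ Set.Icc (0:ℝ) Real.pi, y x ≠ 0) ∧
    IntervalIntegrable g volume 0 Real.pi ∧
    IntervalIntegrable (fun t => (q t - lam) * y t) volume 0 Real.pi ∧
    (∀ x ∈ Set.Icc (0:ℝ) Real.pi, y x = y 0 + ∫ t in (0:ℝ)..x, g t) ∧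
    (∀ x ∈ Set.Icc (0:ℝ) Real.pi, g x = g 0 + ∫ t in (0:ℝ)..x, (q t - lam) * y t) ∧
    y 0 = 0 ∧ y Real.pi = 0

/-- `λ` is a Dirichlet eigenvalue of `L(q)` on `[0,π]`. -/
def IsDirichletEV (q : ℝ → ℂ) (lam : ℂ) : Prop :=
  ∃ y : ℝ → ℂ, IsDirichletEigenpair q lam y

/-- Condition 1 for the index `n`: `M ≤ 1/2` if `n = 1`, and `M < (2n−1)/2` if `n > 1`. -/
def Cond1 (M : ℝ) (n : ℕ) : Prop :=
  (n = 1 → M ≤ 1 / 2) ∧ (1 < n → M < (2 * (n : ℝ) - 1) / 2)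

/-- The partial sum `n_1 + ⋯ + n_{j}` of the multi-index `v = (n_1, …, n_k)`. -/
def psum {k : ℕ} (v : Fin k → ℤ) (j : Fin k) : ℤ :=
  ∑ i ∈ Finset.univ.filter (fun i => i ≤ j), v i

/-- Admissibility of a multi-index: every partial sum avoids `0` and `−2n`. -/
def adm (n : ℕ) {k : ℕ} (v : Fin k → ℤ) : Prop :=
  ∀ j : Fin k, psum v j ≠ 0 ∧ psum v j ≠ -(2 * (n : ℤ))

instance (n : ℕ) {k : ℕ} (v : Fin k → ℤ) : Decidable (adm n v) := by
  unfold adm; infer_instance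

/-- The general term of `a_k(λ)`:
`C_{n_1}⋯C_{n_k}(C_{n_1+⋯+n_k} − C_{n_1+⋯+n_k+2n}) / Π_j (λ − (n+n_1+⋯+n_j)²)`. -/
noncomputable def aTerm (C : ℤ → ℝ) (n : ℕ) (k : ℕ) (lam : ℝ) (v : Fin k → ℤ) : ℝ :=
  if adm n v then
    ((∏ i, C (v i)) * (C (∑ i, v i) - C ((∑ i, v i) + 2 * n))) /
      ∏ j, (lam - ((n : ℝ) + ((psum v j : ℤ) : ℝ))^2)
  else 0

/-- `a_k(λ)`, the full series over `ℤ^k` of admissible multi-indices. -/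
noncomputable def aSum (C : ℤ → ℝ) (n k : ℕ) (lam : ℝ) : ℝ :=
  ∑' v : Fin k → ℤ, aTerm C n k lam v

/-- The truncated sum `a_{r,k,n}(λ)`, over multi-indices with entries in `[−r, r]`. -/
noncomputable def aTrunc (C : ℤ → ℝ) (n k r : ℕ) (lam : ℝ) : ℝ :=
  ∑' v : Fin k → ℤ,
    if ∀ i, -(r : ℤ) ≤ v i ∧ v i ≤ (r : ℤ) then aTerm C n k lam v else 0

/-- `g_n(λ) = −C_{2n} + Σ_{k=1}^{s} a_{r,k,n}(λ)`. -/
noncomputable def gFun (C : ℤ → ℝ) (n r s : ℕ) (lam : ℝ) : ℝ :=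
  -C (2 * n) + ∑ k ∈ Finset.Icc 1 s, aTrunc C n k r lam



namespace KP

/-- iterates `(T D)^j f` on a finite set of sites -/
noncomputable def it (S : Finset ℕ) (T : ℕ → ℕ → ℝ) (D f : ℕ → ℝ) : ℕ → ℕ → ℝ
  | 0 => f
  | j + 1 => fun p => ∑ l ∈ S, T p l * D l * it S T D f j l

theorem it_nonneg {S : Finset ℕ} {T : ℕ → ℕ → ℝ} {D f : ℕ → ℝ}
    (hT : ∀ p ∈ S, ∀ l ∈ S, 0 ≤ T p l) (hD : ∀ p ∈ S, 0 ≤ D p) (hf : ∀ p ∈ S, 0 ≤ f p)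
    (j : ℕ) : ∀ p ∈ S, 0 ≤ it S T D f j p := by
  induction j with
  | zero => exact hf
  | succ j ih =>
    intro p hp
    exact Finset.sum_nonneg fun l hl => mul_nonneg (mul_nonneg (hT p hp l hl) (hD l hl)) (ih l hl)

theorem it_abs {S : Finset ℕ} {T T' : ℕ → ℕ → ℝ} {D f D' f' : ℕ → ℝ}
    (hT : ∀ p ∈ S, ∀ l ∈ S, |T p l| ≤ T' p l) (hD : ∀ p ∈ S, |D p| ≤ D' p)
    (hf : ∀ p ∈ S, |f p| ≤ f' p)
    (j : ℕ) : ∀ p ∈ S, |it S T D f j p| ≤ it S T' D' f' j p := by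
  induction j with
  | zero => exact hf
  | succ j ih =>
    intro p hp
    refine (Finset.abs_sum_le_sum_abs _ _).trans (Finset.sum_le_sum fun l hl => ?_)
    rw [abs_mul, abs_mul]
    have h1 := hT p hp l hl
    have h2 := hD l hl
    have h3 := ih l hl
    have h1' := (abs_nonneg _).trans h1
    have h2' := (abs_nonneg _).trans h2
    gcongr

theorem it_sum {S : Finset ℕ} {T : ℕ → ℕ → ℝ} {D f W : ℕ → ℝ}
    (hT : ∀ p ∈ S, ∀ l ∈ S, 0 ≤ T p l) (hD : ∀ p ∈ S, 0 ≤ D p)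
    (hW0 : ∀ p ∈ S, 0 ≤ W p)
    (hW : ∀ p ∈ S, f p + ∑ l ∈ S, T p l * D l * W l ≤ W p) (N : ℕ) :
    ∀ p ∈ S, ∑ j ∈ Finset.range N, it S T D f j p ≤ W p := by
  induction N with
  | zero => intro p hp; simpa using hW0 p hp
  | succ N ih =>
    intro p hp
    rw [Finset.sum_range_succ']
    have : ∑ k ∈ Finset.range N, it S T D f (k+1) p
        = ∑ l ∈ S, T p l * D l * ∑ k ∈ Finset.range N, it S T D f k l := by
      simp only [it, Finset.mul_sum]
      rw [Finset.sum_comm]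
    rw [this]
    have h2 : ∑ l ∈ S, T p l * D l * ∑ k ∈ Finset.range N, it S T D f k l
        ≤ ∑ l ∈ S, T p l * D l * W l :=
      Finset.sum_le_sum fun l hl => mul_le_mul_of_nonneg_left (ih l hl)
        (mul_nonneg (hT p hp l hl) (hD l hl))
    have := hW p hp
    show _ + f p ≤ _
    linarith

/-- `⟨(T D₁)^i u, E (T D₂)^j f⟩` -/
noncomputable def pair (S : Finset ℕ) (T : ℕ → ℕ → ℝ) (u f D1 E D2 : ℕ → ℝ) (i j : ℕ) : ℝ :=
  ∑ p ∈ S, it S T D1 u i p * E p * it S T D2 f j p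

theorem pair_shift {S : Finset ℕ} {T : ℕ → ℕ → ℝ} (hT : ∀ p l, T p l = T l p)
    (u f D1 D2 : ℕ → ℝ) (i j : ℕ) :
    pair S T u f D1 D1 D2 i (j+1) = pair S T u f D1 D2 D2 (i+1) j := by
  simp only [pair, it, Finset.mul_sum, Finset.sum_mul]
  rw [Finset.sum_comm]
  refine Finset.sum_congr rfl fun p _ => Finset.sum_congr rfl fun l _ => ?_
  rw [hT p l]; ring

/-- the `k+1`-st term of the series -/
noncomputable def aa (S : Finset ℕ) (T : ℕ → ℕ → ℝ) (u f D : ℕ → ℝ) (k : ℕ) : ℝ :=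
  ∑ p ∈ S, u p * D p * it S T D f k p

theorem aa_eq {S : Finset ℕ} {T : ℕ → ℕ → ℝ} (hT : ∀ p l, T p l = T l p)
    (u f D : ℕ → ℝ) (i j : ℕ) : pair S T u f D D D i j = aa S T u f D (i+j) := by
  induction i generalizing j with
  | zero => simp [pair, aa, it]
  | succ i ih => rw [← pair_shift hT, ih]; congr 1; ring

theorem aa_diff {S : Finset ℕ} {T : ℕ → ℕ → ℝ} (hT : ∀ p l, T p l = T l p)
    (u f D1 D2 : ℕ → ℝ) (k : ℕ) :
    aa S T u f D1 k - aa S T u f D2 k =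
      ∑ i ∈ Finset.range (k+1), ∑ p ∈ S,
        it S T D1 u i p * (D1 p - D2 p) * it S T D2 f (k-i) p := by
  have h1 : ∀ i ∈ Finset.range (k+1), ∑ p ∈ S,
        it S T D1 u i p * (D1 p - D2 p) * it S T D2 f (k-i) p
      = pair S T u f D1 D2 D2 (i+1) (k-(i+1)) * (if i = k then 0 else 1)
        + (if i = k then aa S T u f D1 k else 0) - pair S T u f D1 D2 D2 i (k-i) := by
    intro i hi
    have : ∑ p ∈ S, it S T D1 u i p * (D1 p - D2 p) * it S T D2 f (k-i) p
        = pair S T u f D1 D1 D2 i (k-i) - pair S T u f D1 D2 D2 i (k-i) := by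
      simp only [pair, ← Finset.sum_sub_distrib]
      refine Finset.sum_congr rfl fun p _ => by ring
    rw [this]
    have hi' : i ≤ k := by simpa [Nat.lt_succ_iff] using hi
    rcases hi'.eq_or_lt with h | h
    · subst h
      simp
      have := aa_eq (S := S) hT u f D1 i 0
      simp only [pair, it, Nat.add_zero] at this ⊢
      exact this
    · have e : k - i = (k - (i+1)) + 1 := by omega
      simp only [h.ne, if_false, mul_one, add_zero]
      rw [e, pair_shift hT]
  rw [Finset.sum_congr rfl h1, Finset.sum_sub_distrib, Finset.sum_add_distrib]
  rw [Finset.sum_range_succ, Finset.sum_range_succ' (fun i => pair S T u f D1 D2 D2 i (k-i))]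
  have h2 : ∑ x ∈ Finset.range k, pair S T u f D1 D2 D2 (x+1) (k-(x+1)) * (if x = k then (0:ℝ) else 1)
      = ∑ x ∈ Finset.range k, pair S T u f D1 D2 D2 (x+1) (k-(x+1)) := by
    refine Finset.sum_congr rfl fun x hx => ?_
    have : x ≠ k := by have := Finset.mem_range.1 hx; omega
    simp [this]
  rw [h2]
  simp [aa, pair, it]

theorem tri_le (a : ℕ → ℝ) (ha : ∀ i, 0 ≤ a i) (s : ℕ) :
    ∑ m ∈ Finset.range s, ∑ k ∈ Finset.range (s - m), a m * a k
      ≤ (∑ m ∈ Finset.range s, a m)^2 := by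
  rw [sq, Finset.sum_mul_sum]
  refine Finset.sum_le_sum fun m _ => ?_
  exact Finset.sum_le_sum_of_subset_of_nonneg (by intro x hx; simp at hx ⊢; omega)
    fun _ _ _ => mul_nonneg (ha _) (ha _)

/-- derivative estimate -/
theorem der_bound {S : Finset ℕ} {T T' : ℕ → ℕ → ℝ} {u f D1 D2 D' f' W e : ℕ → ℝ} {Δ : ℝ}
    (hsym : ∀ p l, T p l = T l p)
    (hT : ∀ p ∈ S, ∀ l ∈ S, |T p l| ≤ T' p l)
    (hD1 : ∀ p ∈ S, |D1 p| ≤ D' p) (hD2 : ∀ p ∈ S, |D2 p| ≤ D' p)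
    (hu : ∀ p ∈ S, |u p| ≤ f' p) (hf : ∀ p ∈ S, |f p| ≤ f' p)
    (hW : ∀ p ∈ S, f' p + ∑ l ∈ S, T' p l * D' l * W l ≤ W p)
    (hW0 : ∀ p ∈ S, 0 ≤ W p)
    (hDD : ∀ p ∈ S, D1 p - D2 p = -Δ * (D1 p * D2 p)) (hpos : ∀ p ∈ S, 0 ≤ D1 p * D2 p)
    (hΔ : 0 ≤ Δ) (he0 : ∀ p ∈ S, 0 ≤ e p) (he : ∀ p ∈ S, -(e p) ≤ u p * f p) (s : ℕ) (hs : 1 ≤ s) :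
    ∑ k ∈ Finset.range s, aa S T u f D1 k - ∑ k ∈ Finset.range s, aa S T u f D2 k
      ≤ Δ * ∑ p ∈ S, (D' p)^2 * ((W p)^2 - (f' p)^2 + e p) := by
  have hD'0 : ∀ p ∈ S, 0 ≤ D' p := fun p hp => (abs_nonneg _).trans (hD1 p hp)
  have hT'0 : ∀ p ∈ S, ∀ l ∈ S, 0 ≤ T' p l := fun p hp l hl => (abs_nonneg _).trans (hT p hp l hl)
  have hf'0 : ∀ p ∈ S, 0 ≤ f' p := fun p hp => (abs_nonneg _).trans (hf p hp)
  rw [← Finset.sum_sub_distrib, Finset.sum_congr rfl fun k _ => aa_diff hsym u f D1 D2 k,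
    Finset.sum_range_diag_flip s (fun i j => ∑ p ∈ S,
        it S T D1 u i p * (D1 p - D2 p) * it S T D2 f j p)]
  set w : ℕ → ℕ → ℝ := fun j p => it S T' D' f' j p with hw
  have hw0 : ∀ j, ∀ p ∈ S, 0 ≤ w j p := fun j => it_nonneg hT'0 hD'0 hf'0 j
  have key : ∀ m k, ∑ p ∈ S, it S T D1 u m p * (D1 p - D2 p) * it S T D2 f k p
      ≤ Δ * ∑ p ∈ S, (D' p)^2 * (w m p * w k p + if m = 0 ∧ k = 0 then e p - (f' p)^2 else 0) := by
    intro m k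
    rw [Finset.mul_sum]
    refine Finset.sum_le_sum fun p hp => ?_
    have hdd : D1 p * D2 p ≤ (D' p)^2 := by
      calc D1 p * D2 p ≤ |D1 p * D2 p| := le_abs_self _
        _ = |D1 p| * |D2 p| := abs_mul _ _
        _ ≤ D' p * D' p := mul_le_mul (hD1 p hp) (hD2 p hp) (abs_nonneg _) (hD'0 p hp)
        _ = _ := by ring
    rw [hDD p hp]
    by_cases h : m = 0 ∧ k = 0
    · obtain ⟨rfl, rfl⟩ := h
      simp only [it, hw, and_self, if_true]
      have h1 := he p hp
      have h2 := he0 p hp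
      have h3 := hpos p hp
      have : u p * (-Δ * (D1 p * D2 p)) * f p = Δ * ((D1 p * D2 p) * (-(u p * f p))) := by ring
      rw [this]
      refine mul_le_mul_of_nonneg_left ?_ hΔ
      calc (D1 p * D2 p) * (-(u p * f p)) ≤ (D1 p * D2 p) * e p :=
            mul_le_mul_of_nonneg_left (by linarith) h3
        _ ≤ (D' p)^2 * e p := mul_le_mul_of_nonneg_right hdd h2
        _ = _ := by ring
    · simp only [h, if_false, add_zero]
      have h1 := it_abs hT hD1 hu m p hp
      have h2 := it_abs hT hD2 hf k p hp
      have h3 := hpos p hp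
      have e1 : it S T D1 u m p * (-Δ * (D1 p * D2 p)) * it S T D2 f k p
        = Δ * ((D1 p * D2 p) * (-(it S T D1 u m p * it S T D2 f k p))) := by ring
      rw [e1]
      refine mul_le_mul_of_nonneg_left ?_ hΔ
      have h4 : -(it S T D1 u m p * it S T D2 f k p) ≤ w m p * w k p := by
        calc -(it S T D1 u m p * it S T D2 f k p) ≤ |it S T D1 u m p * it S T D2 f k p| := neg_le_abs _
          _ = |it S T D1 u m p| * |it S T D2 f k p| := abs_mul _ _
          _ ≤ _ := mul_le_mul h1 h2 (abs_nonneg _) (hw0 m p hp)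
      calc _ ≤ (D1 p * D2 p) * (w m p * w k p) := mul_le_mul_of_nonneg_left h4 h3
        _ ≤ _ := mul_le_mul_of_nonneg_right hdd (mul_nonneg (hw0 m p hp) (hw0 k p hp))
  calc _ ≤ ∑ m ∈ Finset.range s, ∑ k ∈ Finset.range (s - m),
        Δ * ∑ p ∈ S, (D' p)^2 * (w m p * w k p + if m = 0 ∧ k = 0 then e p - (f' p)^2 else 0) :=
        Finset.sum_le_sum fun m _ => Finset.sum_le_sum fun k _ => key m k
    _ = Δ * ∑ p ∈ S, (D' p)^2 * (∑ m ∈ Finset.range s, ∑ k ∈ Finset.range (s - m), w m p * w k p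
          + (e p - (f' p)^2)) := by
        simp only [← Finset.mul_sum]
        congr 1
        have : ∀ m, ∑ k ∈ Finset.range (s-m), ∑ p ∈ S, (D' p)^2 *
            (w m p * w k p + if m = 0 ∧ k = 0 then e p - (f' p)^2 else 0)
            = ∑ p ∈ S, (D' p)^2 * ∑ k ∈ Finset.range (s-m),
            (w m p * w k p + if m = 0 ∧ k = 0 then e p - (f' p)^2 else 0) := by
          intro m; rw [Finset.sum_comm]; simp only [Finset.mul_sum]
        simp only [this]
        rw [Finset.sum_comm]
        refine Finset.sum_congr rfl fun p _ => ?_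
        rw [← Finset.mul_sum]
        congr 1
        simp only [Finset.sum_add_distrib]
        simp only [Finset.mul_sum]
        congr 1
        rw [Finset.sum_eq_single 0]
        · rw [Finset.sum_eq_single 0]
          · simp
          · intro b _ hb; simp [hb]
          · intro h; simp at h; omega
        · intro b _ hb; simp [hb]
        · intro h; simp at h; omega
    _ ≤ _ := by
        refine mul_le_mul_of_nonneg_left (Finset.sum_le_sum fun p hp => ?_) hΔ
        refine mul_le_mul_of_nonneg_left ?_ (sq_nonneg _)
        have h1 : ∑ m ∈ Finset.range s, ∑ k ∈ Finset.range (s - m), w m p * w k p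
            ≤ (∑ m ∈ Finset.range s, w m p)^2 := tri_le (fun j => w j p) (fun j => hw0 j p hp) s
        have h2 := it_sum hT'0 hD'0 hW0 hW s p hp
        have h3 : 0 ≤ ∑ m ∈ Finset.range s, w m p := Finset.sum_nonneg fun j _ => hw0 j p hp
        have h4 : (∑ m ∈ Finset.range s, w m p)^2 ≤ (W p)^2 := by
          apply pow_le_pow_left₀ h3 h2
        linarith

/-- all terms but the first -/
theorem rest_bound {S : Finset ℕ} {T T' : ℕ → ℕ → ℝ} {u f D D' f' W : ℕ → ℝ}
    (hT : ∀ p ∈ S, ∀ l ∈ S, |T p l| ≤ T' p l)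
    (hD : ∀ p ∈ S, |D p| ≤ D' p)
    (hu : ∀ p ∈ S, |u p| ≤ f' p) (hf : ∀ p ∈ S, |f p| ≤ f' p)
    (hW : ∀ p ∈ S, f' p + ∑ l ∈ S, T' p l * D' l * W l ≤ W p)
    (hW0 : ∀ p ∈ S, 0 ≤ W p) (s : ℕ) (hs : 1 ≤ s) :
    |∑ k ∈ Finset.range s, aa S T u f D k - ∑ p ∈ S, u p * f p * D p|
      ≤ ∑ p ∈ S, f' p * D' p * (W p - f' p) := by
  have hD'0 : ∀ p ∈ S, 0 ≤ D' p := fun p hp => (abs_nonneg _).trans (hD p hp)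
  have hT'0 : ∀ p ∈ S, ∀ l ∈ S, 0 ≤ T' p l := fun p hp l hl => (abs_nonneg _).trans (hT p hp l hl)
  have hf'0 : ∀ p ∈ S, 0 ≤ f' p := fun p hp => (abs_nonneg _).trans (hf p hp)
  obtain ⟨s, rfl⟩ : ∃ s', s = s' + 1 := ⟨s - 1, by omega⟩
  rw [Finset.sum_range_succ']
  have e0 : aa S T u f D 0 = ∑ p ∈ S, u p * f p * D p := by
    simp only [aa, it]; exact Finset.sum_congr rfl fun p _ => by ring
  rw [e0, add_sub_cancel_right]
  have e1 : ∑ k ∈ Finset.range s, aa S T u f D (k+1)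
      = ∑ p ∈ S, u p * D p * ∑ k ∈ Finset.range s, it S T D f (k+1) p := by
    simp only [aa, Finset.mul_sum]; rw [Finset.sum_comm]
  rw [e1]
  refine (Finset.abs_sum_le_sum_abs _ _).trans (Finset.sum_le_sum fun p hp => ?_)
  rw [abs_mul, abs_mul]
  have h1 := it_sum hT'0 hD'0 hW0 hW (s+1) p hp
  rw [Finset.sum_range_succ'] at h1
  have h2 : |∑ k ∈ Finset.range s, it S T D f (k+1) p| ≤ ∑ k ∈ Finset.range s, it S T' D' f' (k+1) p :=
    (Finset.abs_sum_le_sum_abs _ _).trans (Finset.sum_le_sum fun k _ => it_abs hT hD hf (k+1) p hp)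
  have h3 : |∑ k ∈ Finset.range s, it S T D f (k+1) p| ≤ W p - f' p := by
    have : it S T' D' f' 0 p = f' p := rfl
    linarith
  exact mul_le_mul (mul_le_mul (hu p hp) (hD p hp) (abs_nonneg _) (hf'0 p hp)) h3 (abs_nonneg _)
    (mul_nonneg (hf'0 p hp) (hD'0 p hp))

end KP


namespace KP

/-- harmonic numbers -/
noncomputable def Hm (m : ℕ) : ℝ := ∑ i ∈ Finset.range m, 1 / ((i : ℝ) + 1)

theorem Hm_succ (m : ℕ) : Hm (m+1) = Hm m + 1 / ((m:ℝ)+1) := by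
  simp [Hm, Finset.sum_range_succ]

theorem Hm_mono {a b : ℕ} (h : a ≤ b) : Hm a ≤ Hm b := by
  unfold Hm
  exact Finset.sum_le_sum_of_subset_of_nonneg (Finset.range_mono h) fun _ _ _ => by positivity

theorem sum_Ioc_succ (f : ℕ → ℝ) {R K : ℕ} (h : R ≤ K) :
    ∑ k ∈ Finset.Ioc R (K+1), f k = ∑ k ∈ Finset.Ioc R K, f k + f (K+1) := by
  rw [Finset.sum_Ioc_succ_top h]

theorem sumA_eq {R K j : ℕ} (hj : 0 < j) (hjR : j ≤ R) (hK : R ≤ K) :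
    ∑ k ∈ Finset.Ioc R K, 1 / (((k:ℝ) - j) * k)
      = (1 / (j:ℝ)) * (Hm R - Hm (R - j) - Hm K + Hm (K - j)) := by
  induction K, hK using Nat.le_induction with
  | base => simp
  | succ K hK ih =>
    rw [sum_Ioc_succ _ hK, ih]
    have e : K + 1 - j = (K - j) + 1 := by omega
    rw [e, Hm_succ, Hm_succ]
    have hj0 : (0:ℝ) < j := by exact_mod_cast hj
    have h1 : ((K - j : ℕ) : ℝ) = K - j := by push_cast [Nat.cast_sub (hjR.trans hK)]; ring
    have h2 : (j:ℝ) ≤ K := by exact_mod_cast hjR.trans hK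
    rw [h1]
    have h3 : (0:ℝ) < K - j + 1 := by linarith
    have h4 : (K:ℝ) + 1 ≠ 0 := by positivity
    have h5 : (K:ℝ) + 1 - j ≠ 0 := by linarith
    have h3' := h3.ne'
    push_cast
    field_simp
    ring

theorem sumA {R K j : ℕ} (hj : 0 < j) (hjR : j ≤ R) :
    ∑ k ∈ Finset.Ioc R K, 1 / (((k:ℝ) - j) * k) ≤ (1 / (j:ℝ)) * (Hm R - Hm (R - j)) := by
  rcases le_total R K with h | h
  · rw [sumA_eq hj hjR h]
    have := Hm_mono (show K - j ≤ K by omega)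
    apply mul_le_mul_of_nonneg_left _ (by positivity)
    linarith
  · rw [Finset.Ioc_eq_empty (by omega)]
    have := Hm_mono (show R - j ≤ R by omega)
    simp
    apply mul_nonneg (by positivity); linarith

theorem sumB {R K a : ℕ} (ha : 0 < a) :
    ∑ k ∈ Finset.Ioc R K, 1 / (((k:ℝ) + a) * k) ≤ (1 / (a:ℝ)) * (Hm (R + a) - Hm R) := by
  have ha0 : (0:ℝ) < a := by exact_mod_cast ha
  rcases le_total R K with h | h
  · have : ∑ k ∈ Finset.Ioc R K, 1 / (((k:ℝ) + a) * k)
        = (1 / (a:ℝ)) * (Hm (R+a) - Hm R - Hm (K+a) + Hm K) := by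
      induction K, h using Nat.le_induction with
      | base => simp
      | succ K hK ih =>
        rw [sum_Ioc_succ _ hK, ih]
        have e : K + 1 + a = (K + a) + 1 := by omega
        rw [e, Hm_succ, Hm_succ]
        push_cast
        field_simp
        ring
    rw [this]
    have := Hm_mono (show K ≤ K + a by omega)
    apply mul_le_mul_of_nonneg_left _ (by positivity)
    linarith
  · rw [Finset.Ioc_eq_empty (by omega)]
    have := Hm_mono (show R ≤ R + a by omega)
    simp
    apply mul_nonneg (by positivity); linarith

theorem sumC (R K : ℕ) :
    ∑ k ∈ Finset.Ioc R K, 1 / ((k:ℝ) * k) ≤ 1 / ((R:ℝ) + 1/2) := by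
  rcases le_total R K with h | h
  · have : ∑ k ∈ Finset.Ioc R K, 1 / ((k:ℝ) * k) ≤ 1 / ((R:ℝ) + 1/2) - 1 / ((K:ℝ)+1/2) := by
      induction K, h using Nat.le_induction with
      | base => simp
      | succ K hK ih =>
        rw [sum_Ioc_succ _ hK]
        have : 1 / (((K+1:ℕ):ℝ) * ((K+1:ℕ):ℝ)) ≤ 1 / ((K:ℝ)+1/2) - 1 / (((K+1:ℕ):ℝ)+1/2) := by
          push_cast
          rw [div_sub_div _ _ (by positivity) (by positivity), div_le_div_iff₀ (by positivity) (by positivity)]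
          ring_nf
          nlinarith [Nat.cast_nonneg (α := ℝ) K]
        linarith
    have : 0 ≤ 1 / ((K:ℝ)+1/2) := by positivity
    linarith
  · rw [Finset.Ioc_eq_empty (by omega)]; simp; positivity

/-- part `k < j` -/
theorem sumD1 {R j : ℕ} (h : R < j) :
    ∑ k ∈ Finset.Ioc R (j-1), 1 / (((j:ℝ) - k) * k)
      = (1 / (j:ℝ)) * (Hm (j-1) - Hm R + Hm (j - R - 1)) := by
  have hj0 : (0:ℝ) < j := by exact_mod_cast (by omega : 0 < j)
  have h1 : ∀ k ∈ Finset.Ioc R (j-1), 1 / (((j:ℝ) - k) * k) = (1/(j:ℝ)) * (1 / (k:ℝ) + 1 / ((j:ℝ) - k)) := by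
    intro k hk
    simp only [Finset.mem_Ioc] at hk
    have : (0:ℝ) < k := by exact_mod_cast (by omega : 0 < k)
    have : (0:ℝ) < j - k := by
      have : (k:ℝ) < j := by exact_mod_cast (by omega : k < j)
      linarith
    field_simp
    ring
  rw [Finset.sum_congr rfl h1, ← Finset.mul_sum, Finset.sum_add_distrib]
  congr 1
  congr 1
  · have : ∀ K, R ≤ K → ∑ k ∈ Finset.Ioc R K, 1 / (k:ℝ) = Hm K - Hm R := by
      intro K hK
      induction K, hK using Nat.le_induction with
      | base => simp
      | succ K hK ih => rw [sum_Ioc_succ _ hK, ih, Hm_succ]; push_cast; ring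
    exact this _ (by omega)
  · unfold Hm
    refine Finset.sum_nbij' (fun k => j - 1 - k) (fun i => j - 1 - i) ?_ ?_ ?_ ?_ ?_
    · intro k hk; simp at hk ⊢; omega
    · intro k hk; simp at hk ⊢; omega
    · intro k hk; simp at hk ⊢; omega
    · intro k hk; simp at hk ⊢; omega
    · intro k hk
      simp at hk
      have : ((j - 1 - k : ℕ):ℝ) = (j:ℝ) - 1 - k := by
        rw [Nat.cast_sub (by omega), Nat.cast_sub (by omega)]; simp
      rw [this]; ring_nf

noncomputable def aS : ℝ := 0.4367

theorem aS_aux (j : ℕ) (hj : 9 ≤ j) : Hm j + (Hm (j-1) - Hm 8 + Hm (j - 8 - 1)) ≤ aS * j := by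
  have base : ∀ j, 9 ≤ j → j ≤ 15 → Hm j + (Hm (j-1) - Hm 8 + Hm (j - 8 - 1)) ≤ aS * j := by
    intro j h1 h2
    interval_cases j <;> norm_num [Hm, Finset.sum_range_succ, aS]
  rcases le_total j 15 with h | h
  · exact base j hj h
  · induction j, h using Nat.le_induction with
    | base => exact base 15 (by norm_num) (by norm_num)
    | succ j h ih =>
      have ih := ih (by omega)
      obtain ⟨i, rfl⟩ : ∃ i, j = i + 9 := ⟨j - 9, by omega⟩
      have e1 : i + 9 - 1 = i + 8 := by omega
      have e2 : i + 9 + 1 - 1 = (i + 8) + 1 := by omega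
      have e3 : i + 9 - 8 - 1 = i := by omega
      have e4 : i + 9 + 1 - 8 - 1 = i + 1 := by omega
      rw [e1, e3] at ih
      rw [e2, e4, Hm_succ (i+9), Hm_succ (i+8), Hm_succ i]
      have hi : (6:ℝ) ≤ i := by exact_mod_cast (by omega : 6 ≤ i)
      push_cast
      push_cast at ih
      have b1 : 1 / ((i:ℝ) + 1) ≤ 1/7 := by
        rw [div_le_div_iff₀ (by positivity) (by norm_num)]; linarith
      have b2 : 1 / ((i:ℝ) + 8 + 1) ≤ 1/15 := by
        rw [div_le_div_iff₀ (by positivity) (by norm_num)]; linarith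
      have b3 : 1 / ((i:ℝ) + 9 + 1) ≤ 1/16 := by
        rw [div_le_div_iff₀ (by positivity) (by norm_num)]; linarith
      have haS : aS = 4367/10000 := by norm_num [aS]
      rw [haS] at ih ⊢
      have q : Hm (i+9) = Hm (i+8) + 1/((i:ℝ)+8+1) := by
        have := Hm_succ (i+8); push_cast at this; exact this
      rw [q] at ih
      linarith

/-- `∑ 1/(|j-k| k)` for `j > 8` -/
theorem sumD {j K : ℕ} (hj : 9 ≤ j) :
    ∑ k ∈ Finset.Ioc 8 K, 1 / (|(j:ℝ) - k| * k) ≤ aS := by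
  have hj0 : (0:ℝ) < j := by exact_mod_cast (by omega : 0 < j)
  have hsub : ∑ k ∈ Finset.Ioc 8 K, 1 / (|(j:ℝ) - k| * k)
      ≤ ∑ k ∈ Finset.Ioc 8 (j - 1) ∪ ({j} ∪ Finset.Ioc j K), 1 / (|(j:ℝ) - k| * k) := by
    refine Finset.sum_le_sum_of_subset_of_nonneg ?_ fun _ _ _ => by positivity
    intro k hk; simp at hk ⊢; omega
  refine hsub.trans ?_
  rw [Finset.sum_union, Finset.sum_union, Finset.sum_singleton]
  · have e1 : ∑ k ∈ Finset.Ioc 8 (j-1), 1 / (|(j:ℝ) - k| * k) = ∑ k ∈ Finset.Ioc 8 (j-1), 1 / (((j:ℝ) - k) * k) := by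
      refine Finset.sum_congr rfl fun k hk => ?_
      simp at hk
      have : (k:ℝ) ≤ j := by exact_mod_cast (by omega : k ≤ j)
      rw [abs_of_nonneg (by linarith)]
    have e2 : ∑ k ∈ Finset.Ioc j K, 1 / (|(j:ℝ) - k| * k) = ∑ k ∈ Finset.Ioc j K, 1 / (((k:ℝ) - j) * k) := by
      refine Finset.sum_congr rfl fun k hk => ?_
      simp at hk
      have : (j:ℝ) ≤ k := by exact_mod_cast (by omega : j ≤ k)
      rw [abs_sub_comm, abs_of_nonneg (by linarith)]
    rw [e1, e2, sumD1 (by omega)]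
    have := sumA (R := j) (K := K) (j := j) (by omega) le_rfl
    have h0 : Hm (j - j) = 0 := by simp [Hm]
    rw [h0] at this
    have h2 := aS_aux j hj
    simp only [sub_self, abs_zero, zero_mul, div_zero, zero_add]
    calc _ ≤ (1 / (j:ℝ)) * (Hm (j-1) - Hm 8 + Hm (j - 8 - 1)) + (1 / (j:ℝ)) * (Hm j - 0) := by gcongr
      _ = (1/(j:ℝ)) * (Hm j + (Hm (j-1) - Hm 8 + Hm (j - 8 - 1))) := by ring
      _ ≤ (1/(j:ℝ)) * (aS * j) := by gcongr
      _ = aS := by field_simp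
  · simp
  · rw [Finset.disjoint_left]; intro k hk; simp at hk ⊢; omega
end KP


namespace KP

noncomputable def kerR (p n K : ℕ) : ℝ :=
  ∑ k ∈ Finset.Ioc 8 K, (1 / |(p:ℝ) - ((n:ℝ) + k)| + 1 / ((p:ℝ) + n + k)) * (1 / (k:ℝ))

noncomputable def kerL (p n L : ℕ) : ℝ :=
  ∑ k ∈ Finset.Ioc L (n-1), (1 / |(p:ℝ) - ((n:ℝ) - k)| + 1 / ((p:ℝ) + n - k)) *
    (1 / (k:ℝ) + 1 / (2 * (n:ℝ) - k))

noncomputable def bet (a : ℕ) : ℝ := (1 / (a:ℝ)) * (Hm (8 + a) - Hm 8)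

noncomputable def alN (L q : ℕ) : ℝ :=
  if L < q then (1 / ((q - L : ℕ):ℝ)) * (Hm 8 - Hm (8 - (q - L)))
  else if q = L then 1 / ((8:ℝ) + 1/2) else bet (L - q)

theorem kerR_split (p n K : ℕ) : kerR p n K =
    ∑ k ∈ Finset.Ioc 8 K, 1 / (|(p:ℝ) - ((n:ℝ) + k)| * k)
    + ∑ k ∈ Finset.Ioc 8 K, 1 / (((p:ℝ) + n + k) * k) := by
  rw [kerR, ← Finset.sum_add_distrib]
  refine Finset.sum_congr rfl fun k _ => ?_
  rw [add_mul, one_div_mul_one_div, one_div_mul_one_div]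

theorem sumB' {K a : ℕ} {x : ℝ} (ha : 0 < a) (hx : (a:ℝ) ≤ x) :
    ∑ k ∈ Finset.Ioc 8 K, 1 / ((x + k) * k) ≤ bet a := by
  refine le_trans (Finset.sum_le_sum fun k hk => ?_) (sumB (R := 8) (K := K) ha)
  simp at hk
  have : (0:ℝ) < k := by exact_mod_cast (by omega : 0 < k)
  have : (0:ℝ) < a := by exact_mod_cast ha
  rw [add_comm x]
  gcongr

theorem kerR_near {n L p q K a : ℕ} (hp : p + L = n + q) (hq : q ≤ L + 8) (ha : 0 < a)
    (han : a ≤ 2 * n - L) (hL : L < n) : kerR p n K ≤ alN L q + bet a := by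
  rw [kerR_split]
  have hpr : (p:ℝ) + L = n + q := by exact_mod_cast hp
  refine add_le_add ?_ (sumB' ha ?_)
  · unfold alN
    split_ifs with h1 h2
    · refine le_trans (le_of_eq ?_) (sumA (R := 8) (K := K) (j := q - L) (by omega) (by omega))
      refine Finset.sum_congr rfl fun k hk => ?_
      simp at hk
      have e : ((q - L : ℕ):ℝ) = q - L := by rw [Nat.cast_sub h1.le]
      have : (q:ℝ) ≤ L + k := by exact_mod_cast (by omega : q ≤ L + k)
      rw [e, abs_sub_comm, abs_of_nonneg (by linarith)]
      congr 2; linarith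
    · refine le_trans (le_of_eq ?_) (sumC 8 K |>.trans (by norm_num))
      refine Finset.sum_congr rfl fun k hk => ?_
      subst h2
      have : (p:ℝ) - (n + k) = -k := by linarith
      rw [this, abs_neg, Nat.abs_cast]
    · have e : ((L - q : ℕ):ℝ) = L - q := by rw [Nat.cast_sub (by omega)]
      have h3 : (q:ℝ) ≤ L := by exact_mod_cast (by omega : q ≤ L)
      refine le_trans (le_of_eq ?_) (sumB' (K := K) (a := L - q) (by omega) le_rfl)
      refine Finset.sum_congr rfl fun k hk => ?_
      have h4 : (p:ℝ) - (n + k) = -((L:ℝ) - q + k) := by linarith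
      have : (0:ℝ) ≤ (L:ℝ) - q + k := by
        have : (0:ℝ) ≤ k := Nat.cast_nonneg k
        linarith
      rw [h4, abs_neg, abs_of_nonneg this, e]
  · have : a ≤ p + n := by omega
    exact_mod_cast this

theorem kerR_right {n j K a : ℕ} (hj : 9 ≤ j) (ha : 0 < a) (han : a ≤ 2 * n) :
    kerR (n + j) n K ≤ aS + bet a := by
  rw [kerR_split]
  refine add_le_add (le_trans (le_of_eq ?_) (sumD (j := j) (K := K) hj)) (sumB' ha ?_)
  · refine Finset.sum_congr rfl fun k hk => ?_
    push_cast; congr 3; ring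
  · have : a ≤ n + j + n := by omega
    exact_mod_cast this

theorem kerR_left {n p K : ℕ} (hp : p + 9 ≤ n) (hn : 16 ≤ n) :
    kerR p n K ≤ bet 9 + bet 17 ∨ p = 0 := by
  by_cases h0 : p = 0
  · right; exact h0
  left
  rw [kerR_split]
  have hpr : (p:ℝ) + 9 ≤ n := by exact_mod_cast hp
  refine add_le_add ?_ (sumB' (by norm_num) ?_)
  · refine le_trans (le_of_eq ?_) (sumB' (K := K) (a := 9) (x := (n:ℝ) - p) (by norm_num) (by push_cast; linarith))
    refine Finset.sum_congr rfl fun k hk => ?_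
    have h4 : (p:ℝ) - (n + k) = -((n:ℝ) - p + k) := by linarith
    have : (0:ℝ) ≤ (n:ℝ) - p + k := by
      have : (0:ℝ) ≤ k := Nat.cast_nonneg k
      linarith
    rw [h4, abs_neg, abs_of_nonneg this]
  · have : 17 ≤ p + n := by omega
    exact_mod_cast this

/-- reflection of sums -/
theorem sum_reflect (F : ℝ → ℝ) {n L : ℕ} (hL : L < n) :
    ∑ k ∈ Finset.Ioc L (n-1), F (2 * (n:ℝ) - k) = ∑ k ∈ Finset.Ioc n (2*n-L-1), F k := by
  refine Finset.sum_nbij' (fun k => 2*n - k) (fun k => 2*n-k) ?_ ?_ ?_ ?_ ?_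
  · intro k hk; simp at hk ⊢; omega
  · intro k hk; simp at hk ⊢; omega
  · intro k hk; simp at hk ⊢; omega
  · intro k hk; simp at hk ⊢; omega
  · intro k hk
    simp at hk
    congr 1
    rw [Nat.cast_sub (by omega)]; push_cast; ring

theorem sum_unfold (F : ℝ → ℝ) {n L : ℕ} (hL : L < n) (hF : 0 ≤ F n) :
    ∑ k ∈ Finset.Ioc L (n-1), (F k + F (2 * (n:ℝ) - k)) ≤ ∑ k ∈ Finset.Ioc L (2*n-L-1), F k := by
  rw [Finset.sum_add_distrib, sum_reflect F hL]
  have : Finset.Ioc L (2*n-L-1) = Finset.Ioc L (n-1) ∪ ({n} ∪ Finset.Ioc n (2*n-L-1)) := by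
    ext k; simp; omega
  rw [this, Finset.sum_union, Finset.sum_union, Finset.sum_singleton]
  · linarith
  · simp
  · rw [Finset.disjoint_left]; intro k hk; simp at hk ⊢; omega

noncomputable def vv : ℕ → ℝ
  | 0 => 0.0834 | 1 => 0.0870 | 2 => 0.0910 | 3 => 0.0953 | 4 => 0.1000
  | 5 => 0.1053 | 6 => 0.1137 | 7 => 0.1359 | _ => 0.1807

theorem vv_aux {i n : ℕ} (hi : i ≤ 8) (hn : 16 ≤ n) :
    Hm (2*n-9-i) - Hm (8-i) + Hm (2*n-9) - Hm 8 ≤ vv i * (2 * n - i) := by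
  induction n, hn using Nat.le_induction with
  | base => interval_cases i <;> norm_num [Hm, Finset.sum_range_succ, vv]
  | succ n hn ih =>
    obtain ⟨m, rfl⟩ : ∃ m, n = m + 16 := ⟨n - 16, by omega⟩
    have e1 : 2 * (m + 16 + 1) - 9 - i = (2*m + 23 - i) + 1 + 1 := by omega
    have e2 : 2 * (m + 16 + 1) - 9 = (2*m + 23) + 1 + 1 := by omega
    have e3 : 2 * (m + 16) - 9 - i = 2*m+23-i := by omega
    have e4 : 2 * (m + 16) - 9 = 2*m+23 := by omega
    rw [e3, e4] at ih
    rw [e1, e2, Hm_succ, Hm_succ, Hm_succ, Hm_succ]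
    have c1 : ((2*m+23-i : ℕ):ℝ) = 2*m+23-i := by
      rw [Nat.cast_sub (by omega)]; push_cast; ring
    have hm : (0:ℝ) ≤ m := Nat.cast_nonneg m
    have hi' : (i:ℝ) ≤ 8 := by exact_mod_cast hi
    have hi0 : (0:ℝ) ≤ i := Nat.cast_nonneg i
    push_cast [c1]
    push_cast at ih
    have b1 : 1 / (2*(m:ℝ)+23-i+1) ≤ 1/(24-i) := by
      apply one_div_le_one_div_of_le <;> linarith
    have b2 : 1 / (2*(m:ℝ)+23-i+1+1) ≤ 1/(24-i) := by
      apply one_div_le_one_div_of_le <;> linarith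
    have b3 : 1 / (2*(m:ℝ)+23+1) ≤ 1/(24-i) := by
      apply one_div_le_one_div_of_le <;> linarith
    have b4 : 1 / (2*(m:ℝ)+24+1) ≤ 1/(24-i) := by
      apply one_div_le_one_div_of_le <;> linarith
    have b5 : 2 * (1/(24-(i:ℝ))) ≤ vv i := by
      interval_cases i <;> norm_num [vv]
    linarith

noncomputable def lam : ℕ → ℝ
  | 0 => 0.2011 | 1 => 0.2120 | 2 => 0.2250 | 3 => 0.2402 | 4 => 0.2587
  | 5 => 0.2823 | 6 => 0.3167 | 7 => 0.3814 | _ => 0.5205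

theorem sumH {R K : ℕ} (h : R ≤ K) {i : ℕ} (hi : i ≤ R) :
    ∑ k ∈ Finset.Ioc R K, 1 / ((k:ℝ) - i) = Hm (K - i) - Hm (R - i) := by
  induction K, h using Nat.le_induction with
  | base => simp
  | succ K hK ih =>
    have e : K + 1 - i = (K - i) + 1 := by omega
    rw [sum_Ioc_succ _ hK, ih, e, Hm_succ, Nat.cast_sub (by omega)]
    push_cast; ring

/-- the left far sum for `p = n - i + …` -/
theorem kerL_aux {n i : ℕ} (hi : i ≤ 8) (hn : 16 ≤ n) :
    ∑ k ∈ Finset.Ioc 8 (n-1), (1 / ((k:ℝ) - i) + 1 / (2*(n:ℝ) - i - k)) *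
    (1 / (k:ℝ) + 1 / (2 * (n:ℝ) - k)) ≤ lam i := by
  have hn' : (16:ℝ) ≤ n := by exact_mod_cast hn
  have hi' : (i:ℝ) ≤ 8 := by exact_mod_cast hi
  have hi0 : (0:ℝ) ≤ i := Nat.cast_nonneg i
  set F : ℝ → ℝ := fun x => (1 / (x - i)) * (1/x + 1/(2*n-x)) with hF
  have h1 : ∑ k ∈ Finset.Ioc 8 (n-1), (1 / ((k:ℝ) - i) + 1 / (2*(n:ℝ) - i - k)) *
    (1 / (k:ℝ) + 1 / (2 * (n:ℝ) - k)) = ∑ k ∈ Finset.Ioc 8 (n-1), (F k + F (2 * (n:ℝ) - k)) := by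
    refine Finset.sum_congr rfl fun k hk => ?_
    simp only [hF]
    have e1 : 2 * (n:ℝ) - (2 * n - k) = k := by ring
    have e2 : 2 * (n:ℝ) - k - i = 2 * n - i - k := by ring
    rw [e1, e2]; ring
  rw [h1]
  refine (sum_unfold F (by omega) ?_).trans ?_
  · simp only [hF]
    have : (0:ℝ) < n - i := by linarith
    have : (0:ℝ) < 2 * n - n := by linarith
    positivity
  have e9 : 2 * n - 8 - 1 = 2 * n - 9 := by omega
  rw [e9]
  have h2 : ∀ k ∈ Finset.Ioc 8 (2*n-9), F k = 1 / (((k:ℝ) - i) * k)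
      + (1/(2*(n:ℝ)-i)) * (1 / ((k:ℝ) - i) + 1 / (2 * (n:ℝ) - k)) := by
    intro k hk
    simp at hk
    have h3 : (9:ℝ) ≤ k := by exact_mod_cast hk.1
    have h4 : (k:ℝ) + 9 ≤ 2 * n := by exact_mod_cast (by omega : k + 9 ≤ 2 * n)
    have a1 : (0:ℝ) < k - i := by linarith
    have a2 : (0:ℝ) < k := by linarith
    have a3 : (0:ℝ) < 2 * n - k := by linarith
    have a4 : (0:ℝ) < 2 * n - i := by linarith
    simp only [hF]
    field_simp
    ring
  rw [Finset.sum_congr rfl h2, Finset.sum_add_distrib, ← Finset.mul_sum, Finset.sum_add_distrib]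
  have hA : ∑ k ∈ Finset.Ioc 8 (2*n-9), 1 / (((k:ℝ) - i) * k) ≤ lam i - vv i := by
    rcases Nat.eq_zero_or_pos i with rfl | hpos
    · have := sumC 8 (2*n-9)
      simp only [Nat.cast_zero, sub_zero]
      refine this.trans ?_
      norm_num [lam, vv]
    · refine (sumA hpos hi).trans ?_
      interval_cases i <;> norm_num [Hm, Finset.sum_range_succ, vv, lam]
  have hB1 : ∑ k ∈ Finset.Ioc 8 (2*n-9), 1 / ((k:ℝ) - i) = Hm (2*n-9-i) - Hm (8-i) :=
    sumH (by omega) hi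
  have hB2 : ∑ k ∈ Finset.Ioc 8 (2*n-9), 1 / (2 * (n:ℝ) - k) = Hm (2*n-9) - Hm 8 := by
    have := sumH (R := 8) (K := 2*n-9) (by omega) (i := 0) (by omega)
    simp only [Nat.sub_zero, Nat.cast_zero, sub_zero] at this
    rw [← this]
    refine Finset.sum_nbij' (fun k => 2*n - k) (fun k => 2*n-k) ?_ ?_ ?_ ?_ ?_
    · intro k hk; simp at hk ⊢; omega
    · intro k hk; simp at hk ⊢; omega
    · intro k hk; simp at hk ⊢; omega
    · intro k hk; simp at hk ⊢; omega
    · intro k hk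
      simp at hk
      rw [Nat.cast_sub (by omega)]; push_cast; ring
  rw [hB1, hB2]
  have h5 := vv_aux hi hn
  have a4 : (0:ℝ) < 2 * n - i := by linarith
  have : (1/(2*(n:ℝ)-i)) * (Hm (2*n-9-i) - Hm (8-i) + (Hm (2*n-9) - Hm 8)) ≤ vv i := by
    rw [one_div, inv_mul_le_iff₀ a4]; linarith
  linarith

theorem kerL_near {n p q : ℕ} (hp : p + 8 = n + q) (hn : 16 ≤ n) :
    kerL p n 8 ≤ lam (8 - q) := by
  refine le_trans (Finset.sum_le_sum fun k hk => ?_) (kerL_aux (n := n) (i := 8 - q) (by omega) hn)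
  simp at hk
  have hpr : (p:ℝ) + 8 = n + q := by exact_mod_cast hp
  have hn' : (16:ℝ) ≤ n := by exact_mod_cast hn
  have h3 : (9:ℝ) ≤ k := by exact_mod_cast hk.1
  have h4 : (k:ℝ) + 1 ≤ n := by exact_mod_cast (by omega : k + 1 ≤ n)
  have hc : 8 - (q:ℝ) ≤ ((8 - q : ℕ):ℝ) := by
    rcases le_total q 8 with h | h
    · rw [Nat.cast_sub h]; simp
    · have : (8:ℝ) ≤ q := by exact_mod_cast h
      have : (0:ℝ) ≤ ((8 - q : ℕ):ℝ) := Nat.cast_nonneg _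
      linarith
  have hc8 : ((8 - q : ℕ):ℝ) ≤ 8 := by exact_mod_cast (by omega : 8 - q ≤ 8)
  have a3 : (0:ℝ) < 2 * n - k := by linarith
  have hq0 : (0:ℝ) ≤ q := Nat.cast_nonneg _
  have e1 : 0 ≤ (p:ℝ) - (n - k) := by linarith
  rw [abs_of_nonneg e1]
  apply mul_le_mul_of_nonneg_right _ (by positivity)
  apply add_le_add
  · apply one_div_le_one_div_of_le <;> linarith
  · apply one_div_le_one_div_of_le <;> linarith

theorem kerL_left {n p : ℕ} (hp0 : 0 < p) (hp : p + 9 ≤ n) : kerL p n 8 ≤ 2 * aS := by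
  set j := n - p with hj
  have hpr : (p:ℝ) = n - j := by rw [hj, Nat.cast_sub (by omega)]; ring
  have hjn : j < n := by omega
  have hjr : (j:ℝ) < n := by exact_mod_cast hjn
  have hj9r : (9:ℝ) ≤ j := by exact_mod_cast (by omega : 9 ≤ j)
  set F : ℝ → ℝ := fun x => (1 / |(j:ℝ) - x|) * (1/x + 1/(2*n-x)) with hF
  have h1 : kerL p n 8 = ∑ k ∈ Finset.Ioc 8 (n-1), (F k + F (2 * (n:ℝ) - k)) := by
    refine Finset.sum_congr rfl fun k hk => ?_
    simp at hk
    have h4 : (k:ℝ) + 1 ≤ n := by exact_mod_cast (by omega : k + 1 ≤ n)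
    simp only [hF, hpr]
    have e1 : 2 * (n:ℝ) - (2 * n - k) = k := by ring
    have e2 : (n:ℝ) - j - (n - k) = -(j - k) := by ring
    have e3 : (j:ℝ) - (2 * n - k) = -(2 * n - j - k) := by ring
    have e4 : (n:ℝ) - j + n - k = 2 * n - j - k := by ring
    rw [e1, e2, e3, e4, abs_neg, abs_neg, abs_of_nonneg (show (0:ℝ) ≤ 2 * n - j - k by linarith)]
    ring
  rw [h1]
  refine (sum_unfold F (by omega) ?_).trans ?_
  · simp only [hF]
    have : (0:ℝ) < n := by linarith
    have : (0:ℝ) < 2 * n - n := by linarith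
    positivity
  have e9 : 2 * n - 8 - 1 = 2 * n - 9 := by omega
  rw [e9]
  have h2 : ∀ k ∈ Finset.Ioc 8 (2*n-9), F k = 1 / (|(j:ℝ) - k| * k)
      + 1 / (|(j:ℝ) - k| * (2 * (n:ℝ) - k)) := by
    intro k hk
    simp only [hF]
    rw [mul_add, one_div_mul_one_div, one_div_mul_one_div]
  rw [Finset.sum_congr rfl h2, Finset.sum_add_distrib]
  have hA := sumD (j := j) (K := 2*n-9) (by omega)
  have hB : ∑ k ∈ Finset.Ioc 8 (2*n-9), 1 / (|(j:ℝ) - k| * (2 * (n:ℝ) - k)) ≤ aS := by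
    refine le_trans (le_of_eq ?_) (sumD (j := 2*n-j) (K := 2*n-9) (by omega))
    refine Finset.sum_nbij' (fun k => 2*n - k) (fun k => 2*n-k) ?_ ?_ ?_ ?_ ?_
    · intro k hk; simp at hk ⊢; omega
    · intro k hk; simp at hk ⊢; omega
    · intro k hk; simp at hk ⊢; omega
    · intro k hk; simp at hk ⊢; omega
    · intro k hk
      simp at hk
      have c1 : ((2*n-j : ℕ):ℝ) = 2*n - j := by rw [Nat.cast_sub (by omega)]; push_cast; ring
      have c2 : ((2*n-k : ℕ):ℝ) = 2*n - k := by rw [Nat.cast_sub (by omega)]; push_cast; ring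
      rw [c1, c2, abs_sub_comm]
      congr 3; ring
  linarith

theorem sq_left {n : ℕ} (hn : 16 ≤ n) :
    ∑ k ∈ Finset.Ioc 8 (n-1), (1 / (k:ℝ) + 1 / (2 * (n:ℝ) - k))^2 ≤ 0.32 := by
  have := kerL_near (n := n) (p := n) (q := 8) rfl hn
  refine le_trans (le_of_eq ?_) (this.trans (by norm_num [lam]))
  refine Finset.sum_congr rfl fun k hk => ?_
  have e1 : (n:ℝ) - (n - k) = k := by ring
  have e2 : (n:ℝ) + n - k = 2 * n - k := by ring
  rw [e1, e2, Nat.abs_cast, sq]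
end KP


namespace KP

/-- distance of naturals -/
def ad (p l : ℕ) : ℕ := (p - l) + (l - p)

theorem ad_cast (p l : ℕ) : ((ad p l : ℕ) : ℝ) = |(p:ℝ) - l| := by
  unfold ad
  rcases le_total p l with h | h
  · have h' : (p:ℝ) ≤ l := by exact_mod_cast h
    rw [Nat.sub_eq_zero_of_le h, zero_add, Nat.cast_sub h, abs_sub_comm, abs_of_nonneg (by linarith)]
  · have h' : (l:ℝ) ≤ p := by exact_mod_cast h
    rw [Nat.sub_eq_zero_of_le h, add_zero, Nat.cast_sub h, abs_of_nonneg (by linarith)]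

theorem ad_comm (p l : ℕ) : ad p l = ad l p := by unfold ad; omega

structure Dat where
  c : ℕ → ℝ
  h : ℕ → ℝ
  D : ℕ → ℝ
  W : ℕ → ℝ
  z : ℕ → ℝ
  al : ℕ → ℝ
  la : ℕ → ℝ
  bR : ℕ → ℝ
  bL : ℕ → ℝ
  Ki : ℝ
  gR : ℝ
  gL : ℝ
  wR : ℝ
  wL : ℝ
  xR : ℝ
  xL : ℝ
  aR : ℝ
  aLR : ℝ
  aLL : ℝ

structure Dat.Nonneg (d : Dat) : Prop where
  c : ∀ i, 0 ≤ d.c i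
  h : ∀ i, 0 ≤ d.h i
  D : ∀ i, 0 ≤ d.D i
  W : ∀ i, 0 ≤ d.W i
  z : ∀ i, 0 ≤ d.z i
  Ki : 0 ≤ d.Ki
  gR : 0 ≤ d.gR
  gL : 0 ≤ d.gL
  wR : 0 ≤ d.wR
  wL : 0 ≤ d.wL
  xR : 0 ≤ d.xR
  xL : 0 ≤ d.xL

structure Dat.Cert (d : Dat) (n L : ℕ) : Prop where
  row : ∀ q ≤ L + 8, q ≠ L → (d.c (ad q L) + d.h (q + L))
    + ∑ q' ∈ Finset.range (L+9), (d.c (ad q q') + d.h (q + q')) * d.z q'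
    + d.al q * d.xR + d.la q * d.xL ≤ d.W q
  hz : ∀ q ≤ L + 8, q ≠ L → d.D q * d.W q ≤ d.z q
  hxR : d.Ki * d.gR / 2 * d.wR ≤ d.xR
  hxL : d.Ki * d.gL / 2 * d.wL ≤ d.xL
  rowR : d.bR L + ∑ q ∈ Finset.range (L+9), d.bR q * d.z q + d.aR * d.xR + d.la L * d.xL ≤ d.wR
  rowL : L + 1 < n → d.bL L + ∑ q ∈ Finset.range (L+9), d.bL q * d.z q + d.aLR * d.xR + d.aLL * d.xL ≤ d.wL
  hbR : ∀ q ≤ L + 8, d.Ki * (1 / ((L:ℝ) + 9 - q) + 1 / (2 * n + 9 - L + q)) ≤ d.bR q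
  hbL : L + 1 < n → ∀ q ≤ L + 8, d.Ki * (1 / ((q:ℝ) + 1) + 1 / (2 * n - 2 * L - 1 + q)) ≤ d.bL q

structure Dat.Geo (d : Dat) (n L : ℕ) : Prop where
  al : ∀ p q K, p + L = n + q → q ≤ L + 8 → kerR p n K ≤ d.al q
  aR : ∀ j K, 9 ≤ j → kerR (n + j) n K ≤ d.aR
  aLR : ∀ p K, 0 < p → p + L < n → kerR p n K ≤ d.aLR
  la : ∀ p q, p + L = n + q → q ≤ L + 8 → kerL p n L ≤ d.la q
  laR : ∀ j, 9 ≤ j → kerL (n + j) n L ≤ d.la L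
  aLL : ∀ p, 0 < p → p + L < n → kerL p n L ≤ d.aLL
  sq : ∑ k ∈ Finset.Ioc L (n-1), (1 / (k:ℝ) + 1 / (2 * (n:ℝ) - k))^2 ≤ 0.32

def near (n L p : ℕ) : Prop := n ≤ p + L ∧ p ≤ n + 8

instance (n L p : ℕ) : Decidable (near n L p) := by unfold near; infer_instance

noncomputable def TT (d : Dat) (n L p l : ℕ) : ℝ :=
  if near n L p ∧ near n L l then d.c (ad p l) + d.h ((p + L - n) + (l + L - n))
  else d.Ki * (1 / |(p:ℝ) - l| + 1 / ((p:ℝ) + l))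

noncomputable def DD (d : Dat) (n L p : ℕ) : ℝ :=
  if near n L p then d.D (p + L - n)
  else if n < p then d.gR / 2 * (1 / ((p:ℝ) - n))
  else d.gL / 2 * (1 / ((n:ℝ) - p) + 1 / ((n:ℝ) + p))

noncomputable def WW (d : Dat) (n L p : ℕ) : ℝ :=
  if near n L p then d.W (p + L - n) else if n < p then d.wR else d.wL

def sites (n K : ℕ) : Finset ℕ := (Finset.Icc 1 (n + K)).erase n

theorem split_sum (F : ℕ → ℝ) {n L K : ℕ} (hL : L < n) (hK : 8 ≤ K) :
    ∑ l ∈ sites n K, F l = ∑ q ∈ (Finset.range (L+9)).erase L, F (n - L + q)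
      + ∑ k ∈ Finset.Ioc 8 K, F (n + k) + ∑ k ∈ Finset.Ioc L (n-1), F (n - k) := by
  have e : sites n K = (((Finset.range (L+9)).erase L).image (fun q => n - L + q)
      ∪ (Finset.Ioc 8 K).image (fun k => n + k)) ∪ (Finset.Ioc L (n-1)).image (fun k => n - k) := by
    ext p
    simp only [sites, Finset.mem_erase, Finset.mem_Icc, Finset.mem_union, Finset.mem_image,
      Finset.mem_range, Finset.mem_Ioc]
    constructor
    · rintro ⟨h1, h2, h3⟩
      by_cases a : n + 8 < p
      · left; right; exact ⟨p - n, by omega, by omega⟩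
      by_cases b : p + L < n
      · right; exact ⟨n - p, by omega, by omega⟩
      · left; left; exact ⟨p + L - n, by omega, by omega⟩
    · rintro ((⟨q, h, rfl⟩ | ⟨q, h, rfl⟩) | ⟨q, h, rfl⟩) <;> omega
  rw [e, Finset.sum_union, Finset.sum_union, Finset.sum_image, Finset.sum_image, Finset.sum_image]
  · intro a ha b hb; simp at ha hb ⊢; omega
  · intro a ha b hb; simp at ha hb ⊢
  · intro a ha b hb; simp at ha hb ⊢
  · rw [Finset.disjoint_left]; intro k hk; simp at hk ⊢; intro x; omega
  · rw [Finset.disjoint_left]; intro k hk; simp at hk ⊢; intro x; omega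

variable {d : Dat} {n L K : ℕ}

theorem TT_nonneg (h0 : d.Nonneg) (p l : ℕ) : 0 ≤ TT d n L p l := by
  unfold TT; split_ifs
  · exact add_nonneg (h0.c _) (h0.h _)
  · have := h0.Ki; positivity

theorem WW_nonneg (h0 : d.Nonneg) (p : ℕ) : 0 ≤ WW d n L p := by
  unfold WW; split_ifs
  exacts [h0.W _, h0.wR, h0.wL]

theorem DD_nonneg (h0 : d.Nonneg) (p : ℕ) : 0 ≤ DD d n L p := by
  unfold DD; split_ifs with h1 h2
  · exact h0.D _
  · have := h0.gR
    have : (0:ℝ) < p - n := by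
      have : (n:ℝ) < p := by exact_mod_cast h2
      linarith
    positivity
  · have := h0.gL
    have : (0:ℝ) ≤ n - p := by
      have : (p:ℝ) ≤ n := by exact_mod_cast (by omega : p ≤ n)
      linarith
    positivity

theorem far_right (h0 : d.Nonneg) (hc : d.Cert n L) {p : ℕ} {a : ℝ} (ha : kerR p n K ≤ a) :
    ∑ k ∈ Finset.Ioc 8 K, TT d n L p (n + k) * DD d n L (n + k) * WW d n L (n + k) ≤ a * d.xR := by
  have : ∑ k ∈ Finset.Ioc 8 K, TT d n L p (n + k) * DD d n L (n + k) * WW d n L (n + k)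
      = (d.Ki * d.gR / 2 * d.wR) * kerR p n K := by
    rw [kerR, Finset.mul_sum]
    refine Finset.sum_congr rfl fun k hk => ?_
    simp at hk
    have hn : ¬ near n L (n + k) := by unfold near; omega
    have hlt : n < n + k := by omega
    simp only [TT, DD, WW, hn, and_false, if_false, hlt, if_true]
    push_cast
    rw [show (n:ℝ) + k - n = k by ring, show (p:ℝ) + (n + k) = p + n + k by ring]
    ring
  rw [this, mul_comm a]
  have hk0 : 0 ≤ kerR p n K := Finset.sum_nonneg fun k _ => by positivity
  have := h0.xR
  exact mul_le_mul hc.hxR ha hk0 this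

theorem far_left (h0 : d.Nonneg) (hc : d.Cert n L) {p : ℕ} {a : ℝ} (ha : kerL p n L ≤ a) :
    ∑ k ∈ Finset.Ioc L (n-1), TT d n L p (n - k) * DD d n L (n - k) * WW d n L (n - k) ≤ a * d.xL := by
  have : ∑ k ∈ Finset.Ioc L (n-1), TT d n L p (n - k) * DD d n L (n - k) * WW d n L (n - k)
      = (d.Ki * d.gL / 2 * d.wL) * kerL p n L := by
    rw [kerL, Finset.mul_sum]
    refine Finset.sum_congr rfl fun k hk => ?_
    simp at hk
    have hn : ¬ near n L (n - k) := by unfold near; omega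
    have hlt : ¬ n < n - k := by omega
    simp only [TT, DD, WW, hn, and_false, if_false, hlt]
    rw [Nat.cast_sub (by omega)]
    rw [show (n:ℝ) - (n - k) = k by ring, show (p:ℝ) + (n - k) = p + n - k by ring,
      show (n:ℝ) + (n - k) = 2 * n - k by ring]
    ring
  rw [this, mul_comm a]
  have hk0 : 0 ≤ kerL p n L := Finset.sum_nonneg fun k hk => by
    simp at hk
    have h1 : (k:ℝ) ≤ n := by exact_mod_cast (by omega : k ≤ n)
    have h2 : (0:ℝ) ≤ k := Nat.cast_nonneg k
    have h3 : (0:ℝ) ≤ p := Nat.cast_nonneg p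
    have : 0 ≤ (p:ℝ) + n - k := by linarith
    have : 0 ≤ 2 * (n:ℝ) - k := by linarith
    positivity
  exact mul_le_mul hc.hxL ha hk0 h0.xL

theorem near_idx (hL : L < n) {q : ℕ} (hq : q < L + 9) :
    near n L (n - L + q) ∧ n - L + q + L - n = q := by
  unfold near; omega

/-- near part of the sum -/
theorem near_sum (h0 : d.Nonneg) (hc : d.Cert n L) (hL : L < n) {p : ℕ} {b : ℕ → ℝ}
    (hb : ∀ q < L + 9, TT d n L p (n - L + q) ≤ b q) :
    ∑ q ∈ (Finset.range (L+9)).erase L, TT d n L p (n - L + q) * DD d n L (n - L + q) * WW d n L (n - L + q)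
      ≤ ∑ q ∈ Finset.range (L+9), b q * d.z q := by
  refine le_trans (Finset.sum_le_sum (g := fun q => b q * d.z q) fun q hq => ?_)
    (Finset.sum_le_sum_of_subset_of_nonneg (Finset.erase_subset _ _) fun q hq _ => ?_)
  · simp at hq
    obtain ⟨h1, h2⟩ := near_idx hL hq.2
    have e : DD d n L (n - L + q) * WW d n L (n - L + q) ≤ d.z q := by
      simp only [DD, WW, h1, if_true, h2]
      exact hc.hz q (by omega) hq.1
    rw [mul_assoc]
    have t0 := TT_nonneg (n := n) (L := L) h0 p (n - L + q)
    exact mul_le_mul (hb q hq.2) e (mul_nonneg (DD_nonneg h0 _) (WW_nonneg h0 _)) (t0.trans (hb q hq.2))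
  · simp at hq
    exact mul_nonneg ((TT_nonneg h0 _ _).trans (hb q hq)) (h0.z q)

theorem hyp_aux {x y x0 y0 : ℝ} (h0 : 0 < x0) (hx : x0 ≤ x) (hy : x0 ≤ y) (hs : x0 + y0 ≤ x + y)
    (hy0 : x0 ≤ y0) : 1 / x + 1 / y ≤ 1 / x0 + 1 / y0 := by
  have hx' : 0 < x := by linarith
  have hy' : 0 < y := by linarith
  have h1 : 1 / x + 1 / y ≤ 1 / x0 + 1 / (x + y - x0) := by
    have h3 : 0 < x + y - x0 := by linarith
    have : 1 / x0 + 1 / (x + y - x0) - (1 / x + 1 / y) = (x + y) * ((x - x0) * (y - x0)) / (x0 * (x + y - x0) * x * y) := by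
      field_simp
      ring
    have h4 : 0 ≤ (x + y) * ((x - x0) * (y - x0)) / (x0 * (x + y - x0) * x * y) := by
      have : 0 ≤ (x - x0) := by linarith
      have : 0 ≤ (y - x0) := by linarith
      positivity
    linarith
  have h2 : 1 / (x + y - x0) ≤ 1 / y0 := by
    apply one_div_le_one_div_of_le <;> linarith
  linarith

theorem super (h0 : d.Nonneg) (hc : d.Cert n L) (hg : d.Geo n L) (hL : L < n) (hK : 8 ≤ K) :
    ∀ p ∈ sites n K, TT d n L p n + ∑ l ∈ sites n K, TT d n L p l * DD d n L l * WW d n L l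
      ≤ WW d n L p := by
  intro p hp
  simp only [sites, Finset.mem_erase, Finset.mem_Icc] at hp
  obtain ⟨hpn, hp1, hpK⟩ := hp
  rw [split_sum _ hL hK]
  have hnn : n - L + L = n := by omega
  by_cases hnear : near n L p
  · set q := p + L - n with hq
    have hq8 : q ≤ L + 8 := by unfold near at hnear; omega
    have hqL : q ≠ L := by unfold near at hnear; omega
    have hpq : p + L = n + q := by unfold near at hnear; omega
    have hT : ∀ q' < L + 9, TT d n L p (n - L + q') ≤ d.c (ad q q') + d.h (q + q') := by
      intro q' hq'
      obtain ⟨h1, h2⟩ := near_idx hL hq'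
      simp only [TT, hnear, h1, and_self, if_true, h2, ← hq]
      have : ad p (n - L + q') = ad q q' := by unfold ad; omega
      rw [this]
    have h1 := near_sum h0 hc hL hT
    have h2 := far_right (K := K) h0 hc (hg.al p q K hpq hq8)
    have h3 := far_left h0 hc (hg.la p q hpq hq8)
    have h4 := hT L (by omega)
    rw [hnn] at h4
    have h5 := hc.row q hq8 hqL
    have h6 : WW d n L p = d.W q := by simp only [WW, hnear, if_true, ← hq]
    rw [h6]; linarith
  · have hTT : ∀ l, TT d n L p l = d.Ki * (1 / |(p:ℝ) - l| + 1 / ((p:ℝ) + l)) := by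
      intro l; simp [TT, hnear]
    have hnL : ((n - L : ℕ):ℝ) = n - L := by rw [Nat.cast_sub hL.le]
    have hLn' : (L:ℝ) + 1 ≤ n := by exact_mod_cast hL
    by_cases hlt : n < p
    · obtain ⟨j, rfl⟩ : ∃ j, p = n + j := ⟨p - n, by omega⟩
      have hj : 9 ≤ j := by unfold near at hnear; omega
      have hj' : (9:ℝ) ≤ j := by exact_mod_cast hj
      have hT : ∀ q' < L + 9, TT d n L (n + j) (n - L + q') ≤ d.bR q' := by
        intro q' hq'
        refine le_trans ?_ (hc.hbR q' (by omega))
        rw [hTT]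
        have hq'r : (q':ℝ) + 1 ≤ L + 9 := by exact_mod_cast hq'
        have hq0 : (0:ℝ) ≤ q' := Nat.cast_nonneg _
        have hL0 : (0:ℝ) ≤ L := Nat.cast_nonneg _
        refine mul_le_mul_of_nonneg_left ?_ h0.Ki
        push_cast
        rw [hnL, abs_of_nonneg (by linarith)]
        apply add_le_add
        · apply one_div_le_one_div_of_le <;> linarith
        · apply one_div_le_one_div_of_le <;> linarith
      have h1 := near_sum h0 hc hL hT
      have h2 := far_right (K := K) h0 hc (hg.aR j K hj)
      have h3 := far_left h0 hc (hg.laR j hj)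
      have h4 := hT L (by omega)
      rw [hnn] at h4
      have h5 := hc.rowR
      have h6 : WW d n L (n + j) = d.wR := by simp [WW, hnear]; omega
      rw [h6]; linarith
    · have hpl : p + L < n := by unfold near at hnear; omega
      have hpl' : (p:ℝ) + L + 1 ≤ n := by exact_mod_cast hpl
      have hp1' : (1:ℝ) ≤ p := by exact_mod_cast hp1
      have hLn : L + 1 < n := by omega
      have hT : ∀ q' < L + 9, TT d n L p (n - L + q') ≤ d.bL q' := by
        intro q' hq'
        refine le_trans ?_ (hc.hbL hLn q' (by omega))
        rw [hTT]
        have hq0 : (0:ℝ) ≤ q' := Nat.cast_nonneg _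
        have hL0 : (0:ℝ) ≤ L := Nat.cast_nonneg _
        refine mul_le_mul_of_nonneg_left ?_ h0.Ki
        push_cast
        rw [hnL, abs_sub_comm, abs_of_nonneg (by linarith)]
        apply hyp_aux <;> linarith
      have h1 := near_sum h0 hc hL hT
      have h2 := far_right (K := K) h0 hc (hg.aLR p K (by omega) hpl)
      have h3 := far_left h0 hc (hg.aLL p (by omega) hpl)
      have h4 := hT L (by omega)
      rw [hnn] at h4
      have h5 := hc.rowL hLn
      have h6 : WW d n L p = d.wL := by simp [WW, hnear, hlt]
      rw [h6]; linarith
end KP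


namespace KP

noncomputable def Tn (C : ℕ → ℝ) (r p l : ℕ) : ℝ :=
  (if ad p l ≤ r then C (ad p l) else 0) - (if p + l ≤ r then C (p + l) else 0)

noncomputable def fn (C : ℕ → ℝ) (n p : ℕ) : ℝ := C (ad p n) - C (p + n)

noncomputable def Dn (M : ℝ) (n : ℕ) (t : ℝ) (p : ℕ) : ℝ := 1 / (((n:ℝ)^2 - (p:ℝ)^2) / M + t)

noncomputable def Gn (C : ℕ → ℝ) (M : ℝ) (n r s K : ℕ) (t : ℝ) : ℝ :=
  -C (2 * n) + ∑ k ∈ Finset.range s,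
    aa (sites n K) (Tn C r) (fun p => Tn C r p n) (fn C n) (Dn M n t) k

structure CellB (d : Dat) (n L : ℕ) (C : ℕ → ℝ) : Prop where
  C0 : C 0 = 0
  Ki : ∀ k, 1 ≤ k → |C k| ≤ d.Ki * (1 / (k:ℝ))
  c : ∀ k, 1 ≤ k → k ≤ L + 8 → |C k| ≤ d.c k
  h : ∀ i, i ≤ 2 * (L + 8) → |C (2 * (n - L) + i)| ≤ d.h i

def DBd (d : Dat) (n L : ℕ) (M tl th : ℝ) : Prop :=
  ∀ t ∈ Set.Icc tl th, ∀ p, 0 < p → p ≠ n → |Dn M n t p| ≤ DD d n L p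

section
variable {d : Dat} {n L K r s : ℕ} {C : ℕ → ℝ} {M tl th t : ℝ}

theorem Tn_symm (p l : ℕ) : Tn C r p l = Tn C r l p := by
  unfold Tn; rw [ad_comm p l, add_comm p l]

theorem TT_symm (p l : ℕ) : TT d n L p l = TT d n L l p := by
  unfold TT
  simp only [and_comm (a := near n L p), ad_comm p l, add_comm (p + L - n), abs_sub_comm (p:ℝ), add_comm (p:ℝ)]

theorem two_abs (h0 : d.Nonneg) (hB : CellB d n L C) (hL : L < n) {p l : ℕ} (hp : 0 < p) (hl : 0 < l) :
    |C (ad p l)| + |C (p + l)| ≤ TT d n L p l := by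
  have hC0 : C 0 = 0 := hB.C0
  unfold TT
  split_ifs with h
  · obtain ⟨h1, h2⟩ := h
    unfold near at h1 h2
    apply add_le_add
    · by_cases e : ad p l = 0
      · rw [e, hC0, abs_zero]; exact h0.c 0
      · exact hB.c _ (by omega) (by unfold ad; omega)
    · have := hB.h ((p + L - n) + (l + L - n)) (by omega)
      rwa [show 2 * (n - L) + ((p + L - n) + (l + L - n)) = p + l by omega] at this
  · rw [mul_add]
    apply add_le_add
    · by_cases e : ad p l = 0
      · rw [e, hC0, abs_zero]; have := h0.Ki; positivity
      · have := hB.Ki (ad p l) (by omega)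
        rwa [ad_cast] at this
    · have := hB.Ki (p + l) (by omega)
      push_cast at this; exact this

theorem Tn_abs (h0 : d.Nonneg) (hB : CellB d n L C) (hL : L < n) {p l : ℕ} (hp : 0 < p) (hl : 0 < l) :
    |Tn C r p l| ≤ TT d n L p l := by
  refine le_trans ?_ (two_abs h0 hB hL hp hl)
  unfold Tn
  refine (abs_sub _ _).trans (add_le_add ?_ ?_)
  · split_ifs <;> simp
  · split_ifs <;> simp

theorem fn_abs (h0 : d.Nonneg) (hB : CellB d n L C) (hL : L < n) {p : ℕ} (hp : 0 < p) :
    |fn C n p| ≤ TT d n L p n := by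
  refine le_trans ?_ (two_abs h0 hB hL hp (by omega))
  exact abs_sub _ _

theorem uf_low (p : ℕ) : -((C (p + n))^2 / 4) ≤ Tn C r p n * fn C n p := by
  unfold Tn fn
  have had : ad p n ≤ p + n := by unfold ad; omega
  split_ifs with h1 h2
  · nlinarith [sq_nonneg (C (ad p n) - C (p+n)), sq_nonneg (C (p+n))]
  · nlinarith [sq_nonneg (C (ad p n) - C (p+n) / 2)]
  · omega
  · nlinarith [sq_nonneg (C (p+n))]

/-- the negative part allowance -/
noncomputable def ee (d : Dat) (n L p : ℕ) : ℝ :=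
  if near n L p then (d.h (p + L - n + L))^2 / 4 else (TT d n L p n)^2

theorem ee_nonneg (p : ℕ) : 0 ≤ ee d n L p := by
  unfold ee; split_ifs <;> positivity

theorem ee_low (h0 : d.Nonneg) (hB : CellB d n L C) (hL : L < n) {p : ℕ} (hp : 0 < p) :
    -(ee d n L p) ≤ Tn C r p n * fn C n p := by
  unfold ee
  split_ifs with h
  · refine le_trans ?_ (uf_low p)
    unfold near at h
    have := hB.h (p + L - n + L) (by omega)
    rw [show 2 * (n - L) + (p + L - n + L) = p + n by omega] at this
    have := sq_le_sq' (neg_le_of_abs_le this) (le_of_abs_le this)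
    linarith
  · have h1 := Tn_abs (r := r) h0 hB hL hp (show 0 < n by omega)
    have h2 := fn_abs h0 hB hL hp
    have h3 : |Tn C r p n * fn C n p| ≤ (TT d n L p n)^2 := by
      rw [abs_mul, sq]
      exact mul_le_mul h1 h2 (abs_nonneg _) (TT_nonneg h0 _ _)
    exact neg_le_of_abs_le h3

theorem den_left (hM : 0 < M) (hMn : M ≤ n - 1/2) (ht : -1 ≤ t) {p : ℕ} (hp : p < n) :
    1 ≤ ((n:ℝ)^2 - (p:ℝ)^2) / M + t := by
  have h1 : (p:ℝ) + 1 ≤ n := by exact_mod_cast hp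
  have h0 : (0:ℝ) ≤ p := Nat.cast_nonneg p
  have : 2 ≤ ((n:ℝ)^2 - (p:ℝ)^2) / M := by
    rw [le_div_iff₀ hM]; nlinarith
  linarith

theorem den_right (hM : 0 < M) (hMn : M ≤ n - 1/2) (ht : t ≤ 1) {p : ℕ} (hp : n < p) :
    ((n:ℝ)^2 - (p:ℝ)^2) / M + t ≤ -1 := by
  have h1 : (n:ℝ) + 1 ≤ p := by exact_mod_cast hp
  have h0 : (0:ℝ) ≤ n := Nat.cast_nonneg n
  have : ((n:ℝ)^2 - (p:ℝ)^2) / M ≤ -2 := by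
    rw [div_le_iff₀ hM]; nlinarith
  linarith

theorem Dn_pos (hM : 0 < M) (hMn : M ≤ n - 1/2) (ht : -1 ≤ t) {p : ℕ} (hp : p < n) : 0 < Dn M n t p := by
  have := den_left hM hMn ht hp
  unfold Dn; positivity

theorem Dn_neg (hM : 0 < M) (hMn : M ≤ n - 1/2) (ht : t ≤ 1) {p : ℕ} (hp : n < p) : Dn M n t p < 0 := by
  have := den_right hM hMn ht hp
  unfold Dn; exact one_div_neg.2 (by linarith)

/-- `f̂` in near coordinates -/
noncomputable def Dat.f (d : Dat) (L q : ℕ) : ℝ := d.c (ad q L) + d.h (q + L)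

theorem near_vals (hL : L < n) {q : ℕ} (hq : q < L + 9) :
    TT d n L (n - L + q) n = d.f L q ∧ DD d n L (n - L + q) = d.D q ∧ WW d n L (n - L + q) = d.W q
      ∧ ee d n L (n - L + q) = (d.h (q + L))^2 / 4 := by
  obtain ⟨h1, h2⟩ := near_idx hL hq
  have hn : near n L n := by unfold near; omega
  have h3 : n + L - n = L := by omega
  have h4 : ad (n - L + q) n = ad q L := by unfold ad; omega
  refine ⟨?_, ?_, ?_, ?_⟩
  · simp only [TT, h1, hn, and_self, if_true, h2, h3, h4, Dat.f]
  · simp only [DD, h1, if_true, h2]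
  · simp only [WW, h1, if_true, h2]
  · simp only [ee, h1, if_true, h2]

theorem far_f (h0 : d.Nonneg) (hc : d.Cert n L) (hg : d.Geo n L) (hL : L < n) :
    ∑ k ∈ Finset.Ioc 8 K, TT d n L (n + k) n * DD d n L (n + k) * WW d n L (n + k)
      + ∑ k ∈ Finset.Ioc L (n-1), TT d n L (n - k) n * DD d n L (n - k) * WW d n L (n - k)
      ≤ d.al L * d.xR + d.la L * d.xL := by
  have h1 := far_right (K := K) h0 hc (hg.al n L K rfl (by omega))
  have h2 := far_left h0 hc (hg.la n L rfl (by omega))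
  simp only [TT_symm n] at h1 h2
  linarith

theorem der_piece (h0 : d.Nonneg) (hc : d.Cert n L) (hg : d.Geo n L) (hL : L < n) (hK : 8 ≤ K)
    (hB : CellB d n L C) (hM : 0 < M) (hMn : M ≤ n - 1/2) (hD : DBd d n L M tl th)
    (htl : -1 ≤ tl) (hth : th ≤ 1) (hs : 1 ≤ s) {t1 t2 : ℝ} (h1 : t1 ∈ Set.Icc tl th)
    (h2 : t2 ∈ Set.Icc tl th) (h12 : t1 ≤ t2) :
    Gn C M n r s K t2 - Gn C M n r s K t1 ≤ (t2 - t1) *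
      (∑ q ∈ (Finset.range (L+9)).erase L, (d.D q)^2 * ((d.W q)^2 - (d.f L q)^2 + (d.h (q+L))^2/4)
        + (d.gR * d.wR)^2 / 34 + (d.gL * d.wL)^2 * 0.08) := by
  have hpos : ∀ p ∈ sites n K, 0 < p ∧ p ≠ n := by
    intro p hp; simp [sites] at hp; omega
  have key := der_bound (S := sites n K) (T := Tn C r) (T' := TT d n L) (u := fun p => Tn C r p n)
    (f := fn C n) (D1 := Dn M n t2) (D2 := Dn M n t1) (D' := DD d n L) (f' := fun p => TT d n L p n)
    (W := WW d n L) (e := ee d n L) (Δ := t2 - t1) Tn_symm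
    (fun p hp l hl => Tn_abs h0 hB hL (hpos p hp).1 (hpos l hl).1)
    (fun p hp => hD t2 h2 p (hpos p hp).1 (hpos p hp).2)
    (fun p hp => hD t1 h1 p (hpos p hp).1 (hpos p hp).2)
    (fun p hp => Tn_abs h0 hB hL (hpos p hp).1 (by omega))
    (fun p hp => fn_abs h0 hB hL (hpos p hp).1)
    (super h0 hc hg hL hK) (fun p hp => WW_nonneg h0 p) ?_ ?_ (by linarith) (fun p hp => ee_nonneg p)
    (fun p hp => ee_low h0 hB hL (hpos p hp).1) s hs
  · have e : Gn C M n r s K t2 - Gn C M n r s K t1 = ∑ k ∈ Finset.range s,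
        aa (sites n K) (Tn C r) (fun p => Tn C r p n) (fn C n) (Dn M n t2) k - ∑ k ∈ Finset.range s,
        aa (sites n K) (Tn C r) (fun p => Tn C r p n) (fn C n) (Dn M n t1) k := by
      unfold Gn; ring
    rw [e]
    refine key.trans (mul_le_mul_of_nonneg_left ?_ (by linarith))
    rw [split_sum _ hL hK]
    refine add_le_add (add_le_add (le_of_eq ?_) ?_) ?_
    · refine Finset.sum_congr rfl fun q hq => ?_
      simp only [Finset.mem_erase, Finset.mem_range] at hq
      obtain ⟨a1, a2, a3, a4⟩ := near_vals (d := d) hL hq.2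
      rw [a1, a2, a3, a4]
    · have e : ∀ k ∈ Finset.Ioc 8 K, (DD d n L (n+k))^2 * ((WW d n L (n+k))^2 - (TT d n L (n+k) n)^2 + ee d n L (n+k))
          = (d.gR * d.wR)^2 / 4 * (1 / ((k:ℝ) * k)) := by
        intro k hk
        simp only [Finset.mem_Ioc] at hk
        have hn : ¬ near n L (n + k) := by unfold near; omega
        have hlt : n < n + k := by omega
        simp only [DD, WW, ee, hn, if_false, hlt, if_true]
        push_cast
        rw [show (n:ℝ) + k - n = k by ring]
        ring
      rw [Finset.sum_congr rfl e, ← Finset.mul_sum]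
      have := sumC 8 K
      calc _ ≤ (d.gR * d.wR)^2 / 4 * (1 / (((8:ℕ):ℝ) + 1/2)) := by gcongr
        _ = _ := by push_cast; ring
    · have e : ∀ k ∈ Finset.Ioc L (n-1), (DD d n L (n-k))^2 * ((WW d n L (n-k))^2 - (TT d n L (n-k) n)^2 + ee d n L (n-k))
          = (d.gL * d.wL)^2 / 4 * (1 / (k:ℝ) + 1 / (2 * (n:ℝ) - k))^2 := by
        intro k hk
        simp only [Finset.mem_Ioc] at hk
        have hn : ¬ near n L (n - k) := by unfold near; omega
        have hlt : ¬ n < n - k := by omega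
        simp only [DD, WW, ee, hn, if_false, hlt]
        rw [Nat.cast_sub (by omega)]
        rw [show (n:ℝ) - (n - k) = k by ring, show (n:ℝ) + (n - k) = 2 * n - k by ring]
        ring
      rw [Finset.sum_congr rfl e, ← Finset.mul_sum]
      have := hg.sq
      calc _ ≤ (d.gL * d.wL)^2 / 4 * 0.32 := by gcongr
        _ = _ := by ring
  · intro p hp
    rcases lt_or_gt_of_ne (hpos p hp).2 with h | h
    · have a1 := den_left (t := t1) hM hMn (htl.trans h1.1) h
      have a2 := den_left (t := t2) hM hMn (htl.trans h2.1) h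
      unfold Dn
      set A := ((n:ℝ)^2 - (p:ℝ)^2) / M
      have b1 : A + t1 ≠ 0 := by linarith
      have b2 : A + t2 ≠ 0 := by linarith
      field_simp
      ring
    · have a1 := den_right (t := t1) hM hMn (h1.2.trans hth) h
      have a2 := den_right (t := t2) hM hMn (h2.2.trans hth) h
      unfold Dn
      set A := ((n:ℝ)^2 - (p:ℝ)^2) / M
      have b1 : A + t1 ≠ 0 := by linarith
      have b2 : A + t2 ≠ 0 := by linarith
      field_simp
      ring
  · intro p hp
    rcases lt_or_gt_of_ne (hpos p hp).2 with h | h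
    · exact (mul_pos (Dn_pos hM hMn (htl.trans h2.1) h) (Dn_pos hM hMn (htl.trans h1.1) h)).le
    · exact (mul_pos_of_neg_of_neg (Dn_neg hM hMn (h2.2.trans hth) h) (Dn_neg hM hMn (h1.2.trans hth) h)).le

/-- generic bound for `±(G + C_{2n})` from termwise bounds -/
theorem G_bound (h0 : d.Nonneg) (hc : d.Cert n L) (hg : d.Geo n L) (hL : L < n) (hK : 8 ≤ K)
    (hB : CellB d n L C) (hD : DBd d n L M tl th) (ht : t ∈ Set.Icc tl th) (hs : 1 ≤ s) :
    |∑ k ∈ Finset.range s, aa (sites n K) (Tn C r) (fun p => Tn C r p n) (fn C n) (Dn M n t) k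
      - ∑ p ∈ sites n K, Tn C r p n * fn C n p * Dn M n t p|
      ≤ ∑ p ∈ sites n K, TT d n L p n * DD d n L p * (WW d n L p - TT d n L p n) := by
  have hpos : ∀ p ∈ sites n K, 0 < p ∧ p ≠ n := by
    intro p hp; simp [sites] at hp; omega
  exact rest_bound (S := sites n K) (T := Tn C r) (T' := TT d n L) (u := fun p => Tn C r p n)
    (f := fn C n) (D := Dn M n t) (D' := DD d n L) (f' := fun p => TT d n L p n)
    (W := WW d n L) 
    (fun p hp l hl => Tn_abs h0 hB hL (hpos p hp).1 (hpos l hl).1)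
    (fun p hp => hD t ht p (hpos p hp).1 (hpos p hp).2)
    (fun p hp => Tn_abs h0 hB hL (hpos p hp).1 (by omega))
    (fun p hp => fn_abs h0 hB hL (hpos p hp).1)
    (super h0 hc hg hL hK) (fun p hp => WW_nonneg h0 p) s hs

theorem C2n_abs (hB : CellB d n L C) (hL : L < n) : |C (2*n)| ≤ d.h (2 * L) := by
  have := hB.h (2 * L) (by omega)
  rwa [show 2 * (n - L) + 2 * L = 2 * n by omega] at this

theorem uf_abs (h0 : d.Nonneg) (hB : CellB d n L C) (hL : L < n) {p : ℕ} (hp : 0 < p) :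
    |Tn C r p n * fn C n p| ≤ (TT d n L p n)^2 := by
  rw [abs_mul, sq]
  exact mul_le_mul (Tn_abs h0 hB hL hp (by omega)) (fn_abs h0 hB hL hp) (abs_nonneg _) (TT_nonneg h0 _ _)

theorem ufD_abs (h0 : d.Nonneg) (hB : CellB d n L C) (hL : L < n) (hD : DBd d n L M tl th)
    (ht : t ∈ Set.Icc tl th) {p : ℕ} (hp : 0 < p) (hpn : p ≠ n) :
    |Tn C r p n * fn C n p * Dn M n t p| ≤ TT d n L p n * DD d n L p * TT d n L p n := by
  rw [abs_mul]
  calc _ ≤ (TT d n L p n)^2 * DD d n L p :=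
        mul_le_mul (uf_abs h0 hB hL hp) (hD t ht p hp hpn) (abs_nonneg _) (sq_nonneg _)
    _ = _ := by ring

theorem f_nonneg (h0 : d.Nonneg) (q : ℕ) : 0 ≤ d.f L q := add_nonneg (h0.c _) (h0.h _)

/-- near term with full weight -/
theorem fz (h0 : d.Nonneg) (hc : d.Cert n L) {q : ℕ} (hq : q < L + 9) (hqL : q ≠ L) :
    d.f L q * d.D q * d.W q ≤ d.f L q * d.z q := by
  rw [mul_assoc]; exact mul_le_mul_of_nonneg_left (hc.hz q (by omega) hqL) (f_nonneg h0 q)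

theorem up_piece (h0 : d.Nonneg) (hc : d.Cert n L) (hg : d.Geo n L) (hL : L < n) (hK : 8 ≤ K)
    (hB : CellB d n L C) (hM : 0 < M) (hMn : M ≤ n - 1/2) (hD : DBd d n L M tl th)
    (hth : th ≤ 1) (hs : 1 ≤ s) (ht : t ∈ Set.Icc tl th) :
    Gn C M n r s K t ≤ d.h (2*L) + ∑ q ∈ (Finset.range (L+9)).erase L,
        (d.f L q * d.z q + if L < q then (d.h (q+L))^2/4 * d.D q - (d.f L q)^2 * d.D q else 0)
        + (d.al L * d.xR + d.la L * d.xL) := by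
  have hpos : ∀ p ∈ sites n K, 0 < p ∧ p ≠ n := by
    intro p hp; simp [sites] at hp; omega
  have h1 := le_of_abs_le (G_bound (r := r) h0 hc hg hL hK hB hD ht hs)
  have h2 := neg_le_of_abs_le (C2n_abs hB hL)
  have h3 : ∑ p ∈ sites n K, Tn C r p n * fn C n p * Dn M n t p
      + ∑ p ∈ sites n K, TT d n L p n * DD d n L p * (WW d n L p - TT d n L p n)
      ≤ ∑ p ∈ sites n K, (TT d n L p n * DD d n L p * WW d n L p +
        if near n L p ∧ n < p then ee d n L p * DD d n L p - (TT d n L p n)^2 * DD d n L p else 0) := by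
    rw [← Finset.sum_add_distrib]
    refine Finset.sum_le_sum fun p hp => ?_
    obtain ⟨hp0, hpn⟩ := hpos p hp
    split_ifs with h
    · have a1 := Dn_neg hM hMn (ht.2.trans hth) h.2
      have a2 := hD t ht p hp0 hpn
      have a3 := ee_low (r := r) h0 hB hL hp0
      have a4 : Tn C r p n * fn C n p * Dn M n t p ≤ ee d n L p * DD d n L p := by
        calc _ = -(Tn C r p n * fn C n p) * |Dn M n t p| := by rw [abs_of_neg a1]; ring
          _ ≤ ee d n L p * |Dn M n t p| := mul_le_mul_of_nonneg_right (by linarith) (abs_nonneg _)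
          _ ≤ _ := mul_le_mul_of_nonneg_left a2 (ee_nonneg p)
      nlinarith
    · have := le_of_abs_le (ufD_abs (r := r) h0 hB hL hD ht hp0 hpn)
      nlinarith
  rw [split_sum (fun p => TT d n L p n * DD d n L p * WW d n L p +
        if near n L p ∧ n < p then ee d n L p * DD d n L p - (TT d n L p n)^2 * DD d n L p else 0) hL hK] at h3
  have h4 : ∑ k ∈ Finset.Ioc 8 K, (TT d n L (n+k) n * DD d n L (n+k) * WW d n L (n+k) +
        if near n L (n+k) ∧ n < n+k then ee d n L (n+k) * DD d n L (n+k) - (TT d n L (n+k) n)^2 * DD d n L (n+k) else 0)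
      = ∑ k ∈ Finset.Ioc 8 K, TT d n L (n + k) n * DD d n L (n + k) * WW d n L (n + k) := by
    refine Finset.sum_congr rfl fun k hk => ?_
    simp only [Finset.mem_Ioc] at hk
    have hn : ¬ near n L (n + k) := by unfold near; omega
    simp [hn]
  have h5 : ∑ k ∈ Finset.Ioc L (n-1), (TT d n L (n-k) n * DD d n L (n-k) * WW d n L (n-k) +
        if near n L (n-k) ∧ n < n-k then ee d n L (n-k) * DD d n L (n-k) - (TT d n L (n-k) n)^2 * DD d n L (n-k) else 0)
      = ∑ k ∈ Finset.Ioc L (n-1), TT d n L (n - k) n * DD d n L (n - k) * WW d n L (n - k) := by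
    refine Finset.sum_congr rfl fun k hk => ?_
    have hn : ¬ (n < n - k) := by omega
    simp [hn]
  have h6 := far_f (K := K) h0 hc hg hL
  have h7 : ∑ q ∈ (Finset.range (L+9)).erase L, (TT d n L (n-L+q) n * DD d n L (n-L+q) * WW d n L (n-L+q) +
        if near n L (n-L+q) ∧ n < n-L+q then ee d n L (n-L+q) * DD d n L (n-L+q) - (TT d n L (n-L+q) n)^2 * DD d n L (n-L+q) else 0)
      ≤ ∑ q ∈ (Finset.range (L+9)).erase L,
        (d.f L q * d.z q + if L < q then (d.h (q+L))^2/4 * d.D q - (d.f L q)^2 * d.D q else 0) := by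
    refine Finset.sum_le_sum fun q hq => ?_
    simp only [Finset.mem_erase, Finset.mem_range] at hq
    obtain ⟨a1, a2, a3, a4⟩ := near_vals (d := d) hL hq.2
    have a5 := (near_idx hL hq.2).1
    have a6 : n < n - L + q ↔ L < q := by omega
    rw [a1, a2, a3, a4]
    simp only [a5, true_and, a6]
    have := fz h0 hc hq.2 hq.1
    linarith
  rw [h4, h5] at h3
  unfold Gn
  linarith

theorem low_piece (h0 : d.Nonneg) (hc : d.Cert n L) (hg : d.Geo n L) (hL : L < n) (hK : 8 ≤ K)
    (hB : CellB d n L C) (hM : 0 < M) (hMn : M ≤ n - 1/2) (hD : DBd d n L M tl th) (hr : 1 ≤ r)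
    (htl : -1 ≤ tl) (hth : th ≤ 0) (hs : 1 ≤ s) (ht : t ∈ Set.Icc tl th) {v E : ℝ} (hv0 : 0 ≤ v)
    (hE : 0 ≤ E) (hv : v = 0 ∨ (1 ≤ L ∧ v + d.h (2*L-1) ≤ |C 1|))
    (hP : (d.f L (L+1))^2 ≤ v^2 + E) :
    -Gn C M n r s K t ≤ d.h (2*L) + ∑ q ∈ (Finset.range (L+9)).erase L,
        (d.f L q * d.z q + if q < L then (d.h (q+L))^2/4 * d.D q - (d.f L q)^2 * d.D q else
          if q = L + 1 then E * d.D q - (d.f L q)^2 * d.D q else 0)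
        + (d.al L * d.xR + d.la L * d.xL) := by
  have hpos : ∀ p ∈ sites n K, 0 < p ∧ p ≠ n := by
    intro p hp; simp [sites] at hp; omega
  have h1 := neg_le_of_abs_le (G_bound (r := r) h0 hc hg hL hK hB hD ht hs)
  have h2 := le_of_abs_le (C2n_abs hB hL)
  set κ : ℝ := v^2 * |Dn M n t (n+1)| with hκ
  have hκ0 : 0 ≤ κ := by positivity
  set X : ℕ → ℝ := fun p => if near n L p ∧ p < n then ee d n L p * DD d n L p - (TT d n L p n)^2 * DD d n L p
        else if p = n + 1 then E * DD d n L p - (TT d n L p n)^2 * DD d n L p else 0 with hX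
  have h3 : -∑ p ∈ sites n K, Tn C r p n * fn C n p * Dn M n t p
      + ∑ p ∈ sites n K, TT d n L p n * DD d n L p * (WW d n L p - TT d n L p n)
      ≤ ∑ p ∈ sites n K, ((TT d n L p n * DD d n L p * WW d n L p + X p) +
        ((if p = n + 1 then κ else 0) - (if p = n - 1 then κ else 0))) := by
    rw [← Finset.sum_neg_distrib, ← Finset.sum_add_distrib]
    refine Finset.sum_le_sum fun p hp => ?_
    obtain ⟨hp0, hpn⟩ := hpos p hp
    have habs := neg_le_of_abs_le (ufD_abs (r := r) h0 hB hL hD ht hp0 hpn)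
    have a2 := hD t ht p hp0 hpn
    simp only [hX]
    by_cases c1 : p = n + 1
    · subst c1
      have b1 : ¬ (n + 1 < n) := by omega
      have b2 : ¬ (n + 1 = n - 1) := by omega
      simp only [b1, b2, and_false, if_false, if_true]
      have a1 := Dn_neg (t := t) hM hMn (by linarith [ht.2]) (show n < n + 1 by omega)
      have hu := neg_le_of_abs_le (uf_abs (r := r) h0 hB hL hp0)
      have hu' := le_of_abs_le (uf_abs (r := r) h0 hB hL hp0)
      have hTf : TT d n L (n+1) n = d.f L (L+1) := by
        have := (near_vals (d := d) hL (show L + 1 < L + 9 by omega)).1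
        rwa [show n - L + (L + 1) = n + 1 by omega] at this
      have e1 : -(Tn C r (n+1) n * fn C n (n+1) * Dn M n t (n+1)) = (Tn C r (n+1) n * fn C n (n+1)) * |Dn M n t (n+1)| := by
        rw [abs_of_neg a1]; ring
      have e2 : (Tn C r (n+1) n * fn C n (n+1)) * |Dn M n t (n+1)| ≤ (v^2 + E) * |Dn M n t (n+1)| := by
        refine mul_le_mul_of_nonneg_right (hu'.trans ?_) (abs_nonneg _)
        rw [hTf]; exact hP
      have e3 : E * |Dn M n t (n+1)| ≤ E * DD d n L (n+1) := mul_le_mul_of_nonneg_left a2 hE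
      rw [e1]
      nlinarith
    · simp only [c1, if_false]
      by_cases c2 : near n L p ∧ p < n
      · simp only [c2.1, c2.2, and_self, if_true]
        have a1 := Dn_pos hM hMn (htl.trans ht.1) c2.2
        have a3 := ee_low (r := r) h0 hB hL hp0
        rw [abs_of_pos a1] at a2
        by_cases c3 : p = n - 1
        · simp only [c3, if_true]
          rw [← c3]
          have hcomp : |Dn M n t (n+1)| ≤ Dn M n t p := by
            have q1 := den_left hM hMn (htl.trans ht.1) c2.2
            have q2 := den_right (t := t) hM hMn (by linarith [ht.2]) (show n < n + 1 by omega)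
            have a1' := Dn_neg (t := t) hM hMn (by linarith [ht.2]) (show n < n + 1 by omega)
            rw [abs_of_neg a1']
            unfold Dn
            rw [← one_div_neg_eq_neg_one_div]
            apply one_div_le_one_div_of_le (by linarith)
            have hpc : (p:ℝ) = n - 1 := by rw [c3, Nat.cast_sub (by omega)]; simp
            have : ((n:ℝ)^2 - (p:ℝ)^2)/M + ((n:ℝ)^2 - ((n+1:ℕ):ℝ)^2)/M = -2/M := by
              rw [hpc]; push_cast; field_simp; ring
            have h2M : -2/M ≤ 0 := by rw [neg_div]; have : 0 < 2/M := by positivity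
                                      linarith
            have := ht.2
            linarith
          have hlow : v^2 - ee d n L p ≤ Tn C r p n * fn C n p := by
            rcases hv with hv | ⟨hL1, hv⟩
            · rw [hv]; linarith
            · have hh := hB.h (2*L-1) (by omega)
              have e1 : 2 * (n - L) + (2 * L - 1) = p + n := by omega
              rw [e1] at hh
              have e2 : ad p n = 1 := by unfold ad; omega
              have e3 : p + L - n + L = 2 * L - 1 := by omega
              unfold ee Tn fn
              simp only [c2.1, if_true, e2, hr, e3]
              set a := C 1
              set b := C (p+n)
              set hh' := d.h (2*L-1)
              have hb1 := abs_nonneg b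
              have k1 : v^2 ≤ (|a| - |b|)^2 := by
                apply pow_le_pow_left₀ hv0; linarith
              have k2 : v^2 ≤ (|a| - |b|/2)^2 := by
                apply pow_le_pow_left₀ hv0; linarith
              have k3 : a * b ≤ |a| * |b| := by rw [← abs_mul]; exact le_abs_self _
              have k4 := sq_abs a
              have k5 := sq_abs b
              have k6 : b^2 ≤ hh'^2 := by rw [← k5]; exact pow_le_pow_left₀ hb1 hh 2
              split_ifs
              · nlinarith
              · nlinarith
          have m1 : v^2 * |Dn M n t (n+1)| ≤ v^2 * Dn M n t p := mul_le_mul_of_nonneg_left hcomp (sq_nonneg v)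
          have m2 : (v^2 - ee d n L p) * Dn M n t p ≤ Tn C r p n * fn C n p * Dn M n t p :=
            mul_le_mul_of_nonneg_right hlow a1.le
          have m3 : ee d n L p * Dn M n t p ≤ ee d n L p * DD d n L p := mul_le_mul_of_nonneg_left a2 (ee_nonneg p)
          rw [hκ]
          nlinarith
        · simp only [c3, if_false]
          have m2 : (- ee d n L p) * Dn M n t p ≤ Tn C r p n * fn C n p * Dn M n t p :=
            mul_le_mul_of_nonneg_right a3 a1.le
          have m3 : ee d n L p * Dn M n t p ≤ ee d n L p * DD d n L p := mul_le_mul_of_nonneg_left a2 (ee_nonneg p)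
          nlinarith
      · simp only [c2, if_false]
        by_cases c3 : p = n - 1
        · have hL0 : ¬ (1 ≤ L) := by
            intro hh; apply c2; unfold near; omega
          have hv' : v = 0 := by tauto
          have : κ = 0 := by rw [hκ, hv']; ring
          simp only [this]
          simp
          nlinarith
        · simp only [c3, if_false]
          nlinarith
  rw [Finset.sum_add_distrib] at h3
  have hcorr : ∑ p ∈ sites n K, ((if p = n + 1 then κ else 0) - (if p = n - 1 then κ else 0)) = 0 := by
    rcases hv with hv | ⟨hL1, hv⟩
    · have : κ = 0 := by rw [hκ, hv]; ring
      simp [this]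
    · rw [Finset.sum_sub_distrib, Finset.sum_ite_eq', Finset.sum_ite_eq']
      have m1 : n + 1 ∈ sites n K := by simp [sites]; omega
      have m2 : n - 1 ∈ sites n K := by simp [sites]; omega
      simp [m1, m2]
  rw [hcorr, add_zero, split_sum (fun p => TT d n L p n * DD d n L p * WW d n L p + X p) hL hK] at h3
  have h4 : ∑ k ∈ Finset.Ioc 8 K, (TT d n L (n+k) n * DD d n L (n+k) * WW d n L (n+k) + X (n+k))
      = ∑ k ∈ Finset.Ioc 8 K, TT d n L (n + k) n * DD d n L (n + k) * WW d n L (n + k) := by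
    refine Finset.sum_congr rfl fun k hk => ?_
    simp only [Finset.mem_Ioc] at hk
    have b1 : ¬ (n + k < n) := by omega
    have b2 : ¬ (n + k = n + 1) := by omega
    simp only [hX, b1, b2, and_false, if_false, add_zero]
  have h5 : ∑ k ∈ Finset.Ioc L (n-1), (TT d n L (n-k) n * DD d n L (n-k) * WW d n L (n-k) + X (n-k))
      = ∑ k ∈ Finset.Ioc L (n-1), TT d n L (n - k) n * DD d n L (n - k) * WW d n L (n - k) := by
    refine Finset.sum_congr rfl fun k hk => ?_
    simp only [Finset.mem_Ioc] at hk
    have b1 : ¬ near n L (n - k) := by unfold near; omega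
    have b2 : ¬ (n - k = n + 1) := by omega
    simp only [hX, b1, b2, false_and, if_false, add_zero]
  have h6 := far_f (K := K) h0 hc hg hL
  have h7 : ∑ q ∈ (Finset.range (L+9)).erase L, (TT d n L (n-L+q) n * DD d n L (n-L+q) * WW d n L (n-L+q) + X (n-L+q))
      ≤ ∑ q ∈ (Finset.range (L+9)).erase L,
        (d.f L q * d.z q + if q < L then (d.h (q+L))^2/4 * d.D q - (d.f L q)^2 * d.D q else
          if q = L + 1 then E * d.D q - (d.f L q)^2 * d.D q else 0) := by
    refine Finset.sum_le_sum fun q hq => ?_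
    simp only [Finset.mem_erase, Finset.mem_range] at hq
    obtain ⟨a1, a2, a3, a4⟩ := near_vals (d := d) hL hq.2
    have a5 := (near_idx hL hq.2).1
    have a6 : n - L + q < n ↔ q < L := by omega
    have a7 : n - L + q = n + 1 ↔ q = L + 1 := by omega
    simp only [hX, a1, a2, a3, a4, a5, true_and, a6, a7]
    have := fz h0 hc hq.2 hq.1
    linarith
  rw [h4, h5] at h3
  unfold Gn
  linarith
end
end KP


namespace KP

noncomputable def frc {α : Type} (t : ℕ) (k : ℕ → α) : α :=
  Nat.rec (motive := fun _ => α) (k 0) (fun m _ => k (Nat.succ m)) t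
theorem frc_eq {α : Type} (t : ℕ) (k : ℕ → α) : frc t k = k t := by cases t <;> rfl

noncomputable def sm (f : ℕ → ℕ) (n : ℕ) : ℕ :=
  Nat.rec (motive := fun _ => ℕ) 0 (fun i s => Nat.add s (f i)) n
noncomputable def allb (f : ℕ → Bool) (n : ℕ) : Bool :=
  Nat.rec (motive := fun _ => Bool) true (fun i s => and (f i) s) n
noncomputable def cnd {α : Type} (b : Bool) (x y : α) : α := Bool.rec (motive := fun _ => α) y x b
noncomputable def get (t i : ℕ) : ℕ := Nat.mod (Nat.shiftRight t (Nat.mul 32 i)) 4294967296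
noncomputable def getU (t i : ℕ) : ℕ := Nat.mod (Nat.shiftRight t (Nat.mul 64 i)) 18446744073709551616
noncomputable def gw (t i : ℕ) : ℕ := Nat.mul 100 (Nat.mod (Nat.shiftRight t (Nat.mul 14 i)) 16384)
noncomputable def tabl (f : ℕ → ℕ) (n : ℕ) : ℕ :=
  Nat.rec (motive := fun _ => ℕ) 0 (fun i s => Nat.add s (Nat.shiftLeft (f i) (Nat.mul 32 i))) n

/-- fixed-point unit -/
abbrev SS : ℕ := 1000000
/-- offset for signed Chebyshev bounds -/
abbrev OO : ℕ := 1000000000000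

-- harmonic partial sums, rounded up
noncomputable def sN (a m : ℕ) : ℕ := sm (fun i => Nat.add (Nat.div SS (a + i + 1)) 1) m
noncomputable def betN (a : ℕ) : ℕ := sN 8 a / a + 1
noncomputable def alF (N L q : ℕ) : ℕ :=
  cnd (Nat.ble q L) (cnd (Nat.ble L q) 117648 (betN (L - q)))
    (sN (8 - (q - L)) (q - L) / (q - L) + 1) + betN (2 * N - L)
/-- left far-field kernel constants -/
noncomputable def lamN (i : ℕ) : ℕ :=
  get 60269782458305603378807909834717599302029653609871366032688121308372393289108885900 i

-- Chebyshev tables: index j holds bounds of U_{j-1}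
noncomputable def uBuild (a b n : ℕ) : ℕ → ℕ → ℕ → ℕ → ℕ → ℕ → ℕ :=
  Nat.rec (motive := fun _ => ℕ → ℕ → ℕ → ℕ → ℕ → ℕ → ℕ)
    (fun _ _ _ _ _ acc => acc)
    (fun _ ih i pl ph ql qh acc =>
      frc ((50 * OO + a * (ql - OO) - 25 * ph - b * (OO - ql)) / 25) fun nl =>
      frc ((50 * OO + b * (qh - OO) - 25 * pl - a * (OO - qh)) / 25 + 1) fun nh =>
      frc (acc + Nat.shiftLeft nl (128 * i) + Nat.shiftLeft nh (128 * i + 64)) fun acc' =>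
      ih (Nat.succ i) ql qh nl nh acc') n

noncomputable def lo (ut j : ℕ) : ℕ := getU ut (2 * j)
noncomputable def hi (ut j : ℕ) : ℕ := getU ut (2 * j + 1)
noncomputable def um (ut j : ℕ) : ℕ := cnd (Nat.ble (hi ut j - OO) (OO - lo ut j)) (OO - lo ut j) (hi ut j - OO)

noncomputable def chkU (a b ut : ℕ) : Bool :=
  Nat.beq (lo ut 0) OO && Nat.beq (hi ut 0) OO && Nat.beq (lo ut 1) (OO + SS) && Nat.beq (hi ut 1) (OO + SS)
  && allb (fun j =>
      Nat.ble (25 * lo ut (j+2) + 25 * hi ut j + b * (OO - lo ut (j+1))) (50 * OO + a * (lo ut (j+1) - OO))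
      && Nat.ble (50 * OO + b * (hi ut (j+1) - OO)) (25 * hi ut (j+2) + 25 * lo ut j + a * (OO - hi ut (j+1)))) 11

noncomputable def okc (u : Bool) (Ki yh ut k x : ℕ) : Bool :=
  Nat.ble Ki (x * k) || (u && Nat.ble k 12 && Nat.ble (yh * um ut k) (x * k * SS))

noncomputable def chkC (L Ki yh ut c : ℕ) : Bool :=
  Nat.beq (get c 0) 0 && allb (fun i => okc true Ki yh ut (i + 1) (get c (i + 1))) (L + 8)
noncomputable def chkH (N L : ℕ) (cl : Bool) (Ki yh ut h : ℕ) : Bool :=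
  allb (fun i => okc (not cl) Ki yh ut (2 * N - 2 * L + i) (get h i)) (2 * (L + 8) + 1)

noncomputable def chkD (N L : ℕ) (cl : Bool) (tl th D gR : ℕ) : Bool :=
  allb (fun i => Nat.ble (100 * (2 * N - 1) * SS + 100 * (2 * N - 1) * get D (L - (i + 1)))
      (get D (L - (i + 1)) * (200 * (i + 1) * (2 * N - (i + 1)) + tl * (2 * N - 1)))) L
  && allb (fun i => Nat.ble (100 * (2 * N - 1) * SS + th * (2 * N - 1) * get D (L + (i + 1)))
      (get D (L + (i + 1)) * (100 * cnd cl (2 * (i + 1) * (2 * N - 1)) (2 * (i + 1) * (2 * N + (i + 1)))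
        + 100 * (2 * N - 1)))) 8
  && Nat.ble (1800 * (2 * N - 1) * SS + (th - 100) * (2 * N - 1) * gR)
      (1800 * cnd cl (2 * N - 1) (2 * N + 9) * gR)

noncomputable def fN (L c h q : ℕ) : ℕ := get c ((q - L) + (L - q)) + get h (q + L)
noncomputable def bRN (N L Ki q : ℕ) : ℕ := Ki / (L + 9 - q) + Ki / (2 * N + 9 - L + q) + 2
noncomputable def bLN (N L Ki q : ℕ) : ℕ := Ki / (q + 1) + Ki / (2 * N - 2 * L - 1 + q) + 2
noncomputable def laN (cl : Bool) (q : ℕ) : ℕ := cnd cl (lamN (8 - q)) 0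
noncomputable def rowN (c h z q m : ℕ) : ℕ :=
  sm (fun p => Nat.mul (Nat.add (get c (Nat.add (Nat.sub q p) (Nat.sub p q))) (get h (Nat.add q p))) (get z p)) m

noncomputable def chkW (N L : ℕ) (cl : Bool) (al Ki c h D z W gR gL wR wL xR xL : ℕ) : Bool :=
  Nat.beq (get z L) 0
  && allb (fun q => Nat.beq q L || Nat.ble (get D q * gw W q) (get z q * SS)) (L + 9)
  && Nat.ble (Ki * gR * wR) (2 * xR * SS * SS)
  && Nat.ble (Ki * gL * wL) (2 * xL * SS * SS)
  && allb (fun q => Nat.beq q L ||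
      Nat.ble (fN L c h q * SS + rowN c h z q (L + 9) + get al q * xR + laN cl q * xL) (gw W q * SS)) (L + 9)
  && Nat.ble (bRN N L Ki L * SS + sm (fun q => bRN N L Ki q * get z q) (L + 9)
      + (436700 + betN (2 * N - L)) * xR + laN cl L * xL) (wR * SS)
  && (not cl || Nat.ble (bLN N L Ki L * SS + sm (fun q => bLN N L Ki q * get z q) (L + 9)
      + (betN 9 + betN 17) * xR + 873400 * xL) (wL * SS))

noncomputable def sme (L : ℕ) (f : ℕ → ℕ) : ℕ := sm (fun q => cnd (Nat.beq q L) 0 (f q)) (L + 9)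

noncomputable def chkDer (L c h D W gR gL wR wL : ℕ) : Bool :=
  Nat.ble (425 * sme L (fun q => (get D q) ^ 2 * (4 * (gw W q) ^ 2 + (get h (q + L)) ^ 2))
      + 50 * (gR * wR) ^ 2 + 136 * (gL * wL) ^ 2 + 1)
    (1700 * SS ^ 4 + 425 * sme L (fun q => 4 * (get D q) ^ 2 * (fN L c h q) ^ 2))

noncomputable def baseN (L : ℕ) (cl : Bool) (al c h z xR xL : ℕ) : ℕ :=
  4 * get h (2 * L) * SS ^ 2 + sme L (fun q => 4 * fN L c h q * get z q * SS)
    + 4 * (get al L * xR + laN cl L * xL) * SS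

noncomputable def chkUp (L : ℕ) (cl : Bool) (al c h D z xR xL tl : ℕ) : Bool :=
  Nat.ble (baseN L cl al c h z xR xL + sme L (fun q => cnd (Nat.ble q L) 0 ((get h (q + L)) ^ 2 * get D q)) + 1)
    ((tl - 100) * 40000 * SS ^ 2 + sme L (fun q => cnd (Nat.ble q L) 0 (4 * (fN L c h q) ^ 2 * get D q)))

noncomputable def vN (L yl h : ℕ) : ℕ := cnd (Nat.beq L 0) 0 (yl - get h (2 * L - 1))
noncomputable def eN (L yl c h : ℕ) : ℕ := (fN L c h (L + 1)) ^ 2 - (vN L yl h) ^ 2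

noncomputable def chkLow (L : ℕ) (cl : Bool) (al yl c h D z xR xL th : ℕ) : Bool :=
  Nat.ble (baseN L cl al c h z xR xL
      + sme L (fun q => cnd (Nat.ble L q) (cnd (Nat.beq q (L + 1)) (4 * eN L yl c h * get D q) 0)
          ((get h (q + L)) ^ 2 * get D q)) + 1)
    ((100 - th) * 40000 * SS ^ 2
      + sme L (fun q => cnd (Nat.ble L q) (cnd (Nat.beq q (L + 1)) (4 * (fN L c h q) ^ 2 * get D q) 0)
          (4 * (fN L c h q) ^ 2 * get D q)))

noncomputable def chkRun (N L : ℕ) (cl : Bool) (al Ki yl c h tl th kind W : ℕ) : Bool :=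
  frc (1800 * (2 * N - 1) * SS / (1800 * cnd cl (2 * N - 1) (2 * N + 9) - (th - 100) * (2 * N - 1)) + 1) fun gR =>
  frc (tabl (fun q => cnd (Nat.ble L q)
      (cnd (Nat.ble q L) 0
        (100 * (2 * N - 1) * SS / (100 * cnd cl (2 * (q - L) * (2 * N - 1)) (2 * (q - L) * (2 * N + (q - L)))
            + 100 * (2 * N - 1) - th * (2 * N - 1)) + 1))
      (100 * (2 * N - 1) * SS / (200 * (L - q) * (2 * N - (L - q)) + tl * (2 * N - 1) - 100 * (2 * N - 1)) + 1))
        (L + 9)) fun D =>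
  frc (gw W L) fun wR =>
  frc (cnd cl (gw W (L + 9)) 0) fun wL =>
  frc (cnd cl 1081000 0) fun gL =>
  frc (Ki * gR * wR / (2 * SS * SS) + 1) fun xR =>
  frc (cnd cl (Ki * gL * wL / (2 * SS * SS) + 1) 0) fun xL =>
  frc (tabl (fun q => cnd (Nat.beq q L) 0 (get D q * gw W q / SS + 1)) (L + 9)) fun z =>
  chkD N L cl tl th D gR && chkW N L cl al Ki c h D z W gR gL wR wL xR xL
    && cnd (Nat.beq kind 0) (chkDer L c h D W gR gL wR wL)
      (cnd (Nat.beq kind 1) (chkUp L cl al c h D z xR xL tl) (chkLow L cl al yl c h D z xR xL th))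

noncomputable def chkCell (N L : ℕ) (cl : Bool) (al a b w0 w1 w2 w3 w4 w5 w6 w7 w8 : ℕ) : Bool :=
  frc (10000000000 / (15707 + 200 * a) + 1) fun Ki =>
  frc (Ki * (5000 - a * a) / 5000 + 1) fun yh =>
  frc ((2500 - b * b) * 10000000000 / ((15708 + 200 * b) * 2500)) fun yl =>
  frc (uBuild a b 11 2 OO OO (OO + SS) (OO + SS)
    (OO + Nat.shiftLeft OO 64 + Nat.shiftLeft (OO + SS) 128 + Nat.shiftLeft (OO + SS) 192)) fun ut =>
  frc (tabl (fun k => cnd (Nat.beq k 0) 0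
      (cnd (Nat.ble k 12 && Nat.ble (yh * um ut k / (k * SS) + 1) (Ki / k + 1))
        (yh * um ut k / (k * SS) + 1) (Ki / k + 1))) (L + 9)) fun c =>
  frc (tabl (fun i => 
      (cnd (not cl && (Nat.ble (2 * N - 2 * L + i) 12 && Nat.ble (yh * um ut (2 * N - 2 * L + i) / ((2 * N - 2 * L + i) * SS) + 1) (Ki / (2 * N - 2 * L + i) + 1)))
        (yh * um ut (2 * N - 2 * L + i) / ((2 * N - 2 * L + i) * SS) + 1) (Ki / (2 * N - 2 * L + i) + 1))) (2 * (L + 8) + 1)) fun h =>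
  chkU a b ut && chkC L Ki yh ut c && chkH N L cl Ki yh ut h && Nat.ble a 50 && Nat.ble b 50 &&
  (chkRun N L cl al Ki yl c h 35 60 0 w0 && chkRun N L cl al Ki yl c h 60 100 0 w1
  && chkRun N L cl al Ki yl c h 100 150 0 w2 && chkRun N L cl al Ki yl c h 150 180 0 w3
  && chkRun N L cl al Ki yl c h 180 200 1 w4 && chkRun N L cl al Ki yl c h 28 35 2 w5
  && chkRun N L cl al Ki yl c h 20 28 2 w6 && chkRun N L cl al Ki yl c h 10 20 2 w7
  && chkRun N L cl al Ki yl c h 0 10 2 w8)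

/-- certificate: consecutive cells, each given by its right end point and nine packed vectors -/
inductive Cells : Type
  | nil : Cells
  | cons (b w0 w1 w2 w3 w4 w5 w6 w7 w8 : ℕ) (rest : Cells) : Cells

noncomputable def chkCells (N L : ℕ) (cl : Bool) (al : ℕ) (cs : Cells) : ℕ → Bool :=
  Cells.rec (motive := fun _ => ℕ → Bool) (fun a => Nat.beq a 50)
    (fun b w0 w1 w2 w3 w4 w5 w6 w7 w8 _ ih a =>
      chkCell N L cl al a b w0 w1 w2 w3 w4 w5 w6 w7 w8 && ih b) cs

noncomputable def chkN (N L : ℕ) (cl : Bool) (cs : Cells) : Bool :=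
  frc (tabl (fun q => alF N L q) (L + 9)) fun al =>
  allb (fun q => Nat.ble (alF N L q) (get al q)) (L + 9) && chkCells N L cl al cs 0
end KP


set_option maxRecDepth 100000
namespace KP
def cert1 : Cells :=
  (.cons 50
    9326009803640281246356780530935400015
    9424670099601701098571857404334261856
    9564871939790029248670844779977229944
    9663532552664099157871210036004325001
    9736229779653528262448217304378656405
    9268890418041783951755302871071049286
    9253312576670196135557294437703927363
    9237734418347271455410584786537776704
    9216963963165809586380032415505450557
  .nil)
theorem chk1 : chkN 1 0 false cert1 = true := by decide +kernel
def cert2 : Cells :=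
  (.cons 13
    287983685105968013265303905704323387338059
    274201324954076148489668371128504526335143
    263736941163958250582153920962019874548822
    254463623547904339875227509278877166513153
    254038249819431946049182719400357548076080
    290961353137118050932079402099552157560154
    300149605355006410261222727346365617581542
    314442435792071622196395719063894785601218
    332138323567868539293796256927526002946002
  (.cons 50
    237022931969773648380296445600064448572191
    223921178092317052770927949456795577477576
    213712021655231191613204314980380357322961
    205204386097956575218470488887584568322046
    204183476686145244170662113206300561139707
    240170756762225546209431644175198480100203
    248933624865779989285974754604082156612701
    262715995404484191820215674925933270019549
    280411893565508748010896679395733659299789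
  .nil))
theorem chk2 : chkN 2 1 false cert2 = true := by decide +kernel
def cert3 : Cells :=
  (.cons 3
    4309907672287353486203312747304507210694043326
    3908471287930095566248015064144734995855941776
    3639452724715962492518931396998743474540403586
    3459642331986298974903568389941919577852434429
    3470792789749617994897019692391542812686604062
    4436750562280314255009782978050483751083600110
    4715525701617458434651991642636461516486995129
    5181080301712474798696306787003046679909790462
    5841777397247358927424718768722779963747253208
  (.cons 4
    4109185907211341609092018958835074502185100449
    3752352629857200971912257288180297485402857228
    3508423255889451255696725455149216297849379439
    3343945136021560989358635400449127719848253233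
    3352308000645448908866362452921067086825870944
    4220696354216922556650215373847246286437459605
    4466019184586251750773317227869279400093198841
    4874425912947526097649476802419182092688535432
    5445916539316322170941646161853736862200657739
  (.cons 5
    4209542919174993386027996475676237961975620948
    3849920942789683667623565275231210122094911422
    3601809413482648954911063140786547794043575073
    3433149223346066373067916357168924380733626337
    3435936901665129339854353399412347752973440783
    4321053706452558245409530874749995568303335240
    4569164895586264905811841915170987457929259695
    4980360493135469635695463308142133294040936517
    5556034380750865576857183533005760837709428757
  (.cons 6
    4196993050130960103586126730965951204042433981
    3852703176440272670201943050599257142445137970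
    3612954937073734963366941829968222981889956764
    3448476476985780267674321296426399062774077534
    3451264325456410971637693241011760679570380684
    4304322192435679836182308189072634796171618219
    4542676635346732841319590204894104657604029196
    4938540300347691043452704558584202191892738202
    5493306898932487550226910758783818668579616863
  (.cons 7
    4093841724435508013199329101962510498539873755
    3774641125025448321709517356233813949260406886
    3554406888538159238704986632182423182616845280
    3402473193191213553899896629615806431059155114
    3403867500314289125837607235188975707121129431
    4191413865310988344509994433617818421362272192
    4410254730726905474976368329075776892478139155
    4776847731717320414071421774223736233483645064
    5288405360203007930331121368688072603266447402
  (.cons 8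
    3905666510962006549931858805902140386288952760
    3617130542205891808400159993037953181442728036
    3417804105110453535665404846008832096251780084
    3278415089402772301312753464287149089670633676
    3281203448307339564886764567999029344501569527
    3993481735494415149913214226214354580760438674
    4192808768229381748443490046972162948052822734
    4523162122386633037859457011822204738527195166
    4985935424389508811027853652499976604122871687
  (.cons 9
    3665921420095306474195113713832098069815829857
    3409443282985634956174513212605499609210773557
    3232418101481128661165856688624611152722451425
    3106967391778937355561855122217100997327460554
    3106968157497343164126125504218491901413332981
    3742585931751272919866416952876341237465622316
    3919611878994954527940878094973863967863024204
    4213725756538108496365038929547918683530080106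
    4622139971225726517242289559030851590513571467
  (.cons 10
    3657552175223778334267800378519970320144180473
    3385741680311553059537363491573090582184468475
    3187808869608306186729560850125088432628276166
    3045632090568090275650104183741346627397703875
    3034482228454686711418275758648838550496401392
    3741185924966060473403994365722536144880756404
    3923787398770971519952830359263942373728922037
    4223476972995769199828421761963395584136048287
    4641648359144768678995179673555693801633478002
  (.cons 12
    3982315029331190124239475525374848468754835049
    3629661015248514732541401835398050639754076504
    3355066415381912324824717502928171264465050901
    3158529358027774598645110660824820897879251465
    3123684188479645824630432743370405422276434224
    4096613579806291209753897699015811796023666731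
    4323818500673417377819567348508675066957097786
    4697382781335310033866232013194477368479576126
    5220093759730009998073368395492615746534111036
  (.cons 15
    4240203807288817250924255028565242452851533567
    3887549877939226371226609907699614400102752809
    3631074803355301169149191154814007943568055828
    3445688118346002405733104070183523442757458723
    3434537575532866232001723093211903073966692945
    4347533119802219034977761252371562409290672296
    4585888328379754878643257919752910599546071956
    4978965591245149114272670984856720186375319646
    5525370771541125389330586050816051292487202569
  (.cons 20
    4230458716594044236994255381090557080234059667
    3909863809858408763109674960025369426330477348
    3681265772690338698371492111274309452293857115
    3511211190261432005130126334256013653454380175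
    3511211105138920158736834425350725112472263627
    4321061534411267932394211963051194471053142285
    4542690078187787354208732684106707968721595318
    4905101689655979279746534308905407245878374406
    5399932738613743898849273661767491366791525867
  (.cons 32
    4013013519711163415696731215088312889140783151
    3721690553065723950875486005708686421421073451
    3509819351021585742663302260064572305169227959
    3345340380333540036162481452689776134505684505
    3339765023892724870529813398991704014864588134
    4091071232484239456690067024477271012389677431
    4290397584768700525978037316551195167019789278
    4612386458210046517780265950626593300225060795
    5047280340939906321838034682209920669832869102
  (.cons 50
    3031714031062368297330352006569852832867000072
    2853296158786419919686382169959609993433816195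
    2719482839666927708593963472176310302416951893
    2610759560411469645990006569371476988870072483
    2606577915474970914397871657472816801878792247
    3076318499127460376719094986536987147015479246
    3196193086831390961414772829480047782659023181
    3387156149206504686015258034231636969178784682
    3636662581250191002906061609355293709165110978
  .nil)))))))))))))
theorem chk3 : chkN 3 2 false cert3 = true := by decide +kernel
def cert4 : Cells :=
  (.cons 2
    67621814031788895470992478635827534195545006759223
    61843997562955773414589660226887870642667178564175
    58258545063713669965849966743501803029033531086835
    55929137441222724414029765022494095468559571129927
    56705589460547021291683607253096550628998546019819
    69334606047753877826161583039369094644341072371252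
    73399627713454236250729172310141331896737673961467
    80090925918077202373005164621465679825011931833056
    89248641950461303654449260202914546997590537905882
  (.cons 3
    68603845472853120551320295710103314679625931021711
    62940192093537148637152060958690364326738760112800
    59400397581985338657143495795860167734278946838594
    57048144239324551185105989104563294791440928003730
    57778924332056883617459727688017884141466525439548
    70248132387161413378881425300527533935290021387915
    74244658707951289354507321152932255381957769781338
    80821796610650249958896734631737903749729539777355
    89796851420928461895345212668220843649390550951765
  (.cons 4
    71024634585289690989859905196760740036136911871656
    65246769331874703003578806296685217491130964712330
    61615610060105166073159823743312309170092524509452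
    59171996138701483313012118463493955820862220261189
    59879941661976938534764932664516063557618035152624
    72714603182680938373582944787155484523449738665905
    76825331620568395989940337974646370040989965328802
    83585197649650951120590596453850027330236489196749
    92880011697340566934562515039297713393306821994794
  (.cons 5
    71983828669388845393999979914487453102922539605868
    66251613041054842611560393678341540168420046412841
    62643275794062481321947853116032075107443830692241
    60176816152659134172072021109536074394607045613495
    60839089749597852301873661720441256690385486976866
    73628129522088333723195567198580332431752323817600
    77716040116503264639528196263325085087365964489356
    84475932628231306768641457760890322152732218320357
    93770787096957573929880365765230628755903288765061
  (.cons 6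
    71298717718547878305388120652447964008693275975631
    65817690716083000473813584003680413010104028634226
    62369201029794400327957991901005127272825785620936
    59994081059589711278476262363790916257603800258528
    60610685517784852516931329779715476549893777774475
    72851677506252123241748719286638109281047916175594
    76779741933759883500012669754546544281481725027080
    83265616825688536622285521628056243983111927522944
    92217949966414986635270289952994685231013432175437
  (.cons 7
    68832295713225241788499650268953036571567158910924
    63853665475310468474126076672572699982400138845282
    60724883454513530543291399414963583579380830591405
    58555289940332229847862214691219637506797054039996
    59126222472105573787229513591299728789188226078565
    70248238328122705729653543186255081658969382478058
    73833761914563603217238598499093790027552881713937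
    79771569509402005214463039703134849693377102177943
    87970311684607981142199107435998876305073051691894
  (.cons 8
    65498016511492903179160276277202829185919322414969
    60998961013436035869032510103706707462181535931406
    58189899202725282090513413572355129813846596622679
    56225841901228469888727082745761619697583367247716
    56751106688139887628305100026939579299489235097357
    66754100415228920544209035459885247357310112997527
    69997072009890068437536449734170605560657414415038
    75363962405993675538102691144495855223664756090435
    82763419388086807825892522749477383593196993850143
  (.cons 9
    61980991065297840721403582542074441409920137420517
    57915846743711712182073589707561444275124954405763
    55358007010413270449379648542236616872056649029843
    53553819570790786453712746235393838000833582683875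
    54010582043553547157707205382496703030234418517646
    63100048039480916746420343311482125932321698291712
    66046135387139186232341137668474424414492942475808
    70887769360302010660438656188433459854684781094296
    77556433706514670392470604135519714369308641061471
  (.cons 11
    68763424040262016826224867999320686834133314314385
    63259576410644548737952477749017299319279819578587
    59422900443170686353237003450522862934206946269681
    56682421790893587496537803776723355648397391976407
    56819487749473150034923628510135741977654004815747
    70384880565312283111766687786434086659129608462787
    74175929211683186722798763376148077694891616363553
    80479117788318557654680582357927672156097726392325
    89180260904445452337425303909763908977233950567786
  (.cons 13
    70453240697150821250300184143979027525289298124559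
    64538354095239015676906272276774150413490986703744
    60290632185552138791612787372720122844222062991539
    57184773941787063199554259576603497542618079237799
    57161982582746604604905990119119305659341438981722
    72188872856142691120264025987868221917600164487214
    76185436806718069515831014069556198978238479180402
    82716965499673044483793193148031104802860264416804
    91692108113266160358133930015283008958849144662840
  (.cons 16
    73308295017362792887290383813430892599218455486249
    67735946461608463223095687832229512842743187053420
    64081948435079025228334411905344400777989111601267
    61409962334249445293297917072134709659669210797628
    61912386973114950784703325585006293839950560171492
    74792730190768634855159426282752043688638026588240
    78789291356898563594928535032031205309864307139247
    85343653230362984011708247818172264106125522249354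
    94273112773882441021934910379770477150519415303115
  (.cons 20
    71732588480191511499066677019455170523251312648125
    66251589352381995068779661971674047507860777933791
    62666102003886513725549509274114126511088079034564
    60016951867161019115726249407712260749886358902386
    60473701793287563664104660394489547263422131459594
    73194186296462292203228270437796027964281250947313
    77122236786004391644463174998250659297353718457185
    83608085195457963750952164180670697799470172890969
    92469032669273581300365562639589229615001667464390
  (.cons 29
    68512529517635660752592631972542778090586004496372
    63191397464958059765750260958969260241161458490349
    59674427764585368847323734921617024710741148833956
    57025283204577423735316756303645580704107059516974
    57367849135088687540406418407453276363549028373935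
    69905615262416124748275068688417860202198935806264
    73696640216286886818603403863986716006575871124414
    79954113662464549132661493666449608782978934253532
    88518175495735842083643661699201804200347961748864
  (.cons 50
    56774061126739976904931470396284567074679622426201
    53188576567453945071118802884438697532509903657842
    50744968220470869491696901021900944239203227277561
    48735272443585070259101051400475874910192645412613
    48963650195389984287333725733091419689506934199960
    57619046122461519901222384319264557142851892109110
    60176845436424794834327733788762742215973112439033
    64264758818858399880944648557763764209803923268552
    69677247269144357245429651031333235917580893398908
  .nil))))))))))))))
theorem chk4 : chkN 4 3 false cert4 = true := by decide +kernel
def cert5 : Cells :=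
  (.cons 3
    1262822187228262067539832317828449349302792324162657150
    1157307135021042021903279308573124753242309106987685901
    1099311027562565827462602459233726337290289393428927871
    1063390696905694732141975047854392940212666112311563185
    1089207849431398814869671104871608369824241968477574053
    1291633065989572128117826974757233181889441951413722260
    1370582174473643817746390080092168301705859854013243090
    1501166227374276702620309920466075672619380643839599230
    1681514388406114553896863394630533386140921269160028045
  (.cons 4
    1174144159234296833271369686924098523115771302108256770
    1084717979352286876076359200212902211206769969460483823
    1036075916288085980576391369009912935278925793583092893
    1005019759961711114558753554030188993984798831245300466
    1028217878703416829847141080059914930565438960695104224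
    1197716787748268016949408259275932653831270974657846008
    1264318605127020079149240906194522121725222792569969906
    1373949725544793079808181065082848230295469495104331816
    1523242598018250174321737361822459170765608271089001608
  (.cons 5
    1190607290223990551324546331187093613528038583722564322
    1102303338071600567293930503400577668003935672069543872
    1054035305241165184618529840916947629057946596561442143
    1022604913144811780922381521923004036536061017776870311
    1044306522714992478474007779746884152102443764494635917
    1213805797156162158953145003875380911165168387397786589
    1280033698478176871922174352159597700746307836393102817
    1388542682511576454536404599427990625810853952254419240
    1537087745711703578835791187415852845029744217301067171
  (.cons 6
    1174517984075415643711762636047733878081316606151383870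
    1091452053803763699874724658183410892032057318666131487
    1045803054747569768248827587594881852040531300341355962
    1015495095908686412912882740582030528466443812019196923
    1035700173467197619697280864488626171479677979840664535
    1196219913326779017017011649891877550428576339489135672
    1258706370448864009181212874241396538149379434200063544
    1361229112268313956169610151422461651783528681470222712
    1501543043898012908345042969171134573497081349634188777
  (.cons 7
    1129243540577709686136910813710613923876082035084303134
    1055157304751932458364351348550102111384935682235471892
    1015120677522089301467444739240562539872683176817546679
    988180178317115015996418775430347753831731744577639419
    1007262845447150274799892012272826573668546105173660621
    1148326367544154510113835377231440396188028588204579858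
    1204078088084732742733745294156041672493881826786844160
    1296124512102785894497227395640630114409634560081256737
    1421472301542022996772717605183451237267424512778331491
  (.cons 9
    1145333212352593985653817026727904581754177926902553940
    1070872763605343601082904028056433765761564085082528286
    1030462220325730291269411791652822154285035506660366234
    1003147736557521586826894339422202483863977325766710718
    1021856601813422591081184345146208856551967044578170245
    1163667704801830663234710704266278042993973413276917333
    1220542064126336413875937956382168534388424190479655009
    1314459598454336788721281132144959817641164686053663670
    1442801136991629511380350554115928572694222556330715205
  (.cons 11
    1131484273659281430344573509684476086689961101686807585
    1051411955556318421891848040211448771656376893803649333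
    1000899627181106032353414172495222291850534961647015643
    963483244117968743806053971154840962977167806647276817
    974335008058115398628284704670966822941722880835359946
    1152063472749414685313666569021721780894046416931626246
    1209311748087449155431267049584939645809186826743209689
    1302106392362055686293520069758626198577399145230475721
    1427828143428210089944341207045529464614232636432213440
  (.cons 13
    1170020943177719164269232505197691715102233634502220597
    1080220755988504491105922440319018269405071256436512900
    1018483775305838553616180519779030889608195854985680462
    972087606452975151739614268968986037235460094443902105
    978449363302414545133023370579132930784203836716520525
    1194341654972883456408774415919729982190170300796427270
    1255705473245533597194259758524157381927945779880353200
    1355608747293150404330498218532105809097808680795250779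
    1488813181200649883743208216304167551249679166178960364
  (.cons 16
    1217920495075082343254114481028142729253533132202040225
    1131487379185746737417295848225674005559982200815261954
    1079852023671673621978087339830385651619762069112854248
    1042060925173221841125001197226826923428933889274565961
    1058150208513715042138691951379196986432971676665009423
    1239248142902660027351770487524284762887750172133579881
    1302856941927213382610280121609753603310585730635816465
    1406501888620809448865973797159422607673291515053727933
    1546441241904846603628305443470562302341947172585514069
  (.cons 20
    1176763215972716956822645525645792200169060103752981423
    1095942608936661167921068559801147723916058696139954460
    1048797237687088551048870090628443962245716326386226970
    1013251165583194040945073601114054744242670904088319373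
    1029714593367931185344364922979023862169667133926020454
    1196220004674794534702215830486424365015096905066519662
    1256461298396299821431756752757405986557491678018936341
    1354867857835140780264514396256985541409935057408057536
    1487323820329522075777264003052840933633163398334391381
  (.cons 31
    1142340193892458316703612770307794496637814985970212115
    1063764681758850069305269064754877350183926608969701961
    1017367759239752473136831861272629587806920930177095708
    981073421161382959809834237568398474941160266911143529
    995291959623092004850610261695316832828302620212024896
    1160300290719973937834668268839576702073555463701831133
    1219419059835975028074700144861502837217656271943884716
    1315954782995035114775558479914164888518492555523220121
    1445791597533965151009701448528205807007228386891425415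
  (.cons 50
    868073881943493573654593272709243052427728976348862406
    822799438353792277658221886045205009887879991900493258
    795859327367161262615078017407612697391197794344358943
    772660888948454516566687119657075062119252884198625982
    781641017302719726831390303474358317123960088352051844
    877053918937178679754323926408275928034891488309663826
    910729177574956101960819452798841935196086135690942857
    964609582259620998639478421853929537266047243046148976
    1033830935820531986829794410099973029870442032367967716
  .nil))))))))))))
theorem chk5 : chkN 5 4 false cert5 = true := by decide +kernel
def cert6 : Cells :=
  (.cons 3
    20365163469495999716739349650223269865844207573187496351695
    18875489125312436664787640846954874099391521586631640683965
    18201146561633446898826147942197467619143692169095350080580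
    17827190335863497434736980860683354398117431668780691100468
    18452479199507829824726366813020718990701335611115794830154
    20732984475286128559017982218396747102004666721139478354028
    21897748811553942405899488194392333816905323638687770958284
    23810414001661075717897741429869045092446511154860038200329
    26409676856330564356938391111668167474420570604818307145489
  (.cons 5
    21260191378946163015250283207080082065916874165861960472952
    19758247716642460233253283332928971380494539981345084299045
    19040989665424549326327940957115272596473135804400751007107
    18599598771636487178596460923443419366530438298988932748371
    19163589684117085596241332650556966570095840708100887368820
    21621884647439352999108582215701849453700993466082369657380
    22798916431036691752346672757344789330754509309434503846838
    24736115019202349742620692675902452297878583000778804371013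
    27372176474416199232278828931368839775859200642087497130432
  (.cons 7
    20555202273485290706314461210110388533131130101895604345266
    19280072067503434669159185909102969299664640003241578256202
    18716069182949457092003233994456956505094006211841159206300
    18360502529434118558079713243267219383928116389150826632289
    18893846898260168373946594430513322964822234666946422002824
    20843333510922039271716353182723675407712751950144137665123
    21860984261234929693643409573231635480213229900561719172100
    23534590996561464780257322909621099638476475847946282606250
    25802849031138342043871106529622207230001321270658420908608
  (.cons 9
    18483140340070233049409417898578105925938781443402758215786
    17471615830659264689409286853667819366270899099968350246414
    17054746736292800777400954075141848659522204781620022580318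
    16785009935422012208230257587425253354849876973270949368605
    17263188206106914320379862292589723343417910030495583933243
    18685445466375139469114221135624829408423733723884401629461
    19513057041020805872717193727765255950962702184837890611880
    20861758257913456702106156776254766532402544686738780249395
    22664113700791811493096984115577218110012138567362276090008
  (.cons 11
    18403370874296706981353326135748614041155548453668918302478
    17214075011971287934777163862502911458722519674584851535022
    16539742925477875921478716489400547877052722384108326998773
    16043192294848758609634620751297531516736224128901407101352
    16337467358865865976550711028396262646751280690974875996606
    18685366516878451005647181597578523783182338152331239905208
    19568148304728648683492304477825773019020234971066927782218
    20996539663205643694345801008681071453852855362999834516433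
    22903104427782153223344263894566859169281708337671211540271
  (.cons 14
    20150525793567754320796726933743002610765606310555132319883
    18691498367936749996342217706753278174072677722207387489769
    17827124860384380238443194025700677268860329979846499095546
    17195704519117935382711130372089031642449469439127310144129
    17496104700827333377086916846416087209538956693831037932172
    20506085338156395177170079334724404875454764783011912456522
    21585034038833756676351839352531496672049830864547225361161
    23332196443619792629782633441836221934229365614188720250333
    25692397474701737059162783832491615572607061471997373866409
  (.cons 19
    20230295632297960450071941570083023406552093251792371702189
    18906130806527885523825327909261376072133027205364695815959
    18225657137133208358975026058458515170289758352331756344623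
    17741355244625849878599657621536168124880188127901686682550
    18170482432414482509163143089212565611901979638880724734908
    20518423876784864096495859723340942098984279587640975628900
    21560590440094488729374406862298992495702256317949012401180
    23264838854924100179070449157410612910253484969163982773987
    25551474863073077808296408655699472741211995697694313898652
  (.cons 32
    19237185018388860532703839411620025201518058735570483321649
    18035629564624937437080318270490264587077659916418274072741
    17428722791168940067304979412568146575280454371357323187895
    16944423892639025325804092339414898434904030836988732118315
    17336770814010352806933908303447142948142208615762958914848
    19476268915332622124230683109177223846077654018433186864095
    20432610115844905097572624266711554236639910529778548989325
    21989729978737226530709682747965692422965321184620378087490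
    24067933123284360282157624932663837809499721484865736942556
  (.cons 50
    13456221579099207205441026903753489311659379908992911414086
    12879965838825271619635560770210425432263380136127906075104
    12597969447634994161788139893731692688675318793767658213565
    12340494107623172248055978629291351178218886760955459833796
    12561189554928286205529472103903672309944496293187684372398
    13548176924037168096930272067465195825658633607192057205665
    14007956268217520422536318763059849483817267880283940164737
    14737473161900036293900601346373076853464723046143870211548
    15669292562922182477213403621031461701316380482865980446611
  .nil)))))))))
theorem chk6 : chkN 6 5 false cert6 = true := by decide +kernel
def cert7 : Cells :=
  (.cons 3
    328339451402736088680429054367124101307625750812542968587261183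
    306343187275174280094636543389975649185578076000069186513113845
    298307957588882863257604348101270782599532057246882475616080296
    294792486370064552420341734215193124844642345751497063872434370
    307648634435123075292933624884905131174153002973235768137273629
    333260993421505531375736479729546075584721899479583357791049105
    351340088594213407662309637654831157045216844674771542726842106
    380869273290122097066629355637877593034518488993432297730758978
    420643276540995217183374639072147548825774158212243834737450068
  (.cons 5
    341095263919743176983345972160915211819277853711302441475397297
    319400178074713724140510596593019988027477472767949150653797526
    310862712816045787985764232573975315935634665902686732655547182
    306342844014131510401015766546503577678032834351336534095024684
    317993819191042753243777493768016575420587130178333945476764275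
    345916396830301033569531365920899640446520813272100714969929544
    363593849441677002457499753527428951396375713595238246527178938
    392621031508647977587160684319084930804339689211245730411027217
    431692213914534355624584301849452361734666911524622553142140469
  (.cons 8
    345012739456770824671152255763965993693325919474363834616699069
    325527205687425162602000161976031423404551616277294903398700675
    318797662202325239250800782450641627449141184642698014677079283
    314880480987506591825641805905349337209310008525814478277333957
    326431181916562567473538791296369864201433676774607639550759920
    348729059548658204254598386790212680425232613794461017675553114
    365201363794809227582211097060098792863197623594437126307142362
    392219959122466199779368236428079441635904378299675248894909766
    428378682787557429362967305274858755374075470070106458854219908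
  (.cons 11
    322111432464465961276957435866771940549167167305488581592356532
    302324695907999462046001741036086658609437144875182699636184257
    292883475130981050671806730363165101241972798324695316011815769
    286355025727591532527340662201594239464473025678523949652382273
    294189627251976461938274755936712262483130608528086989695668823
    326430323668549637816397491510916370525409175883035648595433276
    341898211934549368682698398839843530457278609049804963262109833
    367309746597725498791778750082318286356594358429085727242738338
    401057879268527495319996371858764052682311400035866100937186668
  (.cons 15
    336273744824793937056464307821315555404739755459193691057887009
    315281761806924974377099413723795435067723231604584065846924610
    305639569540732213200642437203300990548725329459481826456523777
    298809702763056751008100824225243424078855403953585340779565833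
    307648530209336465454920313654361462944032278452794243269579587
    340693088053698966320941907176466410953148734531403573122701211
    357366185990358060216421126220361895638864614891646557871773928
    384685953462334024514311318728301225337666406446557706737867522
    420944914581918112874008917383795903165192706745622597320400333
  (.cons 22
    333663046795661687749111321135912569319395949048814696308349280
    314177647888917462300569651265757763649211154196632623134922528
    306343352886091563643511142289478776708216903673845633346475396
    300618286673856394223929050945420702389239947929372315377325116
    310260601546803246921385530392380362591356901293077732563440733
    337077998572201476673401163208728390845415422814571923861920245
    353248897722363662527513927316878318449902634526453043370515324
    379765141006860302293654798685327697048598988012410583960313329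
    415019698424590753024863499201037729492601169008544008747311412
  (.cons 50
    296701038018010095906008538550428957566856897344543869849966430
    281032368312861573743914705190279764475924385890380964837283170
    274704675813352545878796888601486755108125319542678737899148264
    269381368633981796923678948209950750679877510956200409975575209
    277115309711531982747445872212164128864039836780367111982011059
    298910712696331224760699417648072065974819792518040000365402074
    312168834338766651110080427214177257748298497626464680397920557
    333663065193841136903702896648509702055193939358741817899817802
    361685923242367148980491439068257801937393695397337874528280076
  .nil)))))))
theorem chk7 : chkN 7 6 false cert7 = true := by decide +kernel
def cert8 : Cells :=
  (.cons 4
    5915980399255159905231987848309114632229191726851361515443722212834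
    5532554233915164528650145488531503177789570491649524654933721125926
    5410778359434948948876161827848926913717958364634800334685488960287
    5364700013544018739005748606317276737964882113945237419476744966762
    5619767181447518159692588284189694606254319108242968341046431781591
    5998260649109125584703125004212279133863332589907233447770542315095
    6320798927425827989829634965464966728292929949595685959421771962263
    6853974444617903444494697400664398359002552121968325517687499053471
    7571457520738212673745640998596410608317108512127709726974481636445
  (.cons 7
    5807372880590631498467826737007251586169797776228897268346260166220
    5489767801636162584413539098819078841724760546652709525154507625572
    5402548929004042340703359416013883407194918509135282725328216609590
    5367990119350637860532806852877831559172420789227340631543408497245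
    5596730519857692650574985955205986526111140961677686267800388653765
    5864969858975823441253629451886589346166468707207518971120205059787
    6141434009552674714013408883424053189879729451111336520254905686053
    6592333997338740255968237262878961398393215301080157907891009149525
    7197922160610033763425665065761473340336302704632495884667285675329
  (.cons 11
    5565460911685335020855774593023823160434535167168519355762017637809
    5242920725331985116966870018287073253765006093327331941755232162746
    5124439174472300383882569916101935211337181278149877551967407821433
    5050389159376494996376857549175942832890713833149944757332861309320
    5234701840683368503573114668956009789350888009906295788389041557986
    5626347995208955578242489664856270381560881348461147955232782652977
    5894584221129831644705732346454737308585010206436310512123061720980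
    6335610578767916934522163501708455031662676770111043664928117414354
    6921451783166731009153149265109324255540503374665363795120768900302
  (.cons 17
    5642812380735472814306629072961771528276529700225183445371442615973
    5335082438157563795860151575065494731266601309413887783997915026644
    5241282149579180096791102610979056924870057541164615295841090524073
    5183685472280335547756660273103687088038537300417660640376113795777
    5391032706193470948096939372290995127525860185888885073545045332755
    5693826336591875428796692759866781985702842244328093402178980861718
    5962061457822533215404756483847815732999713438673830741809137670240
    6399794797783755208835139413354226517617819723762866464351846652531
    6980696475618234481682104138314481694744602863825226971986393554226
  (.cons 33
    5316984801779376784479370499399005416776164022611348256781309761143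
    5043813166913540510108170855561339402314055414886512663038640919710
    4963178923858601762547701926608624733819687404905804889103222264667
    4902291940756353870852889377257192770382581342854235046806760165969
    5088247113501365067824110764780039060523183416928607895866101764744
    5353187910829474663093747927577285441650194140054290351998283896550
    5598384461655132249519770003684046120349652374386368107367783618607
    5996623181240560383528419081719277363508159947916141579991763180096
    6521574188728451015257862924598119502414801235927643617313639636214
  (.cons 50
    3315915866314175931972261248491096785636738176684626015566421904818
    3213888155597349498881957369103254055512645831768307987445445283052
    3194141297428216300516133224170312793467179060540026013181383281755
    3172748633376356797965984259235452333669951687537437644681522465753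
    3259966602252955700123857661734226790568585468932935749074317216746
    3322498185844342932062752955553522538950590840844498329476887563741
    3416298273353198526648762072263778503568724227519173445858442120800
    3566049131672921189929003594093919863802655719096327153963346874155
    3752003500820167535981172000299174084354834616627955114208664358950
  .nil))))))
theorem chk8 : chkN 8 7 false cert8 = true := by decide +kernel
def cert9 : Cells :=
  (.cons 4
    94042520967434669203296222981171539025363462964352657172368462432719859
    88515392904231516962138320828099950090778269023704395743349354428338775
    87302103153142159812387726901946230642782885905456932480801129689076087
    87221196986976041975652226047109166264205924834578072742957742574145767
    91912487719379102425635964473742795855480849665941957997583277089853816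
    95120984658119686187151529318930997183556075492017053835574233600021596
    99974066333404855610534250871776236769193502707427571334586529171608971
    107927727830785776968961359758750066800812381738525296004679601256109941
    118577543620474791506654498679871058941896746901929823592235058490317317
  (.cons 8
    96550057678059198015175227267823256628201327577919570908636215243986215
    91696928282840258898899848727653539466583347329288897843782246171530101
    90941998763610273782408919535460689747453766607377508309377257818853992
    90915042109257856581857725854053729057116060504218759715748614822891937
    95417670806947511165372023375815973490441412861612257644852223829250562
    97278027251525904511312983344766873744705901698970000824756636514178453
    101753691064327364789830096446864164677810332938789616999915591159174857
    109087309988460058853561594554746088708223781288453907356907804324075708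
    118847495256158731129068033185990047482732685051731373799844442333911890
  (.cons 13
    91858332516382919510209743042916954459132879690076667152321580516660268
    86385144098896209831071366088195430419070678174928701703137127182258875
    84228294064275636441194635323871884961351707230142548506582116102017521
    82826362029951289826992969050273619594215911187034521367905205647937882
    85846167330464555686868326333122982398224794683281180784887373423514070
    92882854919663408346447368056066084743099046571573998172463224992699518
    97331542327236845187432322492754212623516479083611426426624359466358163
    104611215024036540611072844360689234414227071378015006677438924378560338
    114209597820478418965645560071145317336756695944977451592772452790606240
  (.cons 22
    92640635030841595732853521590806287653765363672381627834391271268963698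
    88057149532926134573925920053666114814626744890228734166483868789691329
    87248311639496596378330095114355973237582886630592123105145994436137650
    86816936037776680362728702918277068919951020202085718953276110800605655
    90807291191487458646425571037230123148537602077242436177489449121321522
    93152903638106067652177397848263516380267480511368249769565712830125524
    97439819849655570758622957676997744026929175742651338315971927292204812
    104422911745675179500245497854042349946404937173752508670493284807645442
    113616867373754909237966895172905325394479555456668831653818714483088278
  (.cons 50
    74926766874102225270018256053323308105970153926036329727429351521030513
    71934021903266179979788612639386036039118981534821303988335737622483006
    71556571131796051427683223000188278834140048643524786888181255941427062
    71206080306892615363935872881899173146660482960237648870293557962133192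
    74064035419931447657831611326208439611826738739936984293040045878824704
    75115494728395469326853631251665904382643053535465773388598049084805553
    78000401558770621256979936455689278675850046607440110053744816733950602
    82664783353541084498992768694238965912473567078197762116458454280688609
    88596368213830597159159821919823279825638898302384209535049990269523352
  .nil)))))
theorem chk9 : chkN 9 8 false cert9 = true := by decide +kernel
def cert10 : Cells :=
  (.cons 5
    1652994300426162463141922943968709947958956232661831973067853915556832957611
    1562437618559067976606798335064616354031854307325327957461479407965445542693
    1549626871966799888203137790095199828202643688962066659113006198104245555813
    1554927386260428647934376451737423496515099410475117316711207771583206953453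
    1644158420649192743668031780458789037420025897011654341599769161272808886934
    1668455209813659370420158981677039007519762167616441131757634683734943601928
    1751502198523453804750028851238835989219131271655838729867999659051591767599
    1886674438026496296398848056565182228524974450729857422734854660102294706190
    2067787559163950192101723912315963584351697780342323893693745088614715447949
  (.cons 10
    1545211965502650833266574836769127115690467897921703699427434913055338255216
    1474533202863310485124063101276337057131812407003511455892958865108691390963
    1471883013172311887355040862479432680726798832943676928049244027633237479719
    1478509498531100648364375534557314511450115690751461089428302213880453943446
    1558023601954173781762989354598942835912880426085273428329295031055429161250
    1553605001322373907199956709364551663098202795954346071477850618118214423495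
    1622516916910100510293913475789019067641281328414146285354211855094227309796
    1735161451863972596595412702147206016179853883706821948582657475972199700145
    1884470678693030884481811461918258374640839013232558132895461006376922994961
  (.cons 18
    1531958994599096244652558362509073637118104693581916303838088135208862356353
    1460838708878635488619311964787948176878635380317026515759020692360504283666
    1455979555870255074424342811349497179051352153489128865814210612296563020101
    1458188249472993237223705389462417867610479999308912579899874122116098166950
    1534167742026302238723762101730112621043968820087583566008026029716484018461
    1539026841216795734965268674208511311459367502921760391569237998513153872848
    1607938460241816483507275480527420288930334242833605561508086342389135316193
    1720140717262384029921776089987758702081809673328746550755043709566295250582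
    1867682234290266418297847345219202795767593178389688386204016069958327163092
  (.cons 50
    1376908917001584681842207166624483414986776407753882629029769734569011319268
    1320366198065437783319914795039913330534472049846821962548478150143155130531
    1319041251524332392667544910941205605373750788319821951494346481660374831077
    1318599728513970187387070099898971358299839404638068959585015871706754944834
    1382210725486211358826618758062647698120141822366721193207015811118179651482
    1379559241515353478606177826467586101556649626507704962073134322897186673187
    1436985599691439597758615632301124990017695656478800121971727893847712617232
    1530193010527457676957618488353328967860746765431387759951805600333975688331
    1651230122996767731114578010810019763216238716339909175399050671453945763444
  .nil))))
theorem chk10 : chkN 10 9 false cert10 = true := by decide +kernel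
def cert11 : Cells :=
  (.cons 6
    28580819931640571800434396056592882768215273649382860201742197045234973664531527
    27155033533755600718583613432272124157831035455207528572837639087475442239640263
    27111601782983235117115328269747547851991184546868331060801280086698231191081486
    27343194797176059237837151635783311996027026613849911602186594801652928902566298
    29036757912517482489571476663083380111808856131883285340958871037167364006859339
    28783470664995162607069664897518382700582337325333921926631653036947204791538848
    30151355276035471721235706072347839749622697121159578692213867058625704425788868
    32402211552183668563246815889167141377682079491693222904034157165444568588277663
    35398529319542945900445465629777769959187745960983253428894119642295917994187286
  (.cons 12
    25888451987208522444432657132724489824515761376913914322938109814991251473322686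
    24607425579706072425731663384446485669218355923808301520549130800754206900277611
    24448218525606329631039660078742280331051999974622551274041059026108412534149313
    24448235312379029721458398204344133142833089462100335490428552696247872016502856
    25743764003528063399745331462087346348869294015920004252948187185104983067480283
    26054908857821008135008883675900685455021434900556573863679157478175777722045190
    27249093849286199609833594543045503498801918991507578709986383478813459604952074
    29188741215116425893925963459847564012912261235117561528088300645643962790958507
    31743574694982880479877282330463238704033575878478809502618273979887797746030544
  (.cons 22
    24694332814813797536928660860146878031139411801828795127997486359680381310931407
    23681087098178588606611350745714808376462843179031054995455401978845239380201620
    23760704320005325808944881300847046559625277695004975698488759249987999825252334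
    23919933020543034171740920409384399105971971774117332231853872224174928508325739
    25273348480067025431316807613487079413306094047661630828368217970312794251792358
    24744993620675218330212160298379163482887362397338677854523677137534837717979661
    25816141124802180612507704999491123012656280029595171603217073144658200268624638
    27553138641375352082248851537857040109357114359795620195874267974421166701286529
    29825709910012006338792993515525017754435967627928167297896929758799430572283513
  (.cons 50
    19135939701752339184622135130662205288875522187151147315354278711677882429967803
    18542467696538348668567588075830003723886860746655747125358289523641721821318385
    18658271271440977181240922214869264194580681812229163712798147579112098665434241
    18759599951603634289544905451418667187109266168397287775423887371130012462156832
    19657051812612861978159523080558015289475643252471435079165084866393197994708075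
    19128700929058314700861988166272394311169923228272859263533487310516089341824480
    19794549616342260420936730533981994052103286105420941092335931842553169085697657
    20858460556603659927025270394188594673172522650244838824739668392849517608095593
    22211870714858462592700493346911135116537833412287011298434839592727366189093018
  .nil))))
theorem chk11 : chkN 11 10 false cert11 = true := by decide +kernel
def cert12 : Cells :=
  (.cons 6
    456647418846139417674112613444342110639625135861967757770381124508118643104586912363
    435777486815759234135859834991788370665685626697159247632165327460034849332049744163
    437556060559794051708227015755665419987208485283167738773236839214297242488117956756
    443484897806417481238081263495743161020576823771633643486719791114515461926401396801
    472655183167976402642053387147328825728419634493177243616194170821752471532403937527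
    459256171203015723360115380424923803883362769337926539997730618081014191389299675828
    480126067053227092391935519746423929578587315131653953396248809950205179536437121970
    514395365633129089432828038910727068499166500796392474894610601761071114375024694606
    559692507441433806975661153192872824195531165972065128676406283651769758613392480111
  (.cons 13
    426053752077651649320548811260232951958753665003239801974585793657383115445522829705
    406369784359668673206093641457764218923197169013215800741622666016833337127852675161
    405895767762723434684237134837714412454707591021778502315028165802503392952626696143
    407911888999475205995487456297015198290710007952842049469448642271631213658091868014
    431509426764227685604619779998645575321896466687170906483684658461982047000237248524
    428069511423925062509675673965402642413410306445554957727939731869825008239436026310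
    447397881650438076984932134925820053218172308909289684873371267617130682269450490548
    478821321845599394051088001586784798973253376489719847799250029474717187759798473781
    520205392995420470316810255236815246691639209820132415725561538847777561848265135661
  (.cons 26
    399255909208480333087326539194452444223454506198117926269178490730363941190599807044
    384077845905264879377888437811239473551509434986730422717084775918988600530965991219
    387635297342710903368977584052471988994411933040996737788394027126382562112091377331
    391667062127462184810241146710074272519697516254736171095211559260177743624371883595
    415620103307912554098665168652493492136768486835990595429634965155727327465074872015
    399374458592866802545140036977200016299403971189078146052885374730561420464268939380
    416212676516530562843909936947852614040948766369300209381642307181383065754103107915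
    443841588232833766271722190173271401619054229559614601286275194536903737543512380068
    479771026955198021572430971875093752424875988769371564411416766214729438649635755108
  (.cons 50
    270004689699494061817049212630654023718039321958756738971371769988007012024596564684
    263482873936598795222696743042073474834804981352530734661501693705960104717137283655
    266328826401530552142297395026184671906219355813141178756018221948548823765755562500
    268937607717473174671089861297296301470511582137233656567394172992715777673406122440
    281388448893555589751023956094052098190725857667357192243315585319362475575515466246
    269411776301253330755691331999385769376712140566886007538300077524812385856009652961
    277356561059388056072812143242910569232742691047835334001587255892871632228291742536
    289925944380200553406497768048251490027342144955726698522690810230127608116777733096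
    305696950034096569592179178253751046200357807796393641659988221834473512089363811503
  .nil))))
theorem chk12 : chkN 12 11 false cert12 = true := by decide +kernel
def cert13 : Cells :=
  (.cons 7
    7701251038246718875213187070618231950702176339578938036796734460515306191684861646442914
    7372917821289863845999219760731758047861490343777274016874795409394093406747308454301809
    7442857814690512024294593241439481565370094682503947554736070528602811052060854818607097
    7578852937847009907241402280837767629481652763771618546428130493403990972478636974870454
    8115064414508687102986152329408247745133287564461923650404217124194221678241531580174455
    7730393205996743884193062597810967182726630813043078995779501599653152643407317344883169
    8080096729496098598835270302121083079801770724362904838880452586761006772577240625140436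
    8651279447659241999958142128334082629297835677262470500415487848962339173230539962586206
    9408970711688225006828170899738418792431912170909913376595605934019722821875634736617062
  (.cons 16
    7100932793451403763411890013620037578165056621037211449039770352247153137872130672250973
    6826998811352357096909544597636485679195435210846844311830490634879800607455706624380749
    6908597070913857621554230839307717855058377658157268498549677684238251103515561636826845
    7021280048575458411429161156029821475809465504202100106611535991150770668226019874098831
    7499209086693784524481369933514954319598293065602850495341533215943997794471489119342385
    7106760918706410266908804935151551957662006189796545876995361868259503110154126674530446
    7415665668174519529496755270662213743623125712448013872551530532196887988346857607680361
    7920793256610770082000715742900284229154732320833052009111170131179444193906146780467914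
    8581344672805526061022255540324134705953591206788596678875506051521120712094709931496600
  (.cons 50
    6084851863549309297766310449602306509453593883394151864187098003421290119949711959084552
    5888630091844106091580493812222063562690755115297010224065443517625638412714255328202036
    5972171731941539228398646848977282195025269982830668454009305455178109626297387127622873
    6053770584539458253464070374027275961972221739462678583383820608587896828907825263447180
    6426789336548811304815307643953093223996111488321533268392643906642328315725345816644868
    6073194545776345837333399822882708788162543856130804266786504341603591600168235927604777
    6310216040226351726258800484158484515604885954013234280386956851305344297697393092660949
    6696833000030411939667624951531776166127343335411429259490802244842540330290228506955751
    7196132107498351225989747334316839229497260125324777945064829155546143392593432131965256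
  .nil)))
theorem chk13 : chkN 13 12 false cert13 = true := by decide +kernel
def cert14 : Cells :=
  (.cons 7
    123599002386839813993310581988416117708933720748180834817347058734357928205524065989653794859
    118697054294677695984189929248285353053423187386686537669230118413613946979440551489691127587
    120320412538343996591039990562220309900372406544616104715656376244179260856218692570438553288
    123026018027811574895642260168898302998084407338661264317827645084961314680835764878872743580
    132097784473601822377758673763015236192845860984358150117562258055682448674560540116339035996
    123949143200679387210000024377051880379933406271287414897367305096612653754343823696741765215
    129328548800479570532359635867795831853961367985361267666367225106511473082241312146999251254
    138177514433156719781475346498206018470437185394681994001909294510553295584732129774815974034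
    149827589099170746543934170534496092117401215687349076250113107511141917460122318875802817627
  (.cons 16
    114049865876278677797575504267356576346891914583542396043160393357184441589101066578148429560
    110007360332771396169116028333534698240758935056914062780834340821994281372048992313430101517
    111789898921849747547825019978132400716746863447407053199112956850501717378180363988063407545
    114049896959812116401057350859828992378016925565586054376214742038951656367076724685792300418
    122134935245259316773873366683367386031085505937846585774629644119586854459793632723521556004
    114018029417998438920252843646438238468028431164956999205100493200161183277403579936463277856
    118792651106574968323180051196828121986516445359223064371431542943374666170484560825189470177
    126623028810854642868611095863145118606400164897874519778392499663484015698771077243990348056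
    136840715416872257371315504600616996639097385815125706880770920090730512147193262712459137709
  (.cons 50
    97879857312434286298078782291684673170138844751332115670054925528047106073497330609489431762
    94983268047017840519002723637194909173969559024964030749358669550816022189264912939051142172
    96702155093043813855596161276076094191188095569755142563854690616411806395884421449698380759
    98389207623458534633153748540368496742364244137825325956392488827633890274329202740669893535
    104723565151378608981396576245389062195915166982252967032451222645594093488483813011805277208
    97593371928288947764933024545443043180516584628696974093220515930208510674697748637409529068
    101285746370945613902901471626557188892389752164139847035270114575166237992415547360733433219
    107301770398292303987698329313358870807808778004451060927462007908874389432963060514229636725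
    115004827525925825390748237353059728662120993774632857478032982700901062852898123032747118507
  .nil)))
theorem chk14 : chkN 14 13 false cert14 = true := by decide +kernel
def cert15 : Cells :=
  (.cons 8
    2073548295931998576588019363516731812083921124555663676143703702406354284730575734271536037875598
    1995842566393680654503818722469895472845534096919563925797700429057282113769329580783544892001942
    2033391950974734119943401191020782855861507458982951841601626261199034736001995604249508728098379
    2087108335311224105405215805426538801147020425565647573368937048624087497349122599141606019026476
    2251907633944796060723996555747338442673784095572128811909876862754722339570343668167063821061877
    2076155765637138784478552032413071503311246796628045959750426071507622060088428692426980908339133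
    2166899512189066573353701079423099198093048776124553576336051143631734534637751286415350283276428
    2316053069441366277553883037381872428378155098499644616828930945228628906348526651023051709157851
    2512664536219515283114328988518580200587512105361712684609450252462493165385331649810023047189397
  (.cons 19
    1833651374134186085389226870084102653192542300243741520437131315081478985026513573209127035063756
    1773155638584337513871112047090491067260226836467696115822354085395105773188878155958029695978750
    1808618875480141588304802486064364521892541086849428941280543893970692798299899213435071917509822
    1850340300695376565740201679398070641074285057542693858425552893000786249514679119092535246556311
    1986456159242317261623015573355018263875696156718961579473429558485437828225175083474595951086904
    1831043681610748981085655666087201499705631559690421717555829367760440017848874089731796059835883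
    1906663486322899190415158709129847504459788185596086974581493874623756169049758728318587379502746
    2030262745434043426641138733052025632844733624566191824606542243807413148871676073473748398952371
    2190889653255720347885049067874962065903598188076475605373438071527928176359902215474187290661151
  (.cons 50
    1419568237393453689111808011474119650682287116879091350544623344703984364199380851643859621857934
    1385669889758246570786408497648759961340326840542297095726772944963100376502131492541193379990028
    1414875129366963124622755802541681733446173176340720919577355055852787078323289030024466843421153
    1442515798019449191652131623646382275231562573798876484440558091452417808911675908141138705418686
    1532216900498595350985232397258296988128598119042524611569764984882540880285823189477462948563490
    1413831434780416394949238146375281698003220139292348203137005422934576448296310564806516497156767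
    1461289376138838520055318892497761811026283870271428621366497038235732509383162556738598681987854
    1537430757554763017150697329204166704898843944771085900373826466449302603187477494941570862255037
    1634432692433894044794515547098140282474888175788548061139775049748182246650070534337758905666715
  .nil)))
theorem chk15 : chkN 15 14 false cert15 = true := by decide +kernel
def cert16 : Cells :=
  (.cons 2
    2479857319274348692611531124156788029361502901269215999185004038941536047119
    2360592823726265009853682869829753770122536030888717308211980741333084737345
    2382683130281738174091977773198211836811973851419196925948355430066120003443
    2453363564487146463483997895339048332901888293295363428128065359548174438398
    2687925238115891727562652333815798539612101298916946167926199618327216214444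
    2499292448250827195789562795063380745631550113821200601817918088258769768496
    2613257777640847702835718757562787888108342981087802297271750791058390192376
    2797457623499528227582271455068228089753194921813327002798160866045839528507
    3036873327427538070839939945369536213795157139228210973395991083726783550433
  (.cons 4
    2446736836541483699972726411364539419007602131644500214135148810483652448559
    2331447773832642903032809243800085733969692336213627825373650479254779924576
    2353979953941964946859144460638560949274345061090804708879155495541402177685
    2419801531790550498453853694793129238840937103205481102115276252271610515740
    2647737744683290078181300802440323941767332118927358033864851702772929647309
    2463521560116124375472187680366450635423678053771300136290293329588357960012
    2575720150309127346977888922258335557068727459921251232457294002735410680344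
    2755944805997704976313173692383360898091644094769501159567267144654919390051
    2990501869278085806776329056130442929351712822143093913609874320218352866577
  (.cons 6
    2372088815254377196950749707916688130029489673001329725024034476948679709022
    2262542382945320493521085306979969459208705791039701758043310263772386070676
    2284191220426776015501553153606682727598277223931272639454518914393000300732
    2343386906122614640375090965558184270825176135748350935528483067260988363050
    2558071172950180062467736868350190781214117248956336639861352640225126273718
    2386223106463942167645232818075109290604755050933330552980961207918319161721
    2493120885873015639013357828819270706589364839635125330421249032653175788094
    2665394244507504671904250396236406492982687977505148290777031158157158323068
    2888466208766098270201603824610018265240621885907791035906433975041511544088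
  (.cons 9
    2331449202894149834768792850255445555137955173730432530275689533706370847027
    2224553580422333673439628166469170743796972440721721505993695571236286140516
    2245319317971391640806812847622561520699041926176014222210514688791170027638
    2298772750782394329050037177942607139946526779219888158521809493531938427074
    2506831071614659108529615971722056686919475646457789213046669875432681427493
    2343816431336325015734626926354366106959212362104266595876794815498105180494
    2449388778885755052276393084356958456294329206664071673652196491482243355154
    2619453120371821861840342785322736389235395408981378948454961443568958051149
    2839432482188278235932957535136930636483482140298872817084894197223941821668
  (.cons 13
    2169339770978182445359162368624297940118638344603770303061489370487515959328
    2075252576516893025687855379860295571835256384288818334603493594829656641429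
    2096457815067152541180563542439266989529370829632537253832190856802330267633
    2144166703254690173355817529763516406235500534579564693742022431807355785340
    2331462117628507543445633794424514430305536580350068686065535996762126750214
    2178173790574776877770827520373623503893617133551602885955387863629489246241
    2273145379248312486690823004034262420159453097099028559545913426692605432005
    2425983420158715738361385373178217724150840031932750148281074177702460756431
    2622552543626147653051326879711295125344222440868095330992907842765949981476
  (.cons 21
    2093810510506776352127675550317186076922374893213511485586035422697098531116
    2004583250854475495873070668992003968225826424273022475721209191302889902190
    2025348961422194333193105035248300016898745625311078916892537306790404395157
    2065109005900918056397712011245894684504897169877608689504793647018168275174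
    2242247476060628115180998422425539156082786489291994057448533451884933337686
    2099551900684833454321986956301513324153791599357959324994629770092956062009
    2191873110919772125790612989395586454901665612297747017485994786935953691131
    2339852241517262925469778734921258617102988045331823842133928853027302691635
    2529795580645413037364966166221687212574041942046383075041329271685061022915
  (.cons 50
    1714806824418787155149603431463111889972407154566386218034712345756314095223
    1650316070756535729130104858466455958793677620898569281548141656806962941415
    1664896872940156396797175626645810030772208777344676108857166929437059321344
    1688312072218868223995557698720903687653456473433176622008532925952190467628
    1812000345037640305381969152150993969873227752293992125883929484533877559090
    1716131069973305622619331969543548890988083304836320422249689929322166881916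
    1783715531563864916703786237356594727953883737745664695720490900193780076303
    1891497408543489682982379723372129212121070547752881375349531393874201595898
    2027108205262002205581358073415809394953810545693658963445144875069761114402
  .nil)))))))
theorem chk16 : chkN 16 8 true cert16 = true := by decide +kernel
end KP


namespace KP

theorem sm_eq (f : ℕ → ℕ) (n : ℕ) : sm f n = ∑ i ∈ Finset.range n, f i := by
  induction n with
  | zero => rfl
  | succ n ih => rw [Finset.sum_range_succ, ← ih]; rfl

theorem allb_iff (f : ℕ → Bool) (n : ℕ) : allb f n = true ↔ ∀ i < n, f i = true := by
  induction n with
  | zero => simp [allb]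
  | succ n ih =>
    have : allb f (n+1) = (f n && allb f n) := rfl
    rw [this, Bool.and_eq_true, ih]
    constructor
    · rintro ⟨h1, h2⟩ i hi
      rcases Nat.lt_succ_iff_lt_or_eq.1 hi with h | rfl
      · exact h2 i h
      · exact h1
    · intro h; exact ⟨h n (by omega), fun i hi => h i (by omega)⟩

theorem cnd_true {α : Type} (x y : α) : cnd true x y = x := rfl
theorem cnd_false {α : Type} (x y : α) : cnd false x y = y := rfl
theorem cnd_eq {α : Type} (b : Bool) (x y : α) : cnd b x y = if b = true then x else y := by
  cases b <;> rfl
theorem cnd_ble {α : Type} (a b : ℕ) (x y : α) : cnd (Nat.ble a b) x y = if a ≤ b then x else y := by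
  simp only [cnd_eq, Nat.ble_eq]
theorem cnd_beq {α : Type} (a b : ℕ) (x y : α) : cnd (Nat.beq a b) x y = if a = b then x else y := by
  simp only [cnd_eq, Nat.beq_eq]

theorem sme_eq (L : ℕ) (f : ℕ → ℕ) : sme L f = ∑ q ∈ (Finset.range (L+9)).erase L, f q := by
  unfold sme
  rw [sm_eq, ← Finset.add_sum_erase (Finset.range (L+9)) _ (a := L) (by simp), cnd_beq, if_pos rfl, zero_add]
  refine Finset.sum_congr rfl fun q hq => ?_
  rw [cnd_beq, if_neg (Finset.ne_of_mem_erase hq)]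

/-- Chebyshev polynomials of the second kind, shifted: `uu x k = U_{k-1}(x)`. -/
noncomputable def uu (x : ℝ) : ℕ → ℝ
  | 0 => 0
  | 1 => 1
  | k + 2 => 2 * x * uu x (k+1) - uu x k

/-- Analytic facts on the scaled Fourier coefficients -/
structure Coef (C : ℕ → ℝ) (x : ℝ) : Prop where
  C0 : C 0 = 0
  k1 : ∀ k, 1 ≤ k → |C k| * (k * (1.5707 + x)) ≤ 1
  u : ∀ k, 1 ≤ k → |C k| * k = |C 1| * |uu x k|
  y1 : |C 1| * (1.5707 + x) ≤ 1 - x^2/2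
  y2 : 1 - x^2 ≤ |C 1| * (1.5708 + x)
  x0 : 0 ≤ x
  x1 : x ≤ 1

theorem tsub_cast_cases (a b : ℕ) : ((a - b : ℕ) : ℝ) = max ((a:ℝ) - b) 0 := by
  rcases le_total a b with h | h
  · rw [Nat.sub_eq_zero_of_le h, max_eq_right]; · simp
    have : (a:ℝ) ≤ b := by exact_mod_cast h
    linarith
  · rw [Nat.cast_sub h, max_eq_left]
    have : (b:ℝ) ≤ a := by exact_mod_cast h
    linarith

theorem chkU_sound {a b ut : ℕ} (h : chkU a b ut = true) {x : ℝ} (hx0 : 0 ≤ x) (ha : (a:ℝ) ≤ 50 * x)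
    (hb : 50 * x ≤ b) : ∀ j ≤ 12, (lo ut j : ℝ) - OO ≤ uu x j * SS ∧ uu x j * SS ≤ (hi ut j : ℝ) - OO := by
  unfold chkU at h
  simp only [Bool.and_eq_true, Nat.beq_eq, allb_iff, Nat.ble_eq] at h
  obtain ⟨⟨⟨⟨h1, h2⟩, h3⟩, h4⟩, h5⟩ := h
  intro j
  induction j using Nat.strong_induction_on with
  | _ j ih =>
    match j, ih with
    | 0, _ => intro _; rw [h1, h2]; simp [uu]
    | 1, _ => intro _; rw [h3, h4]; simp [uu]
    | j+2, ih =>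
      intro hj
      obtain ⟨A1, A2⟩ := ih j (by omega) (by omega)
      obtain ⟨B1, B2⟩ := ih (j+1) (by omega) (by omega)
      obtain ⟨e1, e2⟩ := h5 j (by omega)
      have e1' : (25:ℝ) * lo ut (j+2) + 25 * hi ut j + b * ((OO - lo ut (j+1) : ℕ):ℝ)
        ≤ 50 * (OO:ℕ) + a * ((lo ut (j+1) - OO : ℕ):ℝ) := by exact_mod_cast e1
      have e2' : (50:ℝ) * (OO:ℕ) + b * ((hi ut (j+1) - OO : ℕ):ℝ)
        ≤ 25 * hi ut (j+2) + 25 * lo ut j + a * ((OO - hi ut (j+1) : ℕ):ℝ) := by exact_mod_cast e2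
      rw [tsub_cast_cases, tsub_cast_cases] at e1' e2'
      have hu : uu x (j+2) = 2 * x * uu x (j+1) - uu x j := rfl
      rw [hu]
      generalize ((OO:ℕ):ℝ) = o at *
      generalize ((SS:ℕ):ℝ) = s at *
      generalize (lo ut (j+1) : ℝ) = l1 at *
      generalize (hi ut (j+1) : ℝ) = g1 at *
      have ha0 : (0:ℝ) ≤ a := Nat.cast_nonneg a
      have hb0 : (0:ℝ) ≤ b := Nat.cast_nonneg b
      constructor
      · have k1 : (50 * x) * (l1 - o) ≤ (50 * x) * (uu x (j+1) * s) := mul_le_mul_of_nonneg_left B1 (by linarith)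
        have k2 : a * max (l1 - o) 0 - b * max (o - l1) 0 ≤ 50 * x * (l1 - o) := by
          rcases le_total l1 o with q | q
          · rw [max_eq_right (by linarith), max_eq_left (by linarith)]; nlinarith
          · rw [max_eq_left (by linarith), max_eq_right (by linarith)]; nlinarith
        nlinarith
      · have k1 : (50 * x) * (uu x (j+1) * s) ≤ (50 * x) * (g1 - o) := mul_le_mul_of_nonneg_left B2 (by linarith)
        have k2 : 50 * x * (g1 - o) ≤ b * max (g1 - o) 0 - a * max (o - g1) 0 := by
          rcases le_total g1 o with q | q
          · rw [max_eq_right (by linarith), max_eq_left (by linarith)]; nlinarith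
          · rw [max_eq_left (by linarith), max_eq_right (by linarith)]; nlinarith
        nlinarith

theorem um_sound {a b ut : ℕ} (h : chkU a b ut = true) {x : ℝ} (hx0 : 0 ≤ x) (ha : (a:ℝ) ≤ 50 * x)
    (hb : 50 * x ≤ b) (j : ℕ) (hj : j ≤ 12) : |uu x j| * SS ≤ um ut j := by
  obtain ⟨h1, h2⟩ := chkU_sound h hx0 ha hb j hj
  have e : |uu x j| * SS = |uu x j * SS| := by rw [abs_mul, Nat.abs_cast]
  have m1 : (hi ut j : ℝ) - OO ≤ ((hi ut j - OO : ℕ):ℝ) := by rw [tsub_cast_cases]; exact le_max_left _ _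
  have m2 : (OO:ℝ) - lo ut j ≤ ((OO - lo ut j : ℕ):ℝ) := by rw [tsub_cast_cases]; exact le_max_left _ _
  have k1 : (hi ut j - OO) ≤ um ut j ∧ (OO - lo ut j) ≤ um ut j := by
    unfold um; rw [cnd_ble]; split_ifs <;> constructor <;> omega
  have q1 : ((hi ut j - OO : ℕ):ℝ) ≤ um ut j := by exact_mod_cast k1.1
  have q2 : ((OO - lo ut j : ℕ):ℝ) ≤ um ut j := by exact_mod_cast k1.2
  rw [e]
  exact abs_le.2 ⟨by linarith, by linarith⟩

theorem okc_sound {C : ℕ → ℝ} {x : ℝ} (hC : Coef C x) {Ki yh ut k y k' : ℕ} {u : Bool} {a b : ℕ}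
    (hU : chkU a b ut = true) (ha : (a:ℝ) ≤ 50 * x) (hb : 50 * x ≤ b)
    (hKi : ∀ k, 1 ≤ k → |C k| * k ≤ Ki / SS) (hyh : |C 1| ≤ (yh:ℝ) / SS) (hk : 1 ≤ k)
    (hk1 : k ≤ k') (hk2 : u = true → k' = k) (h : okc u Ki yh ut k y = true) : |C k'| ≤ (y:ℝ) / SS := by
  have hS : (0:ℝ) < (SS:ℕ) := by norm_num
  have hkr : (1:ℝ) ≤ k := by exact_mod_cast hk
  have hkr' : (k:ℝ) ≤ k' := by exact_mod_cast hk1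
  unfold okc at h
  simp only [Bool.or_eq_true, Bool.and_eq_true, Nat.ble_eq] at h
  rcases h with h | ⟨⟨h1, h2⟩, h3⟩
  · have h' : (Ki:ℝ) ≤ y * k := by exact_mod_cast h
    have := hKi k' (by omega)
    rw [le_div_iff₀ hS] at this ⊢
    have p := abs_nonneg (C k')
    have : |C k'| * SS * k ≤ y * k := by
      calc |C k'| * SS * k = |C k'| * k * SS := by ring
        _ ≤ |C k'| * k' * SS := by gcongr
        _ ≤ _ := this.trans h'
    exact le_of_mul_le_mul_right this (by linarith)
  · obtain rfl := hk2 h1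
    have h3' : (yh:ℝ) * um ut k' ≤ y * k' * SS := by exact_mod_cast h3
    have e := hC.u k' hk
    have w := um_sound hU hC.x0 ha hb k' h2
    rw [le_div_iff₀ hS] at hyh ⊢
    have : |C k'| * SS * (k' * SS) ≤ y * (k' * SS) := by
      calc |C k'| * SS * (k' * SS) = (|C k'| * k') * SS * SS := by ring
        _ = (|C 1| * SS) * (|uu x k'| * SS) := by rw [e]; ring
        _ ≤ yh * um ut k' := mul_le_mul hyh w (mul_nonneg (abs_nonneg _) hS.le) (Nat.cast_nonneg _)
        _ ≤ _ := by linarith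
    exact le_of_mul_le_mul_right this (by positivity)

noncomputable def datOf (N L : ℕ) (cl : Bool) (al Ki c h D z W gR gL wR wL xR xL : ℕ) : Dat where
  c i := (get c i : ℝ) / SS
  h i := (get h i : ℝ) / SS
  D i := (get D i : ℝ) / SS
  W i := (gw W i : ℝ) / SS
  z i := (get z i : ℝ) / SS
  al i := (get al i : ℝ) / SS
  la i := (laN cl i : ℝ) / SS
  bR i := (bRN N L Ki i : ℝ) / SS
  bL i := (bLN N L Ki i : ℝ) / SS
  Ki := (Ki:ℝ) / SS
  gR := (gR:ℝ) / SS
  gL := (gL:ℝ) / SS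
  wR := (wR:ℝ) / SS
  wL := (wL:ℝ) / SS
  xR := (xR:ℝ) / SS
  xL := (xL:ℝ) / SS
  aR := ((436700 + betN (2 * N - L) : ℕ):ℝ) / SS
  aLR := ((betN 9 + betN 17 : ℕ):ℝ) / SS
  aLL := ((873400 : ℕ):ℝ) / SS

section
variable {N L n : ℕ} {cl : Bool} {al Ki c h D z W gR gL wR wL xR xL : ℕ}

theorem datOf_nonneg : (datOf N L cl al Ki c h D z W gR gL wR wL xR xL).Nonneg := by
  constructor <;> (try intro i) <;> simp only [datOf] <;> positivity

theorem cellB_sound {C : ℕ → ℝ} {x : ℝ} (hC : Coef C x) {yh ut : ℕ} {a b : ℕ}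
    (hU : chkU a b ut = true) (ha : (a:ℝ) ≤ 50 * x) (hb : 50 * x ≤ b)
    (hKi : ∀ k, 1 ≤ k → |C k| * k ≤ Ki / SS) (hyh : |C 1| ≤ (yh:ℝ) / SS)
    (hcl : if cl = true then N ≤ n else N = n) (hLN : L < N)
    (h1 : chkC L Ki yh ut c = true) (h2 : chkH N L cl Ki yh ut h = true) :
    CellB (datOf N L cl al Ki c h D z W gR gL wR wL xR xL) n L C := by
  have hS : (0:ℝ) < (SS:ℕ) := by norm_num
  unfold chkC at h1
  unfold chkH at h2
  simp only [Bool.and_eq_true, Nat.beq_eq, allb_iff] at h1 h2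
  have hNn : N ≤ n := by split_ifs at hcl <;> omega
  constructor
  · exact hC.C0
  · intro k hk
    have := hKi k hk
    have hk' : (0:ℝ) < k := by exact_mod_cast hk
    show |C k| ≤ (Ki:ℝ)/SS * (1/(k:ℝ))
    rw [mul_one_div, le_div_iff₀ hk']; exact this
  · intro k hk hk2
    have := h1.2 (k-1) (by omega)
    rw [show k - 1 + 1 = k by omega] at this
    exact okc_sound hC hU ha hb hKi hyh hk le_rfl (fun _ => rfl) this
  · intro i hi
    have := h2 i (by omega)
    refine okc_sound hC hU ha hb hKi hyh (k := 2 * N - 2 * L + i) (by omega) (by omega) ?_ this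
    intro e
    have : cl = false := by simpa using e
    rw [this] at hcl
    simp at hcl
    omega
end
end KP


namespace KP

theorem cdiv (x y : ℕ) (hy : 0 < y) : (x:ℝ) / y ≤ ((x / y + 1 : ℕ) : ℝ) := by
  have hy' : (0:ℝ) < y := by exact_mod_cast hy
  rw [div_le_iff₀ hy']
  have := (Nat.lt_mul_div_succ x hy).le
  rw [mul_comm] at this
  exact_mod_cast this

theorem sN_sound (a m : ℕ) : Hm (a + m) - Hm a ≤ (sN a m : ℝ) / SS := by
  have hS : (0:ℝ) < (SS:ℕ) := by norm_num
  induction m with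
  | zero => simp; positivity
  | succ m ih =>
    have e : sN a (m+1) = sN a m + (SS / (a + m + 1) + 1) := rfl
    rw [← add_assoc, Hm_succ, e]
    have k := cdiv SS (a + m + 1) (by omega)
    rw [Nat.cast_add (sN a m), add_div]
    have : 1 / (((a + m : ℕ):ℝ) + 1) ≤ ((SS / (a + m + 1) + 1 : ℕ):ℝ) / SS := by
      rw [le_div_iff₀ hS]
      refine le_trans (le_of_eq ?_) k
      push_cast; ring
    linarith

theorem betN_sound {a : ℕ} (ha : 0 < a) : bet a ≤ (betN a : ℝ) / SS := by
  have hS : (0:ℝ) < (SS:ℕ) := by norm_num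
  have ha' : (0:ℝ) < a := by exact_mod_cast ha
  unfold bet betN
  have h := sN_sound 8 a
  have k := cdiv (sN 8 a) a ha
  calc (1/(a:ℝ)) * (Hm (8+a) - Hm 8) ≤ (1/(a:ℝ)) * ((sN 8 a : ℝ)/SS) := by gcongr
    _ = ((sN 8 a : ℝ) / a) / SS := by field_simp
    _ ≤ _ := by gcongr

theorem alF_sound {N L q : ℕ} (hL : L < N) (hq : q ≤ L + 8) :
    alN L q + bet (2 * N - L) ≤ (alF N L q : ℝ) / SS := by
  have hS : (0:ℝ) < (SS:ℕ) := by norm_num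
  unfold alF alN
  rw [cnd_ble, cnd_ble, Nat.cast_add, add_div]
  refine add_le_add ?_ (betN_sound (by omega))
  split_ifs with h1 h2 h3 h4 h5 h6
  · omega
  · omega
  · have ha : 0 < q - L := by omega
    have ha' : (0:ℝ) < ((q - L : ℕ):ℝ) := by exact_mod_cast ha
    have h := sN_sound (8 - (q-L)) (q - L)
    rw [show 8 - (q-L) + (q-L) = 8 by omega] at h
    have k := cdiv (sN (8 - (q-L)) (q-L)) (q-L) ha
    calc (1/((q-L:ℕ):ℝ)) * (Hm 8 - Hm (8 - (q-L)))
        ≤ (1/((q-L:ℕ):ℝ)) * ((sN (8 - (q-L)) (q-L) : ℝ)/SS) := by gcongr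
      _ = ((sN (8 - (q-L)) (q-L) : ℝ) / ((q-L:ℕ):ℝ)) / SS := by field_simp
      _ ≤ _ := by gcongr
  · norm_num
  all_goals first | omega | exact betN_sound (by omega)

theorem lamN_sound (i : ℕ) (hi : i ≤ 8) : lam i ≤ (lamN i : ℝ) / SS := by
  have e0 : lamN 0 = 201100 := by decide +kernel
  have e1 : lamN 1 = 212000 := by decide +kernel
  have e2 : lamN 2 = 225000 := by decide +kernel
  have e3 : lamN 3 = 240200 := by decide +kernel
  have e4 : lamN 4 = 258700 := by decide +kernel
  have e5 : lamN 5 = 282300 := by decide +kernel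
  have e6 : lamN 6 = 316700 := by decide +kernel
  have e7 : lamN 7 = 381400 := by decide +kernel
  have e8 : lamN 8 = 520500 := by decide +kernel
  interval_cases i <;> simp only [e0,e1,e2,e3,e4,e5,e6,e7,e8] <;> norm_num [lam]

section
variable {N L n : ℕ} {cl : Bool} {al Ki c h D z W gR gL wR wL xR xL : ℕ}

/-- the two admissible set-ups -/
def Setup (N L n : ℕ) (cl : Bool) : Prop :=
  (cl = false ∧ N = n ∧ L + 1 = n) ∨ (cl = true ∧ N = 16 ∧ L = 8 ∧ 16 ≤ n)

theorem geo_sound (hs : Setup N L n cl) (hal : allb (fun q => Nat.ble (alF N L q) (get al q)) (L + 9) = true) :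
    (datOf N L cl al Ki c h D z W gR gL wR wL xR xL).Geo n L := by
  have hS : (0:ℝ) < (SS:ℕ) := by norm_num
  have hLN : L < N := by rcases hs with ⟨-, h1, h2⟩ | ⟨-, h1, h2, h3⟩ <;> omega
  have hNn : N ≤ n := by rcases hs with ⟨-, h1, h2⟩ | ⟨-, h1, h2, h3⟩ <;> omega
  simp only [allb_iff, Nat.ble_eq] at hal
  constructor
  · intro p q K hp hq
    refine (kerR_near (a := 2 * N - L) hp hq (by omega) (by omega) (by omega)).trans ?_
    refine (alF_sound hLN hq).trans ?_
    show _ ≤ (get al q : ℝ)/SS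
    have : (alF N L q : ℝ) ≤ get al q := by exact_mod_cast hal q (by omega)
    gcongr
  · intro j K hj
    refine (kerR_right (a := 2 * N - L) hj (by omega) (by omega)).trans ?_
    show _ ≤ ((436700 + betN (2 * N - L) : ℕ):ℝ) / SS
    rw [Nat.cast_add, add_div]
    refine add_le_add (by unfold aS; norm_num) (betN_sound (by omega))
  · intro p K hp hpL
    rcases hs with ⟨-, h1, h2⟩ | ⟨-, h1, h2, h3⟩
    · omega
    · subst h2
      rcases kerR_left (n := n) (p := p) (K := K) (by omega) h3 with h | h
      · refine h.trans ?_
        show _ ≤ ((betN 9 + betN 17 : ℕ):ℝ) / SS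
        rw [Nat.cast_add, add_div]
        exact add_le_add (betN_sound (by norm_num)) (betN_sound (by norm_num))
      · omega
  · intro p q hp hq
    show _ ≤ (laN cl q : ℝ) / SS
    rcases hs with ⟨h0, h1, h2⟩ | ⟨h0, h1, h2, h3⟩
    · unfold kerL laN
      rw [Finset.Ioc_eq_empty (by omega), h0, cnd_false]; simp
    · subst h2
      rw [h0]
      exact (kerL_near hp h3).trans (lamN_sound _ (by omega))
  · intro j hj
    show _ ≤ (laN cl L : ℝ) / SS
    rcases hs with ⟨h0, h1, h2⟩ | ⟨h0, h1, h2, h3⟩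
    · unfold kerL laN
      rw [Finset.Ioc_eq_empty (by omega), h0, cnd_false]; simp
    · subst h2
      rw [h0]
      refine (kerL_near (q := j + 8) (by omega) h3).trans ?_
      rw [show 8 - (j + 8) = 0 by omega]
      exact lamN_sound 0 (by omega)
  · intro p hp hpL
    rcases hs with ⟨h0, h1, h2⟩ | ⟨h0, h1, h2, h3⟩
    · omega
    · subst h2
      refine (kerL_left hp (by omega)).trans ?_
      show _ ≤ ((873400:ℕ):ℝ)/SS
      unfold aS; norm_num
  · rcases hs with ⟨h0, h1, h2⟩ | ⟨h0, h1, h2, h3⟩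
    · rw [Finset.Ioc_eq_empty (by omega)]; norm_num
    · subst h2; exact sq_left h3

theorem cert_sound (hs : Setup N L n cl)
    (hw : chkW N L cl al Ki c h D z W gR gL wR wL xR xL = true) :
    (datOf N L cl al Ki c h D z W gR gL wR wL xR xL).Cert n L := by
  have hSp : (0:ℝ) < (SS:ℕ) := by norm_num
  have hLN : L < N := by rcases hs with ⟨-, h1, h2⟩ | ⟨-, h1, h2, h3⟩ <;> omega
  have hNn : N ≤ n := by rcases hs with ⟨-, h1, h2⟩ | ⟨-, h1, h2, h3⟩ <;> omega
  have hNr : (N:ℝ) ≤ n := by exact_mod_cast hNn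
  have hLr : (L:ℝ) + 1 ≤ N := by exact_mod_cast hLN
  unfold chkW at hw
  simp only [Bool.and_eq_true, Bool.or_eq_true, Nat.beq_eq, Nat.ble_eq, allb_iff] at hw
  obtain ⟨⟨⟨⟨⟨⟨h1, h2⟩, h3⟩, h4⟩, h5⟩, h6⟩, h7⟩ := hw
  have key : ∀ a m : ℕ, a ≤ m * SS → (a:ℝ) / SS / SS ≤ (m:ℝ)/SS := by
    intro a m hh
    have : (a:ℝ) ≤ m * SS := by exact_mod_cast hh
    rw [div_le_div_iff_of_pos_right hSp, div_le_iff₀ hSp]; exact this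
  constructor
  · intro q hq hqL
    have := key _ _ ((h5 q (by omega)).resolve_left hqL)
    refine le_trans (le_of_eq ?_) this
    simp only [datOf, fN, rowN, sm_eq, ad]
    generalize hSS : (SS:ℝ) = s at *
    push_cast
    have hSS' : (1000000:ℝ) = s := by rw [← hSS]; norm_num
    rw [hSS']
    simp only [add_div, Finset.sum_div]
    have hs0 := hSp.ne'
    congr 1
    · congr 1
      · congr 1
        · rw [add_mul, add_div, add_div]; field_simp
        · refine Finset.sum_congr rfl fun p _ => ?_
          show _ = (((get c ((q - p) + (p - q)) + get h (q + p)) * get z p : ℕ):ℝ) / s / s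
          push_cast
          field_simp
      · field_simp
    · field_simp
  · intro q hq hqL
    have := key _ _ ((h2 q (by omega)).resolve_left hqL)
    refine le_trans (le_of_eq ?_) this
    simp only [datOf]; push_cast; field_simp
  · have : ((Ki * gR * wR : ℕ):ℝ) ≤ ((2 * xR * SS * SS : ℕ):ℝ) := by exact_mod_cast h3
    simp only [datOf]
    generalize hSS : (SS:ℝ) = s at *
    have hSS' : (1000000:ℝ) = s := by rw [← hSS]; norm_num
    push_cast at this
    rw [hSS'] at this
    rw [show (Ki:ℝ) / s * ((gR:ℝ) / s) / 2 * ((wR:ℝ) / s) = (Ki * gR * wR) / (2 * s * s) / s by field_simp]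
    refine div_le_div_of_nonneg_right ?_ hSp.le
    rw [div_le_iff₀ (by positivity)]
    linarith
  · have : ((Ki * gL * wL : ℕ):ℝ) ≤ ((2 * xL * SS * SS : ℕ):ℝ) := by exact_mod_cast h4
    simp only [datOf]
    generalize hSS : (SS:ℝ) = s at *
    have hSS' : (1000000:ℝ) = s := by rw [← hSS]; norm_num
    push_cast at this
    rw [hSS'] at this
    rw [show (Ki:ℝ) / s * ((gL:ℝ) / s) / 2 * ((wL:ℝ) / s) = (Ki * gL * wL) / (2 * s * s) / s by field_simp]
    refine div_le_div_of_nonneg_right ?_ hSp.le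
    rw [div_le_iff₀ (by positivity)]
    linarith
  · have := key _ _ h6
    refine le_trans (le_of_eq ?_) this
    simp only [datOf, sm_eq]
    generalize hSS : (SS:ℝ) = s at *
    push_cast
    have hSS' : (1000000:ℝ) = s := by rw [← hSS]; norm_num
    rw [hSS']
    simp only [add_div, Finset.sum_div]
    have hs0 := hSp.ne'
    congr 1
    · congr 1
      · congr 1
        · field_simp
        · refine Finset.sum_congr rfl fun p _ => ?_
          field_simp
      · field_simp
    · field_simp
  · intro hLn
    have hcl : cl = true := by rcases hs with ⟨h0, h1, h2⟩ | ⟨h0, h1, h2, h3⟩; · omega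
                               · exact h0
    rw [hcl] at h7
    have := key _ _ (h7.resolve_left (by simp))
    refine le_trans (le_of_eq ?_) this
    simp only [datOf, sm_eq]
    generalize hSS : (SS:ℝ) = s at *
    push_cast
    have hSS' : (1000000:ℝ) = s := by rw [← hSS]; norm_num
    rw [hSS']
    simp only [add_div, Finset.sum_div]
    have hs0 := hSp.ne'
    congr 1
    · congr 1
      · congr 1
        · field_simp
        · refine Finset.sum_congr rfl fun p _ => ?_
          field_simp
      · field_simp
    · field_simp
  · intro q hq
    simp only [datOf, bRN]
    have k1 := cdiv Ki (L + 9 - q) (by omega)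
    have k2 := cdiv Ki (2 * N + 9 - L + q) (by omega)
    rw [Nat.cast_sub (by omega)] at k1
    rw [Nat.cast_add (2 * N + 9 - L), Nat.cast_sub (by omega)] at k2
    push_cast at k1 k2
    have k3 : (Ki:ℝ) / (2 * n + 9 - L + q) ≤ (Ki:ℝ) / (2 * N + 9 - L + q) := by
      apply div_le_div_of_nonneg_left (by positivity)
      · have : (0:ℝ) ≤ q := by positivity
        linarith
      · linarith
    rw [div_mul_eq_mul_div]
    refine div_le_div_of_nonneg_right ?_ hSp.le
    push_cast
    rw [mul_add, mul_one_div, mul_one_div]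
    linarith
  · intro hLn q hq
    simp only [datOf, bLN]
    have k1 := cdiv Ki (q + 1) (by omega)
    have k2 := cdiv Ki (2 * N - 2 * L - 1 + q) (by omega)
    rw [Nat.cast_add (2 * N - 2 * L - 1), Nat.cast_sub (by omega), Nat.cast_sub (by omega)] at k2
    push_cast at k1 k2
    have k3 : (Ki:ℝ) / (2 * n - 2 * L - 1 + q) ≤ (Ki:ℝ) / (2 * N - 2 * L - 1 + q) := by
      apply div_le_div_of_nonneg_left (by positivity)
      · have : (0:ℝ) ≤ q := by positivity
        linarith
      · linarith
    rw [div_mul_eq_mul_div]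
    refine div_le_div_of_nonneg_right ?_ hSp.le
    push_cast
    rw [mul_add, mul_one_div, mul_one_div]
    linarith
end
end KP


namespace KP

section
variable {N L n : ℕ} {cl : Bool} {al Ki c h D z W gR gL wR wL xR xL : ℕ}

theorem inv_le_of {x t g s : ℝ} (hs : 0 < s) (hx : 0 < x) (h : s ≤ g * x) : 1 / x ≤ g / s := by
  rw [div_le_div_iff₀ hx hs]; linarith

set_option maxHeartbeats 1600000 in
theorem DBd_sound (hs : Setup N L n cl) {M : ℝ} (hM : 0 < M) (hMn : M ≤ n - 1/2) {tl th : ℕ}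
    (hth : th ≤ 200) (hgL : gL = cnd cl 1081000 0)
    (hd : chkD N L cl tl th D gR = true) :
    DBd (datOf N L cl al Ki c h D z W gR gL wR wL xR xL) n L M (((tl:ℝ) - 100)/100) (((th:ℝ) - 100)/100) := by
  have hSp : (0:ℝ) < (SS:ℕ) := by norm_num
  have hLN : L < N := by rcases hs with ⟨-, h1, h2⟩ | ⟨-, h1, h2, h3⟩ <;> omega
  have hNn : N ≤ n := by rcases hs with ⟨-, h1, h2⟩ | ⟨-, h1, h2, h3⟩ <;> omega
  have hNr : (N:ℝ) ≤ n := by exact_mod_cast hNn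
  have hLr : (L:ℝ) + 1 ≤ N := by exact_mod_cast hLN
  have hN1 : (1:ℝ) ≤ N := by exact_mod_cast (by omega : 1 ≤ N)
  have htl0 : (0:ℝ) ≤ tl := Nat.cast_nonneg _
  have hth' : (th:ℝ) ≤ 200 := by exact_mod_cast hth
  unfold chkD at hd
  simp only [Bool.and_eq_true, Nat.ble_eq, allb_iff] at hd
  obtain ⟨⟨h1, h2⟩, h3⟩ := hd
  rintro t ⟨ht1, ht2⟩ p hp hpn
  have hw : ((2 * N - 1 : ℕ):ℝ) = 2 * N - 1 := by rw [Nat.cast_sub (by omega)]; push_cast; ring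
  have hwp : (0:ℝ) < 2 * N - 1 := by linarith
  have hwn : (0:ℝ) < 2 * (n:ℝ) - 1 := by linarith
  unfold DD
  by_cases hnear : near n L p
  · rw [if_pos hnear]
    unfold near at hnear
    show _ ≤ (get D (p + L - n) : ℝ) / SS
    rcases lt_or_gt_of_ne hpn with hlt | hgt
    · -- left near
      rw [abs_of_pos (Dn_pos hM hMn (by linarith) hlt)]
      have hden := den_left hM hMn (show (-1:ℝ) ≤ t by linarith) hlt
      obtain ⟨i, hi⟩ : ∃ i, p + (i + 1) = n := ⟨n - p - 1, by omega⟩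
      have hc := h1 i (by omega)
      rw [show p + L - n = L - (i + 1) by omega]
      generalize get D (L - (i+1)) = g at hc
      have hc' : (100:ℝ) * (2 * N - 1) * SS + 100 * (2 * N - 1) * g
          ≤ g * (200 * (i + 1) * (2 * N - (i + 1)) + tl * (2 * N - 1)) := by
        have : ((2 * N - (i + 1) : ℕ):ℝ) = 2 * N - (i + 1) := by rw [Nat.cast_sub (by omega)]; push_cast; ring
        rw [← hw, ← this]; exact_mod_cast hc
      refine inv_le_of (t := t) hSp (by linarith) ?_
      have hpr : (p:ℝ) = n - (i + 1) := by rw [← hi]; push_cast; ring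
      have e1 : 2 * ((i:ℝ)+1) * (2 * N - (i + 1)) / (2 * N - 1) ≤ ((n:ℝ)^2 - (p:ℝ)^2) / M := by
        have hi0 : (0:ℝ) ≤ i := Nat.cast_nonneg _
        have hin : (i:ℝ) + 1 ≤ N := by
          have : (i:ℝ) + 1 ≤ L := by exact_mod_cast (by omega : i + 1 ≤ L)
          linarith
        rw [div_le_div_iff₀ hwp hM, hpr]
        have a1 : (n:ℝ)^2 - (n - (i+1))^2 = (i+1) * (2 * n - (i+1)) := by ring
        rw [a1]
        have a2 : (2 * (N:ℝ) - (i+1)) * M ≤ (2 * N - (i+1)) * (n - 1/2) :=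
          mul_le_mul_of_nonneg_left hMn (by linarith)
        have a3 : (2 * (N:ℝ) - (i+1)) * (2 * n - 1) ≤ (2 * n - (i + 1)) * (2 * N - 1) := by nlinarith
        have a4 : 2 * ((2 * (N:ℝ) - (i+1)) * M) ≤ (2 * n - (i + 1)) * (2 * N - 1) := by linarith
        have := mul_le_mul_of_nonneg_left a4 (show (0:ℝ) ≤ i + 1 by linarith)
        linarith
      have e2 : (SS:ℝ) ≤ g * (2 * ((i:ℝ)+1) * (2 * N - (i + 1)) / (2 * N - 1) + (((tl:ℝ) - 100)/100)) := by
        rw [show g * (2 * ((i:ℝ)+1) * (2 * N - (i + 1)) / (2 * N - 1) + (((tl:ℝ) - 100)/100))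
          = (g * (200 * (i + 1) * (2 * N - (i + 1)) + tl * (2 * N - 1)) - 100 * (2 * N - 1) * g) / (100 * (2 * N - 1)) by
            field_simp; ring]
        rw [le_div_iff₀ (by linarith)]; linarith
      refine e2.trans (mul_le_mul_of_nonneg_left ?_ (Nat.cast_nonneg _))
      linarith
    · rw [abs_of_neg (Dn_neg hM hMn (by linarith) hgt)]
      have hden := den_right hM hMn (show t ≤ 1 by linarith) hgt
      obtain ⟨i, hi⟩ : ∃ i, p = n + (i + 1) := ⟨p - n - 1, by omega⟩
      have hc := h2 i (by omega)
      rw [show p + L - n = L + (i + 1) by omega]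
      generalize get D (L + (i+1)) = g at hc
      have hi0 : (0:ℝ) ≤ i := Nat.cast_nonneg _
      unfold Dn
      rw [← one_div_neg_eq_neg_one_div]
      refine inv_le_of (t := t) hSp (by linarith) ?_
      have hpr : (p:ℝ) = n + (i + 1) := by rw [hi]; push_cast; ring
      set e : ℕ := cnd cl (2 * (i + 1) * (2 * N - 1)) (2 * (i + 1) * (2 * N + (i + 1))) with he
      have e1 : (e:ℝ) / (2 * N - 1) ≤ ((p:ℝ)^2 - (n:ℝ)^2) / M := by
        rw [div_le_div_iff₀ hwp hM, hpr]
        have a1 : ((n:ℝ) + (i+1))^2 - n^2 = (i+1) * (2 * n + (i+1)) := by ring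
        rw [a1]
        rcases hs with ⟨h0, b1, b2⟩ | ⟨h0, b1, b2, b3⟩
        · rw [he, h0, cnd_false]
          push_cast
          rw [b1]
          have : (2 * ((i:ℝ)+1) * (2 * n + (i+1))) * M ≤ (2 * ((i:ℝ)+1) * (2 * n + (i+1))) * (n - 1/2) :=
            mul_le_mul_of_nonneg_left hMn (by positivity)
          linarith
        · rw [he, h0, cnd_true]
          rw [Nat.cast_mul, hw]
          push_cast
          have k1 : ((i:ℝ)+1) * (2 * N - 1) * (2 * M) ≤ (i+1) * (2*N-1) * (2 * n + (i+1)) :=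
            mul_le_mul_of_nonneg_left (by linarith) (by positivity)
          linarith
      have hc' : (100:ℝ) * (2 * N - 1) * SS + th * (2 * N - 1) * g
          ≤ g * (100 * e + 100 * (2 * N - 1)) := by
        rw [← hw]; exact_mod_cast hc
      have e2 : (SS:ℝ) ≤ g * ((e:ℝ) / (2 * N - 1) - (((th:ℝ) - 100)/100)) := by
        rw [show g * ((e:ℝ) / (2 * N - 1) - (((th:ℝ) - 100)/100))
          = (g * (100 * e + 100 * (2 * N - 1)) - th * (2 * N - 1) * g) / (100 * (2 * N - 1)) by
            field_simp; ring]
        rw [le_div_iff₀ (by linarith)]; linarith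
      refine e2.trans (mul_le_mul_of_nonneg_left ?_ (Nat.cast_nonneg _))
      have : ((n:ℝ)^2 - (p:ℝ)^2) / M = - (((p:ℝ)^2 - (n:ℝ)^2) / M) := by rw [← neg_div]; ring
      rw [this]; linarith
  · rw [if_neg hnear]
    unfold near at hnear
    by_cases hgt : n < p
    · rw [if_pos hgt, abs_of_neg (Dn_neg hM hMn (by linarith) hgt)]
      have hden := den_right hM hMn (show t ≤ 1 by linarith) hgt
      show _ ≤ (gR:ℝ) / SS / 2 * (1 / ((p:ℝ) - n))
      obtain ⟨k, hk⟩ : ∃ k, p = n + k := ⟨p - n, by omega⟩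
      have hk9 : (9:ℝ) ≤ k := by exact_mod_cast (by omega : 9 ≤ k)
      have hpr : (p:ℝ) = n + k := by rw [hk]; push_cast; ring
      unfold Dn
      rw [← one_div_neg_eq_neg_one_div]
      have hgR0 : (0:ℝ) ≤ gR := Nat.cast_nonneg _
      set e : ℕ := cnd cl (2 * N - 1) (2 * N + 9) with he
      set tp : ℝ := ((th - 100 : ℕ):ℝ) with htp
      have htp1 : (th:ℝ) - 100 ≤ tp := by rw [htp, tsub_cast_cases]; exact le_max_left _ _
      have htp0 : 0 ≤ tp := Nat.cast_nonneg _
      have h3' : (1800:ℝ) * (2 * N - 1) * SS + tp * (2 * N - 1) * gR ≤ 1800 * e * gR := by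
        rw [← hw, htp]; exact_mod_cast h3
      have e1 : 2 * (e:ℝ) / (2 * N - 1) ≤ (2 * n + k) / M := by
        rw [div_le_div_iff₀ hwp hM]
        rcases hs with ⟨h0, b1, b2⟩ | ⟨h0, b1, b2, b3⟩
        · rw [he, h0, cnd_false]
          push_cast
          rw [b1]
          have k1 : (2 * (n:ℝ) + 9) * (2 * M) ≤ (2 * n + k) * (2 * n - 1) :=
            mul_le_mul (by linarith) (by linarith) (by linarith) (by linarith)
          linarith
        · rw [he, h0, cnd_true]
          rw [hw]
          have k1 : (2 * (N:ℝ) - 1) * (2 * M) ≤ (2 * N - 1) * (2 * n + k) :=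
            mul_le_mul_of_nonneg_left (by linarith) hwp.le
          linarith
      have e2 : (SS:ℝ) ≤ gR * ((e:ℝ) / (2 * N - 1) - tp / 1800) := by
        rw [show gR * ((e:ℝ) / (2 * N - 1) - tp / 1800)
          = (1800 * e * gR - tp * (2 * N - 1) * gR) / (1800 * (2 * N - 1)) by
            field_simp]
        rw [le_div_iff₀ (by linarith)]; linarith
      have hkp : (0:ℝ) < k := by linarith
      have e3 : (e:ℝ) / (2 * N - 1) - tp / 1800 ≤ -(((n:ℝ)^2 - (p:ℝ)^2) / M + t) / (2 * k) := by
        rw [le_div_iff₀ (by linarith)]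
        have q1 : ((n:ℝ)^2 - (p:ℝ)^2) / M = - (k * ((2 * n + k) / M)) := by rw [hpr]; field_simp; ring
        rw [q1]
        have q2 := mul_le_mul_of_nonneg_left e1 hkp.le
        have q3 : t ≤ tp / 100 := by linarith
        have q4 : tp * 9 ≤ tp * k := mul_le_mul_of_nonneg_left hk9 htp0
        have q5 : 2 * (e:ℝ) / (2 * N - 1) = 2 * ((e:ℝ) / (2 * N - 1)) := by ring
        rw [q5] at q2
        nlinarith
      have e4 := e2.trans (mul_le_mul_of_nonneg_left e3 hgR0)
      have e5 : (gR:ℝ) / SS / 2 * (1 / ((p:ℝ) - n)) = (gR / (2 * k)) / SS := by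
        rw [hpr, add_sub_cancel_left, div_div, div_div, div_mul_div_comm, mul_one]
        congr 1; ring
      rw [e5]
      refine inv_le_of (t := t) hSp (by linarith) (e4.trans (le_of_eq ?_))
      field_simp
    · rw [if_neg hgt]
      rcases hs with ⟨h0, b1, b2⟩ | ⟨h0, b1, b2, b3⟩
      · exfalso; omega
      · rw [abs_of_pos (Dn_pos hM hMn (by linarith) (by omega))]
        have hden := den_left hM hMn (show (-1:ℝ) ≤ t by linarith) (show p < n by omega)
        show _ ≤ (gL:ℝ) / SS / 2 * (1 / ((n:ℝ) - p) + 1 / ((n:ℝ) + p))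
        obtain ⟨k, hk⟩ : ∃ k, n = p + k := ⟨n - p, by omega⟩
        have hk9 : (9:ℝ) ≤ k := by exact_mod_cast (by omega : 9 ≤ k)
        have hkn : (k:ℝ) + 1 ≤ n := by exact_mod_cast (by omega : k + 1 ≤ n)
        have hpr : (p:ℝ) = n - k := by rw [hk]; push_cast; ring
        have hn16 : (16:ℝ) ≤ n := by exact_mod_cast b3
        rw [hgL, h0, cnd_true]
        have e5 : ((1081000:ℕ):ℝ) / SS / 2 * (1 / ((n:ℝ) - p) + 1 / ((n:ℝ) + p))
            = 1.081 * n / (k * (2 * n - k)) := by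
          have z1 : (0:ℝ) < k := by linarith
          have z2 : (0:ℝ) < 2 * n - k := by linarith
          rw [hpr, show (n:ℝ) - (n - k) = k by ring, show (n:ℝ) + (n - k) = 2 * n - k by ring]
          have z3 : ((1081000:ℕ):ℝ) / SS = 1.081 := by norm_num
          rw [z3]
          field_simp
          ring
        rw [e5]
        unfold Dn
        have y0 : 9 * (2 * (n:ℝ) - 9) ≤ k * (2 * n - k) := by nlinarith
        have hy : 0 < (k:ℝ) * (2 * n - k) := by nlinarith
        have q1 : (k:ℝ) * (2 * n - k) / (n - 1/2) ≤ ((n:ℝ)^2 - (p:ℝ)^2) / M := by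
          rw [show (n:ℝ)^2 - (p:ℝ)^2 = k * (2 * n - k) by rw [hpr]; ring]
          exact div_le_div_of_nonneg_left hy.le hM hMn
        rw [div_le_div_iff₀ (by linarith) hy, one_mul]
        have hnh : (0:ℝ) < n - 1/2 := by linarith
        generalize (k:ℝ) * (2 * n - k) = y at *
        have q2 : y ≤ 1.081 * n * (y / (n - 1/2) - 1) := by
          have : (y / (n - 1/2) - 1) = (y - (n - 1/2)) / (n - 1/2) := by
            rw [sub_div, div_self hnh.ne']
          rw [this, ← mul_div_assoc, le_div_iff₀ hnh]
          nlinarith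
        refine q2.trans (mul_le_mul_of_nonneg_left ?_ (by positivity))
        linarith
end
end KP


namespace KP

theorem der_real {I : Finset ℕ} {D W h f : ℕ → ℝ} {gR wR gL wL S : ℝ} (hS : 0 < S)
    (H : 425 * ∑ q ∈ I, (D q)^2 * (4 * (W q)^2 + (h q)^2) + 50 * (gR * wR)^2 + 136 * (gL * wL)^2 + 1
      ≤ 1700 * S^4 + 425 * ∑ q ∈ I, 4 * (D q)^2 * (f q)^2) :
    ∑ q ∈ I, (D q / S)^2 * ((W q / S)^2 - (f q / S)^2 + (h q / S)^2/4)
      + (gR / S * (wR / S))^2 / 34 + (gL / S * (wL / S))^2 * 0.08 < 1 := by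
  have e : ∑ q ∈ I, (D q / S)^2 * ((W q / S)^2 - (f q / S)^2 + (h q / S)^2/4)
      = (∑ q ∈ I, (D q)^2 * (4 * (W q)^2 + (h q)^2) - ∑ q ∈ I, 4 * (D q)^2 * (f q)^2) / (4 * S^4) := by
    rw [← Finset.sum_sub_distrib, Finset.sum_div]
    refine Finset.sum_congr rfl fun q _ => ?_
    field_simp
    ring
  rw [e]
  generalize ∑ q ∈ I, (D q)^2 * (4 * (W q)^2 + (h q)^2) = A at *
  generalize ∑ q ∈ I, 4 * (D q)^2 * (f q)^2 = B at *
  have e2 : (A - B) / (4 * S^4) + (gR / S * (wR / S))^2 / 34 + (gL / S * (wL / S))^2 * 0.08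
     = (425 * (A - B) + 50 * (gR * wR)^2 + 136 * (gL * wL)^2) / (1700 * S^4) := by
    field_simp
    ring
  rw [e2, div_lt_one (by positivity)]
  linarith

theorem up_real {I : Finset ℕ} {f z X Y : ℕ → ℝ} {h a xR l xL S T : ℝ} (hS : 0 < S)
    (H : 4 * h * S^2 + ∑ q ∈ I, 4 * f q * z q * S + 4 * (a * xR + l * xL) * S + ∑ q ∈ I, X q + 1
      ≤ T * 40000 * S^2 + ∑ q ∈ I, Y q) (hST : S = 1000000) :
    h / S + ∑ q ∈ I, (f q / S * (z q / S) + (X q - Y q) / (4 * S^3))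
      + (a / S * (xR / S) + l / S * (xL / S)) < T / 100 := by
  have e : ∑ q ∈ I, (f q / S * (z q / S) + (X q - Y q) / (4 * S^3))
     = (∑ q ∈ I, 4 * f q * z q * S + ∑ q ∈ I, X q - ∑ q ∈ I, Y q) / (4 * S^3) := by
    rw [← Finset.sum_add_distrib, ← Finset.sum_sub_distrib, Finset.sum_div]
    refine Finset.sum_congr rfl fun q _ => ?_
    field_simp
    ring
  rw [e]
  generalize ∑ q ∈ I, 4 * f q * z q * S = A at *
  generalize ∑ q ∈ I, X q = B at *
  generalize ∑ q ∈ I, Y q = G at *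
  have e2 : h / S + (A + B - G) / (4 * S^3) + (a / S * (xR / S) + l / S * (xL / S))
     = (4 * h * S^2 + A + 4 * (a * xR + l * xL) * S + B - G) / (4 * S^3) := by
    field_simp
    ring
  rw [e2, div_lt_div_iff₀ (by positivity) (by norm_num)]
  have : T * (4 * S^3) = (T * 40000 * S^2) * 100 := by rw [hST]; ring
  rw [this]
  linarith

section
variable {N L n : ℕ} {cl : Bool} {al Ki c h D z W gR gL wR wL xR xL : ℕ}

theorem f_dat (q : ℕ) : (datOf N L cl al Ki c h D z W gR gL wR wL xR xL).f L q = (fN L c h q : ℝ) / SS := by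
  unfold Dat.f fN datOf ad
  push_cast
  rw [add_div]

theorem chkDer_sound (H : chkDer L c h D W gR gL wR wL = true)
    (d : Dat) (hd : d = datOf N L cl al Ki c h D z W gR gL wR wL xR xL) :
    ∑ q ∈ (Finset.range (L+9)).erase L, (d.D q)^2 * ((d.W q)^2 - (d.f L q)^2 + (d.h (q+L))^2/4)
        + (d.gR * d.wR)^2 / 34 + (d.gL * d.wL)^2 * 0.08 < 1 := by
  have hS : (0:ℝ) < (SS:ℕ) := by norm_num
  unfold chkDer at H
  rw [Nat.ble_eq, sme_eq, sme_eq] at H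
  have H' := der_real (I := (Finset.range (L+9)).erase L) (D := fun q => (get D q : ℝ)) (W := fun q => (gw W q : ℝ))
    (h := fun q => (get h (q+L) : ℝ)) (f := fun q => (fN L c h q : ℝ)) (gR := gR) (wR := wR) (gL := gL) (wL := wL)
    hS (by exact_mod_cast H)
  subst hd
  simp only [f_dat]
  exact H'

theorem chkUp_sound {tl : ℕ} (htl : 100 ≤ tl) (H : chkUp L cl al c h D z xR xL tl = true)
    (d : Dat) (hd : d = datOf N L cl al Ki c h D z W gR gL wR wL xR xL) :
    d.h (2*L) + ∑ q ∈ (Finset.range (L+9)).erase L,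
        (d.f L q * d.z q + if L < q then (d.h (q+L))^2/4 * d.D q - (d.f L q)^2 * d.D q else 0)
        + (d.al L * d.xR + d.la L * d.xL) < ((tl:ℝ) - 100) / 100 := by
  have hS : (0:ℝ) < (SS:ℕ) := by norm_num
  unfold chkUp baseN at H
  rw [Nat.ble_eq] at H
  simp only [sme_eq, cnd_ble] at H
  have H2 : ((_ : ℕ) : ℝ) ≤ ((_ : ℕ) : ℝ) := Nat.cast_le.2 H
  simp only [Nat.cast_add, Nat.cast_mul, Nat.cast_pow, Nat.cast_sum, Nat.cast_sub htl, Nat.cast_one, Nat.cast_ofNat] at H2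
  rw [← Nat.cast_ofNat (n := 1000000)] at H2
  have H' := up_real hS H2 (by norm_num)
  subst hd
  refine lt_of_le_of_lt (le_of_eq ?_) H'
  simp only [f_dat]
  show (get h (2*L) : ℝ) / SS + _ + ((get al L : ℝ) / SS * ((xR:ℝ) / SS) + (laN cl L : ℝ) / SS * ((xL:ℝ)/SS)) = _
  congr 2
  refine Finset.sum_congr rfl fun q hq => ?_
  show (fN L c h q : ℝ) / SS * ((get z q : ℝ)/SS) + _ = _
  congr 1
  show (if L < q then ((get h (q+L) : ℝ)/SS)^2/4 * ((get D q : ℝ)/SS) - ((fN L c h q : ℝ)/SS)^2 * ((get D q:ℝ)/SS) else 0) = _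
  by_cases hq' : q ≤ L
  · rw [if_neg (by omega), if_pos hq', if_pos hq']; simp
  · rw [if_pos (by omega), if_neg hq', if_neg hq']
    generalize ((SS:ℕ):ℝ) = S at *
    simp only [Nat.cast_mul, Nat.cast_pow, Nat.cast_ofNat]
    field_simp

theorem chkLow_sound {th yl : ℕ} (hth : th ≤ 100) (H : chkLow L cl al yl c h D z xR xL th = true)
    (d : Dat) (hd : d = datOf N L cl al Ki c h D z W gR gL wR wL xR xL) :
    d.h (2*L) + ∑ q ∈ (Finset.range (L+9)).erase L,
        (d.f L q * d.z q + if q < L then (d.h (q+L))^2/4 * d.D q - (d.f L q)^2 * d.D q else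
          if q = L + 1 then ((eN L yl c h : ℝ) / SS^2) * d.D q - (d.f L q)^2 * d.D q else 0)
        + (d.al L * d.xR + d.la L * d.xL) < (100 - (th:ℝ)) / 100 := by
  have hS : (0:ℝ) < (SS:ℕ) := by norm_num
  unfold chkLow baseN at H
  rw [Nat.ble_eq] at H
  simp only [sme_eq, cnd_ble, cnd_beq] at H
  have H2 : ((_ : ℕ) : ℝ) ≤ ((_ : ℕ) : ℝ) := Nat.cast_le.2 H
  simp only [Nat.cast_add, Nat.cast_mul, Nat.cast_pow, Nat.cast_sum, Nat.cast_sub hth, Nat.cast_one, Nat.cast_ofNat] at H2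
  rw [← Nat.cast_ofNat (n := 1000000)] at H2
  have H' := up_real hS H2 (by norm_num)
  subst hd
  refine lt_of_le_of_lt (le_of_eq ?_) H'
  simp only [f_dat]
  show (get h (2*L) : ℝ) / SS + _ + ((get al L : ℝ) / SS * ((xR:ℝ) / SS) + (laN cl L : ℝ) / SS * ((xL:ℝ)/SS)) = _
  congr 2
  refine Finset.sum_congr rfl fun q hq => ?_
  show (fN L c h q : ℝ) / SS * ((get z q : ℝ)/SS) + _ = _
  congr 1
  show (if q < L then ((get h (q+L) : ℝ)/SS)^2/4 * ((get D q : ℝ)/SS) - ((fN L c h q : ℝ)/SS)^2 * ((get D q:ℝ)/SS) else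
    if q = L + 1 then ((eN L yl c h : ℝ) / SS^2) * ((get D q : ℝ)/SS) - ((fN L c h q : ℝ)/SS)^2 * ((get D q:ℝ)/SS) else 0) = _
  by_cases hq' : L ≤ q
  · rw [if_neg (by omega), if_pos hq', if_pos hq']
    by_cases h1 : q = L + 1
    · rw [if_pos h1, if_pos h1, if_pos h1]
      generalize ((SS:ℕ):ℝ) = S at *
      simp only [Nat.cast_mul, Nat.cast_pow, Nat.cast_ofNat]
      field_simp
    · rw [if_neg h1, if_neg h1, if_neg h1]; simp
  · rw [if_pos (by omega), if_neg hq', if_neg hq']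
    generalize ((SS:ℕ):ℝ) = S at *
    simp only [Nat.cast_mul, Nat.cast_pow, Nat.cast_ofNat]
    field_simp
end
end KP


namespace KP

def DerP (G : ℝ → ℝ) (tl th : ℕ) : Prop :=
  ∃ κ < 1, ∀ t1 ∈ Set.Icc (((tl:ℝ) - 100) / 100) (((th:ℝ) - 100) / 100),
    ∀ t2 ∈ Set.Icc (((tl:ℝ) - 100) / 100) (((th:ℝ) - 100) / 100), t1 ≤ t2 → G t2 - G t1 ≤ (t2 - t1) * κ
def UpP (G : ℝ → ℝ) (tl th : ℕ) : Prop :=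
  ∀ t ∈ Set.Icc (((tl:ℝ) - 100) / 100) (((th:ℝ) - 100) / 100), G t < ((tl:ℝ) - 100) / 100
def LowP (G : ℝ → ℝ) (tl th : ℕ) : Prop :=
  ∀ t ∈ Set.Icc (((tl:ℝ) - 100) / 100) (((th:ℝ) - 100) / 100), -G t < (100 - (th:ℝ)) / 100

/-- all the information extracted from the certificates -/
structure Concl (G : ℝ → ℝ) : Prop where
  d1 : DerP G 35 60
  d2 : DerP G 60 100
  d3 : DerP G 100 150
  d4 : DerP G 150 180
  up : UpP G 180 200
  l1 : LowP G 28 35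
  l2 : LowP G 20 28
  l3 : LowP G 10 20
  l4 : LowP G 0 10

section
variable {N L n : ℕ} {cl : Bool} {al Ki yl c h : ℕ} {C : ℕ → ℝ} {M : ℝ} {r s K : ℕ}

theorem frc_elim {t : ℕ} {k : ℕ → Bool} (H : frc t k = true) : ∃ y, t = y ∧ k y = true := ⟨t, rfl, by rwa [frc_eq] at H⟩

theorem run_sound (hs : Setup N L n cl) (hal : allb (fun q => Nat.ble (alF N L q) (get al q)) (L + 9) = true)
    (hM : 0 < M) (hMn : M ≤ n - 1/2) (hK : 8 ≤ K) (hr : 1 ≤ r) (hs1 : 1 ≤ s)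
    (hB : ∀ D z W gR gL wR wL xR xL, CellB (datOf N L cl al Ki c h D z W gR gL wR wL xR xL) n L C)
    (hyl : (yl:ℝ) / SS ≤ |C 1|)
    {tl th kind W : ℕ} (hth : th ≤ 200) (H : chkRun N L cl al Ki yl c h tl th kind W = true) :
    (kind = 0 → DerP (Gn C M n r s K) tl th) ∧ (kind = 1 → 100 ≤ tl → UpP (Gn C M n r s K) tl th) ∧
    (kind = 2 → th ≤ 100 → LowP (Gn C M n r s K) tl th) := by
  have hS : (0:ℝ) < (SS:ℕ) := by norm_num
  unfold chkRun at H
  obtain ⟨gR, -, H⟩ := frc_elim H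
  obtain ⟨D, -, H⟩ := frc_elim H
  obtain ⟨wR, -, H⟩ := frc_elim H
  obtain ⟨wL, -, H⟩ := frc_elim H
  obtain ⟨gL, hgL, H⟩ := frc_elim H
  obtain ⟨xR, -, H⟩ := frc_elim H
  obtain ⟨xL, -, H⟩ := frc_elim H
  obtain ⟨z, -, H⟩ := frc_elim H
  rw [Bool.and_eq_true, Bool.and_eq_true] at H
  obtain ⟨⟨H1, H2⟩, H3⟩ := H
  have hLn : L < n := by rcases hs with ⟨-, h1, h2⟩ | ⟨-, h1, h2, h3⟩ <;> omega
  set d := datOf N L cl al Ki c h D z W gR gL wR wL xR xL with hd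
  have hD := DBd_sound (al := al) (Ki := Ki) (c := c) (h := h) (z := z) (W := W) (gR := gR) (wR := wR) (wL := wL)
    (xR := xR) (xL := xL) hs hM hMn hth hgL.symm H1
  have hC := cert_sound hs H2
  have hG : d.Geo n L := geo_sound hs hal
  have hN : d.Nonneg := datOf_nonneg
  have hB' : CellB d n L C := hB D z W gR gL wR wL xR xL
  have htl0 : (0:ℝ) ≤ tl := Nat.cast_nonneg _
  have htl1 : (-1:ℝ) ≤ ((tl:ℝ) - 100)/100 := by linarith
  have hth' : (th:ℝ) ≤ 200 := by exact_mod_cast hth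
  have hth1 : ((th:ℝ) - 100)/100 ≤ 1 := by linarith
  refine ⟨?_, ?_, ?_⟩
  · intro hk
    subst hk
    rw [cnd_beq, if_pos rfl] at H3
    exact ⟨_, chkDer_sound H3 d hd, fun t1 h1 t2 h2 h12 =>
      der_piece hN hC hG hLn hK hB' hM hMn hD htl1 hth1 hs1 h1 h2 h12⟩
  · intro hk htl
    subst hk
    rw [cnd_beq, if_neg (by norm_num), cnd_beq, if_pos rfl] at H3
    intro t ht
    exact (up_piece hN hC hG hLn hK hB' hM hMn hD hth1 hs1 ht).trans_lt (chkUp_sound htl H3 d hd)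
  · intro hk hth2
    subst hk
    rw [cnd_beq, if_neg (by norm_num), cnd_beq, if_neg (by norm_num)] at H3
    intro t ht
    have hth2' : (th:ℝ) ≤ 100 := by exact_mod_cast hth2
    have hl := chkLow_sound hth2 H3 d hd
    refine lt_of_le_of_lt (low_piece (v := (vN L yl h : ℝ) / SS) (E := (eN L yl c h : ℝ) / SS^2) hN hC hG hLn hK hB' hM hMn hD hr htl1
      (by linarith) hs1 ht (by positivity) (by positivity) ?_ ?_) hl
    · unfold vN
      rw [cnd_beq]
      split_ifs with h0
      · left; simp
      · rw [tsub_cast_cases]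
        rcases le_total ((yl:ℝ) - get h (2*L-1)) 0 with h2 | h2
        · left; rw [max_eq_right h2]; simp
        · right
          refine ⟨by omega, ?_⟩
          rw [max_eq_left h2]
          show _ + (get h (2*L-1) : ℝ) / SS ≤ _
          rw [← add_div, sub_add_cancel]
          exact hyl
    · rw [hd, f_dat, div_pow, div_pow, ← add_div]
      refine div_le_div_of_nonneg_right ?_ (by positivity)
      unfold eN
      have : ((fN L c h (L+1) : ℕ):ℝ)^2 - ((vN L yl h : ℕ):ℝ)^2 ≤ (((fN L c h (L + 1)) ^ 2 - (vN L yl h) ^ 2 : ℕ) : ℝ) := by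
        rw [tsub_cast_cases]; push_cast; exact le_max_left _ _
      linarith

theorem ar1 {Ki a : ℕ} (hKi : 10000000000 / (15707 + 200 * a) + 1 = Ki) {x : ℝ} (hx0 : 0 ≤ x)
    (ha : (a:ℝ) ≤ 50 * x) : (1:ℝ) / (1.5707 + x) ≤ (Ki:ℝ) / SS := by
  have hSp : (0:ℝ) < (SS:ℕ) := by norm_num
  have h1 : 10000000000 ≤ (15707 + 200 * a) * Ki := by
    rw [← hKi]
    exact (Nat.lt_mul_div_succ 10000000000 (show 0 < 15707 + 200 * a by omega)).le
  have h2 : (((10000000000:ℕ)):ℝ) ≤ (((15707 + 200 * a) * Ki : ℕ) : ℝ) := Nat.cast_le.2 h1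
  rw [Nat.cast_mul, Nat.cast_add, Nat.cast_mul, Nat.cast_ofNat, Nat.cast_ofNat, Nat.cast_ofNat] at h2
  clear hKi h1
  rw [div_le_div_iff₀ (by linarith) hSp, show ((SS:ℕ):ℝ) = 1000000 by norm_num]
  have hk0 : (0:ℝ) ≤ Ki := Nat.cast_nonneg _
  have h3 : (15707 + 200 * (a:ℝ)) * Ki ≤ (15707 + 10000 * x) * Ki := mul_le_mul_of_nonneg_right (by linarith) hk0
  linarith

theorem ar2 {Ki yh a : ℕ} (ha50 : a ≤ 50) (hyh : Ki * (5000 - a * a) / 5000 + 1 = yh) {x y : ℝ} (hx0 : 0 ≤ x)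
    (hx1 : x ≤ 1) (ha : (a:ℝ) ≤ 50 * x) (h : y * (1.5707 + x) ≤ 1 - x^2/2)
    (q1 : (1:ℝ) / (1.5707 + x) ≤ (Ki:ℝ) / SS) : y ≤ (yh:ℝ) / SS := by
  have hSp : (0:ℝ) < (SS:ℕ) := by norm_num
  have ha0 : (0:ℝ) ≤ a := Nat.cast_nonneg a
  have hle : a * a ≤ 5000 := (Nat.mul_le_mul ha50 ha50).trans (by norm_num)
  have h5 : (Ki:ℝ) * (5000 - a * a) ≤ 5000 * yh := by
    have h1 : Ki * (5000 - a * a) ≤ 5000 * yh := by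
      rw [← hyh]
      exact (Nat.lt_mul_div_succ _ (by norm_num)).le
    have h6 : ((Ki * (5000 - a * a) : ℕ) : ℝ) ≤ ((5000 * yh : ℕ):ℝ) := Nat.cast_le.2 h1
    rw [Nat.cast_mul, Nat.cast_sub hle, Nat.cast_mul, Nat.cast_mul, Nat.cast_ofNat] at h6
    exact h6
  clear hyh
  have h1 : y ≤ (1 - x^2/2) / (1.5707 + x) := by
    rw [le_div_iff₀ (by linarith)]; exact h
  have h2 : (1 - x^2/2) / (1.5707 + x) = (1 - x^2/2) * (1 / (1.5707 + x)) := by ring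
  have hxx : x^2 ≤ 1 := by nlinarith
  have h3 : (1 - x^2/2) * (1 / (1.5707 + x)) ≤ (1 - x^2/2) * ((Ki:ℝ) / SS) :=
    mul_le_mul_of_nonneg_left q1 (by linarith)
  have hax : (a:ℝ) * a ≤ (50 * x) * (50 * x) := mul_le_mul ha ha ha0 (by linarith)
  have h4 : (1 - x^2/2) * ((Ki:ℝ) / SS) ≤ ((5000 - (a:ℝ) * a) / 5000) * ((Ki:ℝ) / SS) :=
    mul_le_mul_of_nonneg_right (by linarith) (by positivity)
  have h6 : ((5000 - (a:ℝ) * a) / 5000) * ((Ki:ℝ) / SS) ≤ yh / SS := by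
    rw [← mul_div_assoc]
    refine div_le_div_of_nonneg_right ?_ hSp.le
    linarith
  linarith

theorem ar3 {yl b : ℕ} (hb50 : b ≤ 50) (hyl : (2500 - b * b) * 10000000000 / ((15708 + 200 * b) * 2500) = yl)
    {x y : ℝ} (hx0 : 0 ≤ x) (hb : 50 * x ≤ b) (h : 1 - x^2 ≤ y * (1.5708 + x)) : (yl:ℝ) / SS ≤ y := by
  have hSp : (0:ℝ) < (SS:ℕ) := by norm_num
  have h1 : (1 - x^2) / (1.5708 + x) ≤ y := by
    rw [div_le_iff₀ (by linarith)]; exact h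
  refine le_trans ?_ h1
  have hle : b * b ≤ 2500 := (Nat.mul_le_mul hb50 hb50).trans (by norm_num)
  have h5 : (yl:ℝ) * ((15708 + 200 * b) * 2500) ≤ (2500 - b * b) * 10000000000 := by
    have h4 : yl * ((15708 + 200 * b) * 2500) ≤ (2500 - b * b) * 10000000000 := by
      rw [← hyl]; exact Nat.div_mul_le_self _ _
    have h6 : ((yl * ((15708 + 200 * b) * 2500) : ℕ) : ℝ) ≤ (((2500 - b * b) * 10000000000 : ℕ):ℝ) := Nat.cast_le.2 h4
    rw [Nat.cast_mul, Nat.cast_mul (2500 - b * b), Nat.cast_sub hle, Nat.cast_mul, Nat.cast_add, Nat.cast_mul, Nat.cast_mul,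
      Nat.cast_ofNat, Nat.cast_ofNat, Nat.cast_ofNat, Nat.cast_ofNat] at h6
    exact h6
  clear hyl
  rw [div_le_div_iff₀ hSp (by linarith), show ((SS:ℕ):ℝ) = 1000000 by norm_num]
  have h7 : (yl:ℝ) * (15708 + 10000 * x) ≤ yl * (15708 + 200 * b) :=
      mul_le_mul_of_nonneg_left (by linarith) (Nat.cast_nonneg _)
  have h8 : (50 * x) * (50 * x) ≤ (b:ℝ) * b := mul_le_mul hb hb (by linarith) (Nat.cast_nonneg _)
  linarith

theorem cell_sound (hs : Setup N L n cl) (hal : allb (fun q => Nat.ble (alF N L q) (get al q)) (L + 9) = true)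
    (hM : 0 < M) (hMn : M ≤ n - 1/2) (hK : 8 ≤ K) (hr : 1 ≤ r) (hs1 : 1 ≤ s) {x : ℝ} (hC : Coef C x)
    {a b w0 w1 w2 w3 w4 w5 w6 w7 w8 : ℕ} (ha : (a:ℝ) ≤ 50 * x) (hb : 50 * x ≤ b)
    (H : chkCell N L cl al a b w0 w1 w2 w3 w4 w5 w6 w7 w8 = true) : Concl (Gn C M n r s K) := by
  have hSp : (0:ℝ) < (SS:ℕ) := by norm_num
  unfold chkCell at H
  obtain ⟨Ki, hKi, H⟩ := frc_elim H
  obtain ⟨yh, hyh, H⟩ := frc_elim H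
  obtain ⟨yl, hyl, H⟩ := frc_elim H
  obtain ⟨ut, -, H⟩ := frc_elim H
  obtain ⟨c, -, H⟩ := frc_elim H
  obtain ⟨h, -, H⟩ := frc_elim H
  simp only [Bool.and_eq_true, Nat.ble_eq] at H
  obtain ⟨⟨⟨⟨⟨hU, hc⟩, hh⟩, ha50⟩, hb50⟩, ⟨⟨⟨⟨⟨⟨⟨⟨r0, r1⟩, r2⟩, r3⟩, r4⟩, r5⟩, r6⟩, r7⟩, r8⟩⟩ := H
  have hx0 := hC.x0
  have q1 := ar1 hKi hx0 ha
  have hKiC : ∀ k, 1 ≤ k → |C k| * k ≤ (Ki:ℝ) / SS := by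
    intro k hk
    refine le_trans ?_ q1
    rw [le_div_iff₀ (by linarith)]
    have h1 := hC.k1 k hk
    rw [mul_assoc]
    exact h1
  have hyhC : |C 1| ≤ (yh:ℝ) / SS := ar2 ha50 hyh hx0 hC.x1 ha hC.y1 q1
  have hylC : (yl:ℝ) / SS ≤ |C 1| := ar3 hb50 hyl hx0 hb hC.y2
  have hLN : L < N := by rcases hs with ⟨-, h1, h2⟩ | ⟨-, h1, h2, h3⟩ <;> omega
  have hcl : if cl = true then N ≤ n else N = n := by
    rcases hs with ⟨h0, h1, h2⟩ | ⟨h0, h1, h2, h3⟩ <;> simp [h0] <;> omega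
  have hB : ∀ D z W gR gL wR wL xR xL, CellB (datOf N L cl al Ki c h D z W gR gL wR wL xR xL) n L C :=
    fun D z W gR gL wR wL xR xL => cellB_sound hC hU ha hb hKiC hyhC hcl hLN hc hh
  have R := fun {tl th kind W : ℕ} (hth : th ≤ 200) (H : chkRun N L cl al Ki yl c h tl th kind W = true) =>
    run_sound (r := r) (s := s) hs hal hM hMn hK hr hs1 hB hylC hth H
  exact ⟨(R (by norm_num) r0).1 rfl, (R (by norm_num) r1).1 rfl, (R (by norm_num) r2).1 rfl,
    (R (by norm_num) r3).1 rfl, (R (by norm_num) r4).2.1 rfl (by norm_num), (R (by norm_num) r5).2.2 rfl (by norm_num),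
    (R (by norm_num) r6).2.2 rfl (by norm_num), (R (by norm_num) r7).2.2 rfl (by norm_num),
    (R (by norm_num) r8).2.2 rfl (by norm_num)⟩

theorem cells_sound (hs : Setup N L n cl) (hal : allb (fun q => Nat.ble (alF N L q) (get al q)) (L + 9) = true)
    (hM : 0 < M) (hMn : M ≤ n - 1/2) (hK : 8 ≤ K) (hr : 1 ≤ r) (hs1 : 1 ≤ s) {x : ℝ} (hC : Coef C x)
    (cs : Cells) (a : ℕ) (ha : (a:ℝ) ≤ 50 * x) (hx : x < 1)
    (H : chkCells N L cl al cs a = true) : Concl (Gn C M n r s K) := by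
  induction cs generalizing a with
  | nil =>
    have H : Nat.beq a 50 = true := H
    rw [Nat.beq_eq] at H
    rw [H] at ha
    push_cast at ha
    linarith
  | cons b w0 w1 w2 w3 w4 w5 w6 w7 w8 rest ih =>
    have H : (chkCell N L cl al a b w0 w1 w2 w3 w4 w5 w6 w7 w8 && chkCells N L cl al rest b) = true := H
    rw [Bool.and_eq_true] at H
    rcases le_total (50 * x) b with h1 | h1
    · exact cell_sound hs hal hM hMn hK hr hs1 hC ha h1 H.1
    · exact ih b h1 H.2

theorem N_sound (hs : Setup N L n cl) (cs : Cells) (H : chkN N L cl cs = true)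
    (hM : 0 < M) (hMn : M ≤ n - 1/2) (hK : 8 ≤ K) (hr : 1 ≤ r) (hs1 : 1 ≤ s) {x : ℝ} (hC : Coef C x)
    (hx : x < 1) : Concl (Gn C M n r s K) := by
  unfold chkN at H
  rw [frc_eq, Bool.and_eq_true] at H
  exact cells_sound hs H.1 hM hMn hK hr hs1 hC cs 0 (by have := hC.x0; push_cast; linarith) hx H.2

theorem concl_all (hn : 1 ≤ n) (hM : 0 < M) (hMn : M ≤ n - 1/2) (hK : 8 ≤ K) (hr : 1 ≤ r) (hs1 : 1 ≤ s)
    {x : ℝ} (hC : Coef C x) (hx : x < 1) : Concl (Gn C M n r s K) := by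
  rcases le_or_gt 16 n with h | h
  · exact N_sound (N := 16) (L := 8) (cl := true) (Or.inr ⟨rfl, rfl, rfl, h⟩) cert16 chk16 hM hMn hK hr hs1 hC hx
  · have A : ∀ (N L : ℕ) (cs : Cells), N = n → L + 1 = n → chkN N L false cs = true → Concl (Gn C M n r s K) :=
      fun N L cs h1 h2 H => N_sound (Or.inl ⟨rfl, h1, h2⟩) cs H hM hMn hK hr hs1 hC hx
    rcases (by omega : n = 1 ∨ n = 2 ∨ n = 3 ∨ n = 4 ∨ n = 5 ∨ n = 6 ∨ n = 7 ∨ n = 8 ∨ n = 9 ∨ n = 10 ∨ n = 11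
      ∨ n = 12 ∨ n = 13 ∨ n = 14 ∨ n = 15) with e | e | e | e | e | e | e | e | e | e | e | e | e | e | e
    · exact A 1 0 cert1 e.symm e.symm chk1
    · exact A 2 1 cert2 e.symm e.symm chk2
    · exact A 3 2 cert3 e.symm e.symm chk3
    · exact A 4 3 cert4 e.symm e.symm chk4
    · exact A 5 4 cert5 e.symm e.symm chk5
    · exact A 6 5 cert6 e.symm e.symm chk6
    · exact A 7 6 cert7 e.symm e.symm chk7
    · exact A 8 7 cert8 e.symm e.symm chk8
    · exact A 9 8 cert9 e.symm e.symm chk9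
    · exact A 10 9 cert10 e.symm e.symm chk10
    · exact A 11 10 cert11 e.symm e.symm chk11
    · exact A 12 11 cert12 e.symm e.symm chk12
    · exact A 13 12 cert13 e.symm e.symm chk13
    · exact A 14 13 cert14 e.symm e.symm chk14
    · exact A 15 14 cert15 e.symm e.symm chk15
end
end KP


namespace KP

theorem DerP.mono {G : ℝ → ℝ} {tl th : ℕ} (h : DerP G tl th) {x y : ℝ} (hx : ((tl:ℝ) - 100)/100 ≤ x) (hxy : x < y)
    (hy : y ≤ ((th:ℝ) - 100)/100) : x - G x < y - G y := by
  obtain ⟨κ, hκ, H⟩ := h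
  have := H x ⟨hx, by linarith⟩ y ⟨by linarith, hy⟩ hxy.le
  nlinarith

theorem smo_union {f : ℝ → ℝ} {a b c : ℝ} (hab : a ≤ b) (hbc : b ≤ c) (h1 : StrictMonoOn f (Set.Icc a b))
    (h2 : StrictMonoOn f (Set.Icc b c)) : StrictMonoOn f (Set.Icc a c) := by
  rintro x ⟨x1, x2⟩ y ⟨y1, y2⟩ hxy
  rcases le_total y b with h | h
  · exact h1 ⟨x1, by linarith⟩ ⟨y1, h⟩ hxy
  · rcases le_total b x with h' | h'
    · exact h2 ⟨h', x2⟩ ⟨h, y2⟩ hxy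
    · rcases eq_or_lt_of_le h' with e | e
      · subst e; exact h2 ⟨h', x2⟩ ⟨h, y2⟩ hxy
      · exact (h1 ⟨x1, h'⟩ ⟨hab, le_rfl⟩ e).trans_le
          (h2.monotoneOn ⟨le_rfl, hbc⟩ ⟨h, y2⟩ h)

theorem DerP.smo {G : ℝ → ℝ} {tl th : ℕ} (h : DerP G tl th) :
    StrictMonoOn (fun t => t - G t) (Set.Icc (((tl:ℝ) - 100)/100) (((th:ℝ) - 100)/100)) :=
  fun _ hx _ hy hxy => h.mono hx.1 hxy hy.2

theorem core {G : ℝ → ℝ} (h : Concl G) (hc : ContinuousOn G (Set.Icc (-1) 1)) :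
    ∃! t, t ∈ Set.Icc (-1:ℝ) 1 ∧ t = G t := by
  have mono : StrictMonoOn (fun t => t - G t) (Set.Icc (-0.65:ℝ) 0.8) := by
    have h1 := h.d1.smo
    have h2 := h.d2.smo
    have h3 := h.d3.smo
    have h4 := h.d4.smo
    have := smo_union (by norm_num) (by norm_num) (smo_union (by norm_num) (by norm_num) (smo_union (by norm_num) (by norm_num) h1 h2) h3) h4
    norm_num at this ⊢
    exact this
  have up : ∀ t ∈ Set.Icc (0.8:ℝ) 1, G t < t := by
    rintro t ⟨t1, t2⟩
    have := h.up t ⟨by norm_num at t1 ⊢; linarith, by norm_num at t2 ⊢; linarith⟩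
    norm_num at this t1
    linarith
  have low : ∀ t ∈ Set.Icc (-1:ℝ) (-0.65), t < G t := by
    rintro t ⟨t1, t2⟩
    rcases le_total t (-0.9) with h1 | h1
    · have := h.l4 t ⟨by norm_num at t1 ⊢; linarith, by norm_num at h1 ⊢; linarith⟩
      norm_num at this h1
      linarith
    rcases le_total t (-0.8) with h2 | h2
    · have := h.l3 t ⟨by norm_num at h1 ⊢; linarith, by norm_num at h2 ⊢; linarith⟩
      norm_num at this h2
      linarith
    rcases le_total t (-0.72) with h3 | h3
    · have := h.l2 t ⟨by norm_num at h2 ⊢; linarith, by norm_num at h3 ⊢; linarith⟩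
      norm_num at this h3
      linarith
    · have := h.l1 t ⟨by norm_num at h3 ⊢; linarith, by norm_num at t2 ⊢; linarith⟩
      norm_num at this t2
      linarith
  have fix : ∀ t ∈ Set.Icc (-1:ℝ) 1, t = G t → t ∈ Set.Icc (-0.65:ℝ) 0.8 := by
    rintro t ⟨t1, t2⟩ e
    constructor
    · by_contra hh
      have := low t ⟨t1, by linarith⟩; linarith
    · by_contra hh
      have := up t ⟨by linarith, t2⟩; linarith
  have hc' : ContinuousOn (fun t => t - G t) (Set.Icc (-1:ℝ) 1) := continuousOn_id.sub hc
  obtain ⟨t, ht, e⟩ : (0:ℝ) ∈ Set.image (fun t => t - G t) (Set.Icc (-1:ℝ) 1) := by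
    apply intermediate_value_Icc (by norm_num) hc'
    have a1 := low (-1) ⟨le_rfl, by norm_num⟩
    have a2 := up 1 ⟨by norm_num, le_rfl⟩
    constructor <;> linarith
  have e' : t = G t := by simp only at e; linarith
  refine ⟨t, ⟨ht, e'⟩, ?_⟩
  rintro y ⟨hy, ey⟩
  refine mono.injOn (fix y hy ey) (fix t ht e') ?_
  linarith

variable {C : ℕ → ℝ} {M : ℝ} {n r s K : ℕ}

theorem Dn_cont (hM : 0 < M) (hMn : M ≤ n - 1/2) {p : ℕ} (hp : p ≠ n) :
    ContinuousOn (fun t => Dn M n t p) (Set.Icc (-1) 1) := by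
  unfold Dn
  refine ContinuousOn.div continuousOn_const (continuousOn_const.add continuousOn_id) ?_
  rintro t ⟨h1, h2⟩
  show ((n:ℝ)^2 - (p:ℝ)^2) / M + t ≠ 0
  rcases lt_or_gt_of_ne hp with h | h
  · have := den_left hM hMn h1 h; linarith
  · have := den_right hM hMn h2 h; intro h; linarith

theorem it_cont (hM : 0 < M) (hMn : M ≤ n - 1/2) (T : ℕ → ℕ → ℝ) (f : ℕ → ℝ) (j : ℕ) :
    ∀ p, ContinuousOn (fun t => it (sites n K) T (Dn M n t) f j p) (Set.Icc (-1) 1) := by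
  induction j with
  | zero => intro p; exact continuousOn_const
  | succ j ih =>
    intro p
    show ContinuousOn (fun t => ∑ l ∈ sites n K, T p l * Dn M n t l * it (sites n K) T (Dn M n t) f j l) _
    refine continuousOn_finset_sum _ fun l hl => ?_
    exact (continuousOn_const.mul (Dn_cont hM hMn (Finset.ne_of_mem_erase hl))).mul (ih l)

theorem Gn_cont (hM : 0 < M) (hMn : M ≤ n - 1/2) : ContinuousOn (Gn C M n r s K) (Set.Icc (-1) 1) := by
  unfold Gn aa
  refine continuousOn_const.add (continuousOn_finset_sum _ fun k _ => continuousOn_finset_sum _ fun l hl => ?_)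
  exact (continuousOn_const.mul (Dn_cont hM hMn (Finset.ne_of_mem_erase hl))).mul (it_cont hM hMn _ _ _ _)

theorem Gn_unique (hn : 1 ≤ n) (hM : 0 < M) (hMn : M ≤ n - 1/2) (hK : 8 ≤ K) (hr : 1 ≤ r) (hs1 : 1 ≤ s)
    {x : ℝ} (hC : Coef C x) (hx : x < 1) : ∃! t, t ∈ Set.Icc (-1:ℝ) 1 ∧ t = Gn C M n r s K t :=
  core (concl_all hn hM hMn hK hr hs1 hC hx) (Gn_cont hM hMn)
end KP


namespace KP

theorem cos_int (k u v : ℝ) (hk : k ≠ 0) : ∫ x in u..v, Real.cos (k * x) = (Real.sin (k * v) - Real.sin (k * u)) / k := by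
  rw [intervalIntegral.integral_comp_mul_left _ hk, integral_cos, smul_eq_mul]
  field_simp

theorem coef_int {a b c : ℝ} {q : ℝ → ℝ} (hc : c ∈ Set.Ioo (0:ℝ) Real.pi)
    (hqa : ∀ x ∈ Set.Icc (0:ℝ) c, q x = a) (hqb : ∀ x ∈ Set.Ioc c Real.pi, q x = b) (k : ℝ) :
    ∫ x in (0:ℝ)..Real.pi, q x * Real.cos (k * x)
     = a * (∫ x in (0:ℝ)..c, Real.cos (k * x)) + b * ∫ x in c..Real.pi, Real.cos (k * x) := by
  have i1 : IntervalIntegrable (fun x => a * Real.cos (k * x)) volume 0 c := by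
    apply Continuous.intervalIntegrable; fun_prop
  have i2 : IntervalIntegrable (fun x => b * Real.cos (k * x)) volume c Real.pi := by
    apply Continuous.intervalIntegrable; fun_prop
  have e1 : Set.EqOn (fun x => a * Real.cos (k * x)) (fun x => q x * Real.cos (k * x)) (Set.uIoc 0 c) := by
    rw [Set.uIoc_of_le hc.1.le]
    intro x hx; simp only; rw [hqa x ⟨hx.1.le, hx.2⟩]
  have e2 : Set.EqOn (fun x => b * Real.cos (k * x)) (fun x => q x * Real.cos (k * x)) (Set.uIoc c Real.pi) := by
    rw [Set.uIoc_of_le hc.2.le]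
    intro x hx; simp only; rw [hqb x hx]
  rw [← intervalIntegral.integral_add_adjacent_intervals (i1.congr e1) (i2.congr e2)]
  rw [← intervalIntegral.integral_const_mul, ← intervalIntegral.integral_const_mul]
  congr 1
  · exact intervalIntegral.integral_congr_ae (Eventually.of_forall fun x hx => (e1 hx).symm)
  · exact intervalIntegral.integral_congr_ae (Eventually.of_forall fun x hx => (e2 hx).symm)

theorem coef_eq {a b c : ℝ} {q : ℝ → ℝ} (hc : c ∈ Set.Ioo (0:ℝ) Real.pi)
    (hqa : ∀ x ∈ Set.Icc (0:ℝ) c, q x = a) (hqb : ∀ x ∈ Set.Ioc c Real.pi, q x = b) (k : ℤ) (hk : k ≠ 0) :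
    cosCoefR q k = (a - b) * Real.sin (k * c) / (Real.pi * k) := by
  have hk' : (k:ℝ) ≠ 0 := by exact_mod_cast hk
  unfold cosCoefR
  rw [coef_int hc hqa hqb, cos_int _ _ _ hk', cos_int _ _ _ hk', Real.sin_int_mul_pi]
  have := Real.pi_pos
  field_simp
  simp
  ring

theorem coef_zero {a b c : ℝ} {q : ℝ → ℝ} (hc : c ∈ Set.Ioo (0:ℝ) Real.pi) (habc : (b - a) * c = b * Real.pi)
    (hqa : ∀ x ∈ Set.Icc (0:ℝ) c, q x = a) (hqb : ∀ x ∈ Set.Ioc c Real.pi, q x = b) :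
    cosCoefR q 0 = 0 := by
  unfold cosCoefR
  rw [coef_int hc hqa hqb]
  simp
  linarith

theorem coef_even (q : ℝ → ℝ) (k : ℤ) : cosCoefR q (-k) = cosCoefR q k := by
  unfold cosCoefR
  simp [neg_mul, Real.cos_neg]

theorem sin_uu (α : ℝ) (k : ℕ) : Real.sin (k * α) = uu (Real.cos α) k * Real.sin α := by
  induction k using Nat.strong_induction_on with
  | _ k ih =>
    match k, ih with
    | 0, _ => simp [uu]
    | 1, _ => simp [uu]
    | k+2, ih =>
      have h1 := ih k (by omega)
      have h2 := ih (k+1) (by omega)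
      have hu : uu (Real.cos α) (k+2) = 2 * Real.cos α * uu (Real.cos α) (k+1) - uu (Real.cos α) k := rfl
      rw [hu, sub_mul, ← h1, mul_assoc, ← h2]
      have e1 : ((k+2 : ℕ):ℝ) * α = ((k+1 : ℕ):ℝ) * α + α := by push_cast; ring
      have e2 : (k:ℝ) * α = ((k+1 : ℕ):ℝ) * α - α := by push_cast; ring
      rw [e1, e2, Real.sin_add, Real.sin_sub]
      ring

theorem coef_of {C : ℕ → ℝ} {α : ℝ} (h0 : 0 < α) (h1 : α ≤ Real.pi / 2) (hC0 : C 0 = 0)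
    (hC : ∀ k, 1 ≤ k → |C k| = |Real.sin (k * α)| / (k * (Real.pi - α))) : Coef C (Real.cos α) := by
  have p1 := Real.pi_gt_d4
  have p2 := Real.pi_lt_d4
  have hs : 0 < Real.sin α := Real.sin_pos_of_pos_of_lt_pi h0 (by linarith)
  have hx0 : 0 ≤ Real.cos α := Real.cos_nonneg_of_mem_Icc ⟨by linarith, h1⟩
  have hsc := Real.sin_sq_add_cos_sq α
  have hx : Real.cos α ≤ Real.pi / 2 - α := by
    rw [← Real.sin_pi_div_two_sub]; exact Real.sin_le (by linarith)
  have hc : 0 < Real.pi - α := by linarith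
  have e1 : |C 1| = Real.sin α / (Real.pi - α) := by
    rw [hC 1 le_rfl]; simp [abs_of_pos hs]
  refine ⟨hC0, ?_, ?_, ?_, ?_, hx0, Real.cos_le_one _⟩
  · intro k hk
    have hk' : (0:ℝ) < k := by exact_mod_cast hk
    rw [hC k hk, div_mul_eq_mul_div, div_le_one (by positivity)]
    have := Real.abs_sin_le_one (k * α)
    calc |Real.sin (k * α)| * (k * (1.5707 + Real.cos α)) ≤ 1 * (k * (1.5707 + Real.cos α)) := by gcongr
      _ = k * (1.5707 + Real.cos α) := one_mul _
      _ ≤ _ := mul_le_mul_of_nonneg_left (by linarith) hk'.le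
  · intro k hk
    have hk' : (0:ℝ) < k := by exact_mod_cast hk
    rw [hC k hk, e1, sin_uu, abs_mul, abs_of_pos hs]
    field_simp
  · rw [e1, div_mul_eq_mul_div, div_le_iff₀ hc]
    have a1 : Real.sin α ≤ 1 - Real.cos α ^ 2 / 2 := by nlinarith [sq_nonneg (Real.sin α - 1)]
    exact mul_le_mul a1 (by linarith) (by linarith) (by linarith)
  · rw [e1, div_mul_eq_mul_div, le_div_iff₀ hc]
    have a1 : (1 - Real.cos α ^ 2) = Real.sin α * Real.sin α := by linarith [sq (Real.sin α)]
    rw [a1, mul_assoc]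
    refine mul_le_mul_of_nonneg_left ?_ hs.le
    have a2 : (Real.pi / 2 - α) * Real.sin α ≤ Real.cos α := by
      have := Real.le_tan (x := Real.pi / 2 - α) (by linarith) (by linarith)
      rw [Real.tan_eq_sin_div_cos, Real.sin_pi_div_two_sub, Real.cos_pi_div_two_sub, le_div_iff₀ hs] at this
      exact this
    have a3 := Real.sin_le_one α
    nlinarith

theorem coef_kp {a b c : ℝ} {q : ℝ → ℝ} (hc : c ∈ Set.Ioo (0:ℝ) Real.pi) (ha : a < 0) (hb : 0 < b)
    (habc : (b - a) * c = b * Real.pi)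
    (hqa : ∀ x ∈ Set.Icc (0:ℝ) c, q x = a) (hqb : ∀ x ∈ Set.Ioc c Real.pi, q x = b) :
    ∃ x < 1, Coef (fun k => cosCoefR q (k:ℤ) / max |a| b) x := by
  have hpi := Real.pi_pos
  obtain ⟨hc1, hc2⟩ := hc
  set M := max |a| b with hM
  have hMp : 0 < M := lt_of_lt_of_le hb (le_max_right _ _)
  obtain ⟨α, hα0, hα1, hMα, hsin⟩ : ∃ α, 0 < α ∧ α ≤ Real.pi / 2 ∧ M * Real.pi = (b - a) * (Real.pi - α) ∧
      ∀ k : ℕ, |Real.sin (k * c)| = |Real.sin (k * α)| := by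
    have hA : |a| = -a := abs_of_neg ha
    rcases le_total c (Real.pi / 2) with h | h
    · refine ⟨c, hc1, h, ?_, fun _ => rfl⟩
      have : M = -a := by
        rw [hM, hA]; apply max_eq_left
        by_contra hh; push Not at hh; nlinarith
      rw [this]; linarith
    · refine ⟨Real.pi - c, by linarith, by linarith, ?_, fun k => ?_⟩
      · have : M = b := by
          rw [hM, hA]; apply max_eq_right
          by_contra hh; push Not at hh; nlinarith
        rw [this]; linarith
      · rw [mul_sub, Real.sin_sub, Real.sin_nat_mul_pi, Real.cos_nat_mul_pi]
        simp [abs_mul]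
  refine ⟨Real.cos α, ?_, coef_of hα0 hα1 ?_ ?_⟩
  · have := Real.cos_lt_cos_of_nonneg_of_le_pi_div_two le_rfl hα1 hα0
    rwa [Real.cos_zero] at this
  · simp only [Nat.cast_zero]
    rw [coef_zero ⟨hc1, hc2⟩ habc hqa hqb, zero_div]
  · intro k hk
    have hk' : (0:ℝ) < k := by exact_mod_cast hk
    rw [coef_eq ⟨hc1, hc2⟩ hqa hqb (k:ℤ) (by exact_mod_cast (by omega : k ≠ 0)), abs_div, abs_div, abs_mul, abs_of_pos hMp,
      Int.cast_natCast, hsin k, abs_of_neg (by linarith : a - b < 0), abs_of_pos (by positivity : 0 < Real.pi * (k:ℝ)),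
      div_div, mul_comm Real.pi, mul_assoc, mul_comm Real.pi, hMα]
    have hba : 0 < b - a := by linarith
    have hpa : 0 < Real.pi - α := by linarith
    rw [div_eq_div_iff (by positivity) (by positivity)]
    ring
end KP


namespace KP

noncomputable def wt (n : ℕ) (lm : ℝ) (x : ℤ) : ℝ :=
  if x = (n:ℤ) ∨ x = -(n:ℤ) then 0 else 1 / (lm - (x:ℝ)^2)

noncomputable def VV (C : ℤ → ℝ) (n r : ℕ) (lm : ℝ) : ℕ → ℤ → ℝ
  | 0 => fun p => C (p - n) - C (p + n)
  | j + 1 => fun p => ∑ m ∈ Finset.Icc (-(r:ℤ)) r, C m * wt n lm (p + m) * VV C n r lm j (p + m)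

theorem psum_cons_zero {k : ℕ} (m : ℤ) (v : Fin k → ℤ) : psum (Fin.cons m v : Fin (k+1) → ℤ) 0 = m := by
  unfold psum
  rw [Finset.sum_filter, Fin.sum_univ_succ]
  simp

theorem psum_cons_succ {k : ℕ} (m : ℤ) (v : Fin k → ℤ) (j : Fin k) :
    psum (Fin.cons m v : Fin (k+1) → ℤ) j.succ = m + psum v j := by
  unfold psum
  rw [Finset.sum_filter, Fin.sum_univ_succ, Finset.sum_filter]
  simp

noncomputable def tm (C : ℤ → ℝ) (n : ℕ) (lm : ℝ) (k : ℕ) (p : ℤ) (v : Fin k → ℤ) : ℝ :=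
  (∏ i, C (v i)) * (∏ j, wt n lm (p + psum v j)) * (C (p + ∑ i, v i - n) - C (p + ∑ i, v i + n))

theorem sum_cons {k : ℕ} (S : Finset ℤ) (f : (Fin (k+1) → ℤ) → ℝ) :
    ∑ v ∈ Fintype.piFinset (fun _ : Fin (k+1) => S), f v
      = ∑ m ∈ S, ∑ v ∈ Fintype.piFinset (fun _ : Fin k => S), f (Fin.cons m v) := by
  rw [← Finset.sum_product']
  refine Finset.sum_nbij' (fun v => (v 0, Fin.tail v)) (fun x => Fin.cons x.1 x.2) ?_ ?_ ?_ ?_ ?_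
  · intro v hv
    simp only [Fintype.mem_piFinset, Finset.mem_product] at hv ⊢
    exact ⟨hv 0, fun i => hv i.succ⟩
  · rintro ⟨m, v⟩ hv
    simp only [Fintype.mem_piFinset, Finset.mem_product] at hv ⊢
    intro i
    refine Fin.cases ?_ (fun i => ?_) i
    · simpa using hv.1
    · simpa using hv.2 i
  · intro v _; simp
  · rintro ⟨m, v⟩ _; simp
  · intro v _; simp

theorem tm_cons {C : ℤ → ℝ} {n : ℕ} {lm : ℝ} {k : ℕ} (p m : ℤ) (v : Fin k → ℤ) :
    tm C n lm (k+1) p (Fin.cons m v) = C m * wt n lm (p + m) * tm C n lm k (p + m) v := by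
  unfold tm
  rw [Fin.prod_univ_succ, Fin.prod_univ_succ, Fin.sum_univ_succ]
  simp only [psum_cons_zero, psum_cons_succ, Fin.cons_zero, Fin.cons_succ, add_assoc]
  ring

theorem VV_eq {C : ℤ → ℝ} {n r : ℕ} {lm : ℝ} (k : ℕ) : ∀ p,
    VV C n r lm k p = ∑ v ∈ Fintype.piFinset (fun _ : Fin k => Finset.Icc (-(r:ℤ)) r), tm C n lm k p v := by
  induction k with
  | zero => intro p; simp [VV, tm]
  | succ k ih =>
    intro p
    rw [sum_cons]
    simp only [VV, tm_cons]
    refine Finset.sum_congr rfl fun m _ => ?_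
    rw [ih, Finset.mul_sum]

theorem aTerm_eq {C : ℤ → ℝ} {n : ℕ} {lm : ℝ} {k : ℕ} (v : Fin k → ℤ) :
    aTerm C n k lm v = tm C n lm k n v := by
  unfold aTerm tm
  split_ifs with h
  · have e : ∏ j, wt n lm (n + psum v j) = 1 / ∏ j, (lm - ((n : ℝ) + ((psum v j : ℤ) : ℝ))^2) := by
      rw [one_div, ← Finset.prod_inv_distrib]
      refine Finset.prod_congr rfl fun j _ => ?_
      have := h j
      unfold wt
      rw [if_neg (by omega)]
      push_cast
      rw [one_div]
    rw [e]
    have e1 : (n:ℤ) + ∑ i, v i - n = ∑ i, v i := by ring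
    have e2 : (n:ℤ) + ∑ i, v i + n = ∑ i, v i + 2 * n := by ring
    rw [e1, e2]
    ring
  · unfold adm at h
    push Not at h
    obtain ⟨j, hj⟩ := h
    have e : ∏ j, wt n lm (n + psum v j) = 0 := by
      apply Finset.prod_eq_zero (Finset.mem_univ j)
      unfold wt
      rw [if_pos]
      by_cases h0 : psum v j = 0
      · left; omega
      · right; have := hj h0; omega
    rw [e]; ring

theorem aTrunc_eq {C : ℤ → ℝ} {n r : ℕ} {lm : ℝ} (k : ℕ) : aTrunc C n k r lm = VV C n r lm k n := by
  unfold aTrunc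
  rw [VV_eq, tsum_eq_sum (s := Fintype.piFinset (fun _ : Fin k => Finset.Icc (-(r:ℤ)) r))]
  · refine Finset.sum_congr rfl fun v hv => ?_
    simp only [Fintype.mem_piFinset, Finset.mem_Icc] at hv
    rw [if_pos hv, aTerm_eq]
  · intro v hv
    simp only [Fintype.mem_piFinset, Finset.mem_Icc] at hv
    rw [if_neg hv]

theorem wt_neg {n : ℕ} {lm : ℝ} (x : ℤ) : wt n lm (-x) = wt n lm x := by
  unfold wt
  have : (-x = (n:ℤ) ∨ -x = -(n:ℤ)) ↔ (x = (n:ℤ) ∨ x = -(n:ℤ)) := by omega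
  simp only [this]
  push_cast
  simp

theorem VV_odd {C : ℤ → ℝ} {n r : ℕ} {lm : ℝ} (hC : ∀ k, C (-k) = C k) (k : ℕ) : ∀ p,
    VV C n r lm k (-p) = - VV C n r lm k p := by
  induction k with
  | zero =>
    intro p
    simp only [VV]
    rw [show -p - (n:ℤ) = -(p + n) by ring, show -p + (n:ℤ) = -(p - n) by ring, hC, hC]
    ring
  | succ k ih =>
    intro p
    simp only [VV]
    rw [← Finset.sum_neg_distrib]
    refine Finset.sum_nbij' (fun m => -m) (fun m => -m) ?_ ?_ ?_ ?_ ?_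
    · intro m hm; simp only [Finset.mem_Icc] at hm ⊢; omega
    · intro m hm; simp only [Finset.mem_Icc] at hm ⊢; omega
    · intro m _; simp
    · intro m _; simp
    · intro m _
      rw [show -p + m = -(p + -m) by ring, ih, wt_neg, hC]
      ring

theorem sum_symm (g : ℤ → ℝ) (R : ℕ) :
    ∑ x ∈ Finset.Icc (-(R:ℤ)) R, g x = g 0 + ∑ l ∈ Finset.Icc 1 R, (g l + g (-(l:ℤ))) := by
  induction R with
  | zero => simp
  | succ R ih =>
    rw [Finset.sum_Icc_succ_top (by omega)]
    have e : Finset.Icc (-((R+1:ℕ):ℤ)) ((R+1:ℕ):ℤ)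
      = insert (-((R+1:ℕ):ℤ)) (insert ((R+1:ℕ):ℤ) (Finset.Icc (-(R:ℤ)) R)) := by
      ext x; simp only [Finset.mem_Icc, Finset.mem_insert]; push_cast; omega
    rw [e, Finset.sum_insert, Finset.sum_insert, ih]
    · ring
    · simp
    · simp only [Finset.mem_Icc, Finset.mem_insert]; push_cast; omega

noncomputable def cC (C : ℤ → ℝ) (r : ℕ) (m : ℤ) : ℝ := if -(r:ℤ) ≤ m ∧ m ≤ r then C m else 0

theorem cC_neg {C : ℤ → ℝ} {r : ℕ} (hC : ∀ k, C (-k) = C k) (m : ℤ) : cC C r (-m) = cC C r m := by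
  unfold cC
  have : (-(r:ℤ) ≤ -m ∧ -m ≤ r) ↔ (-(r:ℤ) ≤ m ∧ m ≤ r) := by omega
  simp only [this, hC]

theorem VV_fold {C : ℤ → ℝ} {n r K : ℕ} {lm : ℝ} (hC : ∀ k, C (-k) = C k) (k p : ℕ) (hp : p + r ≤ n + K) :
    VV C n r lm (k+1) p = ∑ l ∈ sites n K, (cC C r (p - l) - cC C r (p + l)) * wt n lm l * VV C n r lm k l := by
  have e1 : VV C n r lm (k+1) p = ∑ x ∈ Finset.Icc (-((n+K:ℕ):ℤ)) ((n+K:ℕ):ℤ),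
      cC C r (x - p) * wt n lm x * VV C n r lm k x := by
    simp only [VV]
    have hsub : Finset.Icc ((p:ℤ)-r) (p+r) ⊆ Finset.Icc (-((n+K:ℕ):ℤ)) ((n+K:ℕ):ℤ) := by
      intro x hx; simp only [Finset.mem_Icc] at hx ⊢; push_cast; omega
    rw [← Finset.sum_subset hsub]
    · refine Finset.sum_nbij' (fun m => p + m) (fun x => x - p) ?_ ?_ ?_ ?_ ?_
      · intro m hm; simp only [Finset.mem_Icc] at hm ⊢; omega
      · intro m hm; simp only [Finset.mem_Icc] at hm ⊢; omega
      · intro m _; ring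
      · intro m _; ring
      · intro m hm
        simp only [Finset.mem_Icc] at hm
        rw [show (p:ℤ) + m - p = m by ring]
        unfold cC
        rw [if_pos hm]
    · intro x _ hx
      simp only [Finset.mem_Icc] at hx
      unfold cC
      rw [if_neg (by omega)]; ring
  rw [e1, sum_symm]
  have h0 : VV C n r lm k 0 = 0 := by
    have := VV_odd (n := n) (r := r) (lm := lm) hC k 0
    simp only [neg_zero] at this
    linarith
  rw [h0, mul_zero, zero_add]
  have hs : sites n K ⊆ Finset.Icc 1 (n+K) := Finset.erase_subset _ _
  rw [← Finset.sum_subset hs]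
  · refine Finset.sum_congr rfl fun l _ => ?_
    rw [VV_odd hC, wt_neg, show (l:ℤ) - p = -(p - l) by ring, show -(l:ℤ) - p = -(p + l) by ring, cC_neg hC, cC_neg hC]
    ring
  · intro l h1 h2
    have : l = n := by
      by_contra h
      exact h2 (Finset.mem_erase.2 ⟨h, h1⟩)
    subst this
    rw [wt_neg]
    simp [wt]

theorem cC_sub {C : ℤ → ℝ} {r : ℕ} {M : ℝ} (hM : 0 < M) (hC : ∀ k, C (-k) = C k) (p l : ℕ) :
    cC C r (p - l) - cC C r (p + l) = M * Tn (fun k => C (k:ℤ) / M) r p l := by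
  have h1 : cC C r ((p:ℤ) - l) = M * (if ad p l ≤ r then C ((ad p l : ℕ):ℤ) / M else 0) := by
    have : cC C r ((p:ℤ) - l) = cC C r ((ad p l : ℕ):ℤ) := by
      rcases le_total l p with h | h
      · congr 1; unfold ad; omega
      · rw [← cC_neg hC]; congr 1; unfold ad; omega
    rw [this]
    unfold cC
    split_ifs <;> first | omega | (simp; done) | field_simp
  have h2 : cC C r ((p:ℤ) + l) = M * (if p + l ≤ r then C ((p + l : ℕ):ℤ) / M else 0) := by
    unfold cC
    push_cast
    split_ifs <;> first | omega | (simp; done) | field_simp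
  rw [h1, h2]
  unfold Tn
  ring

theorem wt_eq {n : ℕ} {M t : ℝ} (hM : 0 < M) (l : ℕ) (hl : l ≠ n) (hl1 : 1 ≤ l) :
    wt n ((n:ℝ)^2 + t * M) l = Dn M n t l / M := by
  unfold wt Dn
  rw [if_neg (by omega), div_div]
  congr 1
  push_cast
  field_simp
  ring

theorem VV_it {C : ℤ → ℝ} {n r K : ℕ} {M t : ℝ} (hM : 0 < M) (hC : ∀ k, C (-k) = C k) (k : ℕ) :
    ∀ p : ℕ, p + r * k ≤ n + K → VV C n r ((n:ℝ)^2 + t * M) k p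
      = M * it (sites n K) (Tn (fun k => C (k:ℤ) / M) r) (Dn M n t) (fn (fun k => C (k:ℤ) / M) n) k p := by
  induction k with
  | zero =>
    intro p _
    simp only [VV, it, fn]
    have : C ((p:ℤ) - n) = C ((ad p n : ℕ):ℤ) := by
      rcases le_total n p with h | h
      · congr 1; unfold ad; omega
      · rw [← hC]; congr 1; unfold ad; omega
    rw [this]
    push_cast
    field_simp
  | succ k ih =>
    intro p hp
    have hp' : p + r * k + r ≤ n + K := by rw [mul_add, mul_one] at hp; omega
    rw [VV_fold (K := K) hC k p (by nlinarith [Nat.zero_le (r * k)])]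
    simp only [it]
    rw [Finset.mul_sum]
    refine Finset.sum_congr rfl fun l hl => ?_
    simp only [sites, Finset.mem_erase, Finset.mem_Icc] at hl
    rw [cC_sub hM hC, wt_eq hM l hl.1 hl.2.1]
    by_cases h : l ≤ p + r
    · rw [ih l (by omega)]
      simp only [sites]
      field_simp
    · have : Tn (fun k => C (k:ℤ) / M) r p l = 0 := by
        unfold Tn
        rw [if_neg (by unfold ad; omega), if_neg (by omega)]; ring
      rw [this]; ring

theorem gFun_eq {C : ℤ → ℝ} {n r s : ℕ} {M t : ℝ} (hM : 0 < M) (hC : ∀ k, C (-k) = C k) :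
    gFun C n r s ((n:ℝ)^2 + t * M) = M * Gn (fun k => C (k:ℤ) / M) M n r s (r * s + 8) t := by
  unfold gFun Gn
  rw [mul_add, Finset.mul_sum]
  congr 1
  · push_cast; field_simp
  · refine Finset.sum_nbij' (fun k => k - 1) (fun k => k + 1) ?_ ?_ ?_ ?_ ?_
    · intro k hk; simp only [Finset.mem_Icc, Finset.mem_range] at hk ⊢; omega
    · intro k hk; simp only [Finset.mem_Icc, Finset.mem_range] at hk ⊢; omega
    · intro k hk; simp only [Finset.mem_Icc] at hk; omega
    · intro k hk; omega
    · intro k hk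
      simp only [Finset.mem_Icc] at hk
      obtain ⟨j, rfl⟩ : ∃ j, k = j + 1 := ⟨k - 1, by omega⟩
      have hrs : r * (j + 1) ≤ r * s := Nat.mul_le_mul_left r hk.2
      rw [aTrunc_eq, VV_it (K := r * s + 8) hM hC (j+1) n (by omega)]
      simp only [it, aa, Nat.add_sub_cancel]
      congr 1
      refine Finset.sum_congr rfl fun l _ => ?_
      rw [Tn_symm]

theorem final {C : ℤ → ℝ} {n r s : ℕ} {M x : ℝ} (hC : ∀ k, C (-k) = C k) (hn : 1 ≤ n) (hM : 0 < M)
    (hMn : M ≤ n - 1/2) (hr : 1 ≤ r) (hs : 1 ≤ s) (hx : x < 1) (hco : Coef (fun k => C (k:ℤ) / M) x) :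
    ∃! rho : ℝ, rho ∈ Set.Icc ((n : ℝ)^2 - M) ((n : ℝ)^2 + M) ∧ rho = (n : ℝ)^2 + gFun C n r s rho := by
  obtain ⟨t, ⟨ht, h1⟩, h2⟩ := Gn_unique (K := r * s + 8) hn hM hMn (by omega) hr hs hco hx
  refine ⟨(n:ℝ)^2 + t * M, ⟨⟨by nlinarith [ht.1], by nlinarith [ht.2]⟩, ?_⟩, ?_⟩
  · rw [gFun_eq hM hC, ← h1]; ring
  · rintro rho ⟨⟨a1, a2⟩, a3⟩
    have e : rho = (n:ℝ)^2 + ((rho - (n:ℝ)^2) / M) * M := by field_simp; ring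
    rw [e]
    congr 2
    refine h2 _ ⟨⟨?_, ?_⟩, ?_⟩
    · rw [le_div_iff₀ hM]; linarith
    · rw [div_le_iff₀ hM]; linarith
    · rw [e, gFun_eq hM hC] at a3
      have : (rho - (n:ℝ)^2) / M * M = M * Gn (fun k => C (k:ℤ) / M) M n r s (r * s + 8) ((rho - (n:ℝ)^2) / M) := by
        linarith
      rw [mul_comm] at this
      exact mul_left_cancel₀ hM.ne' this

end KP


/-- Let `q` be the Kronig–Penney potential, `n ≥ 1` satisfying
Condition 1, and `r, s ≥ 1`. Then the equation `λ = n² + g_n(λ)` has exactly one solution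
in the interval `I_n = [n² − M, n² + M]`. -/
theorem stmt4
    (a b c : ℝ) (q : ℝ → ℝ)
    (hc : c ∈ Set.Ioo (0:ℝ) Real.pi) (ha : a < 0) (hb : 0 < b)
    (habc : (b - a) * c = b * Real.pi)
    (hqa : ∀ x ∈ Set.Icc (0:ℝ) c, q x = a)
    (hqb : ∀ x ∈ Set.Ioc c Real.pi, q x = b)
    (n r s : ℕ) (hn : 1 ≤ n) (hr : 1 ≤ r) (hs : 1 ≤ s)
    (hcond : Cond1 (max |a| b) n) :
    ∃! rho : ℝ, rho ∈ Set.Icc ((n : ℝ)^2 - max |a| b) ((n : ℝ)^2 + max |a| b) ∧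
      rho = (n : ℝ)^2 + gFun (cosCoefR q) n r s rho := by
  obtain ⟨x, hx, hcoef⟩ := KP.coef_kp hc ha hb habc hqa hqb
  have hMp : 0 < max |a| b := lt_of_lt_of_le hb (le_max_right _ _)
  refine KP.final (KP.coef_even q) hn hMp ?_ hr hs hx hcoef
  rcases eq_or_lt_of_le hn with h | h
  · have h1 := hcond.1 h.symm
    rw [← h]; push_cast; linarith
  · have h1 := hcond.2 h
    linarith
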